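/- Rigidity of bounded eternal solutions: one-dimensional symmetry and classification. Let w : R^N × R → R be a bounded function, C^2 in the space variable z = (z', z^{(N)}) ∈ R^{N-1} × R and C^1 in the time variable τ, solving w_τ = Δφ(w) + f(w) on all of R^N × R. Assume that w(z', z^{(N)}, τ) → α_- as z^{(N)} → -∞ uniformly in (z', τ), and w(z', z^{(N)}, τ) → α_+ as z^{(N)} → +∞ uniformly in (z', τ). Then there exists z* ∈ R such that w(z', z^{(N)}, τ) = U_0(z^{(N)} - z*) for all (z', z^{(N)}, τ) ∈ R^N × R, where U_0 is the unique strictly increasing standing wave solving (φ(U_0))'' + f(U_0) = 0 with U_0(-∞) = α_-, U_0(0) = α, U_0(+∞) = α_+. -/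

import Mathlib

open MeasureTheory Real Set Filter

/-- The Laplacian of `g : ℝ^N → ℝ` at `x`, as the sum of the pure second
derivatives in the coordinate directions. -/
noncomputable def lap {N : ℕ} (g : EuclideanSpace ℝ (Fin N) → ℝ)
    (x : EuclideanSpace ℝ (Fin N)) : ℝ :=
  ∑ i : Fin N, iteratedFDeriv ℝ 2 g x ![EuclideanSpace.single i 1, EuclideanSpace.single i 1]

/-- The partial derivative of `g` in the `i`-th coordinate direction. -/
noncomputable def pd {N : ℕ} (i : Fin N) (g : EuclideanSpace ℝ (Fin N) → ℝ)
    (x : EuclideanSpace ℝ (Fin N)) : ℝ :=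
  fderiv ℝ g x (EuclideanSpace.single i 1)

section Calculus

variable {N : ℕ} {i : Fin N} {g h : EuclideanSpace ℝ (Fin N) → ℝ}
  {x : EuclideanSpace ℝ (Fin N)}

lemma contDiff_pd {n : WithTop ℕ∞} (hg : ContDiff ℝ (n + 1) g) (i : Fin N) :
    ContDiff ℝ n (pd i g) :=
  (hg.fderiv_right le_rfl).clm_apply contDiff_const

lemma continuous_pd (hg : ContDiff ℝ 1 g) (i : Fin N) : Continuous (pd i g) :=
  (contDiff_pd (n := 0) (by simpa using hg) i).continuous

lemma contDiff_pd_one (hg : ContDiff ℝ 2 g) (i : Fin N) : ContDiff ℝ 1 (pd i g) :=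
  contDiff_pd (n := 1) (by simpa [one_add_one_eq_two] using hg) i

lemma lap_eq_sum_pd (hg : ContDiff ℝ 2 g) (x : EuclideanSpace ℝ (Fin N)) :
    lap g x = ∑ i, pd i (pd i g) x := by
  refine Finset.sum_congr rfl fun i _ => ?_
  rw [iteratedFDeriv_two_apply]
  have hd : DifferentiableAt ℝ (fderiv ℝ g) x :=
    ((hg.fderiv_right (m := 1) (by norm_num)).differentiable (by norm_num)) x
  unfold pd
  rw [fderiv_clm_apply hd (differentiableAt_const _)]
  simp

lemma pd_mul (hg : DifferentiableAt ℝ g x) (hh : DifferentiableAt ℝ h x) :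
    pd i (fun y => g y * h y) x = pd i g x * h x + g x * pd i h x := by
  unfold pd
  rw [fderiv_fun_mul hg hh]
  simp; ring

lemma pd_add (hg : DifferentiableAt ℝ g x) (hh : DifferentiableAt ℝ h x) :
    pd i (fun y => g y + h y) x = pd i g x + pd i h x := by
  unfold pd
  rw [fderiv_fun_add hg hh]
  simp

lemma pd_sub (hg : DifferentiableAt ℝ g x) (hh : DifferentiableAt ℝ h x) :
    pd i (fun y => g y - h y) x = pd i g x - pd i h x := by
  unfold pd
  rw [fderiv_fun_sub hg hh]
  simp

lemma pd_const_mul (c : ℝ) (hg : DifferentiableAt ℝ g x) :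
    pd i (fun y => c * g y) x = c * pd i g x := by
  unfold pd
  rw [fderiv_const_mul hg]
  simp

lemma pd_const (c : ℝ) : pd i (fun _ => c) x = 0 := by
  unfold pd; simp

lemma pd_comp {G : ℝ → ℝ} {G' : ℝ} (hG : HasDerivAt G G' (g x))
    (hg : DifferentiableAt ℝ g x) :
    pd i (fun y => G (g y)) x = G' * pd i g x := by
  unfold pd
  have := (hG.comp_hasFDerivAt x hg.hasFDerivAt).fderiv
  simp only [Function.comp_def] at this
  rw [this]; simp

lemma pd_coord (l : Fin N) : pd i (fun y => y l) x = if i = l then 1 else 0 := by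
  unfold pd
  have : (fun y : EuclideanSpace ℝ (Fin N) => y l) = EuclideanSpace.proj (𝕜 := ℝ) l := by
    ext y; simp
  rw [this, ContinuousLinearMap.fderiv]
  simp [eq_comm]

lemma contDiff_coord {n : WithTop ℕ∞} (l : Fin N) :
    ContDiff ℝ n (fun y : EuclideanSpace ℝ (Fin N) => y l) :=
  (EuclideanSpace.proj (𝕜 := ℝ) l).contDiff

lemma tsupport_pd_subset (g : EuclideanSpace ℝ (Fin N) → ℝ) (i : Fin N) :
    tsupport (pd i g) ⊆ tsupport g := by
  refine (closure_mono ?_).trans (tsupport_fderiv_subset ℝ (f := g))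
  intro y hy
  contrapose! hy
  simp only [Function.mem_support, not_not] at hy ⊢
  simp [pd, hy]

lemma hasCompactSupport_pd (hg : HasCompactSupport g) (i : Fin N) :
    HasCompactSupport (pd i g) :=
  hg.mono' ((subset_tsupport _).trans (tsupport_pd_subset g i))

lemma integral_pd_eq_zero (hg : ContDiff ℝ 1 g) (hc : HasCompactSupport g) (i : Fin N) :
    ∫ x, pd i g x = 0 := by
  have h := integral_mul_fderiv_eq_neg_fderiv_mul_of_integrable
    (μ := (volume : Measure (EuclideanSpace ℝ (Fin N))))
    (f := fun _ => (1 : ℝ)) (g := g) (v := EuclideanSpace.single i 1)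
    (by simp)
    (by
      simp only [one_mul]
      exact (continuous_pd hg i).integrable_of_hasCompactSupport (hasCompactSupport_pd hc i))
    (by simpa using hg.continuous.integrable_of_hasCompactSupport hc)
    (fun x _ => by fun_prop)
    (fun x _ => (hg.differentiable (by norm_num)) x)
  simpa [pd] using h

end Calculus

/-- A bounded open subset of the line is a countable disjoint union of open intervals whose
endpoints lie outside the set. -/
lemma exists_iUnion_Ioo_of_isOpen {O : Set ℝ} (hO : IsOpen O) {a b : ℝ} (hab : O ⊆ Ioo a b) :
    ∃ (ι : Type) (_ : Countable ι) (c d : ι → ℝ), (∀ i, c i < d i) ∧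
      Pairwise (Function.onFun Disjoint fun i => Ioo (c i) (d i)) ∧
      (⋃ i, Ioo (c i) (d i)) = O ∧ ∀ i, c i ∉ O ∧ d i ∉ O := by
  set S := ordConnectedSection O
  have hSO : S ⊆ O := ordConnectedSection_subset
  have hopen (x : ℝ) : IsOpen (ordConnectedComponent O x) := by
    rw [isOpen_iff_mem_nhds]
    intro y hy
    rw [ordConnectedComponent_eq (mem_ordConnectedComponent.1 hy)]
    exact ordConnectedComponent_mem_nhds.2 (hO.mem_nhds (ordConnectedComponent_subset hy))
  have hsub (x : ℝ) : ordConnectedComponent O x ⊆ Ioo a b :=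
    ordConnectedComponent_subset.trans hab
  have hIoo (x : S) : ordConnectedComponent O x.1 =
      Ioo (sInf (ordConnectedComponent O x.1)) (sSup (ordConnectedComponent O x.1)) := by
    have hne : (ordConnectedComponent O x.1).Nonempty :=
      nonempty_ordConnectedComponent.2 (hSO x.2)
    have hbb : BddBelow (ordConnectedComponent O x.1) := bddBelow_Ioo.mono (hsub _)
    have hba : BddAbove (ordConnectedComponent O x.1) := bddAbove_Ioo.mono (hsub _)
    apply Subset.antisymm
    · intro y hy
      obtain ⟨ε, hε, hball⟩ := Metric.isOpen_iff.1 (hopen x.1) y hy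
      constructor
      · refine (csInf_le hbb (hball (?_ : y - ε / 2 ∈ _))).trans_lt (by linarith)
        rw [Metric.mem_ball, Real.dist_eq, show y - ε / 2 - y = -(ε / 2) by ring, abs_neg,
          abs_of_pos (by linarith)]
        linarith
      · refine lt_of_lt_of_le (by linarith : y < y + ε / 2)
          (le_csSup hba (hball (?_ : y + ε / 2 ∈ _)))
        rw [Metric.mem_ball, Real.dist_eq, show y + ε / 2 - y = (ε / 2) by ring,
          abs_of_pos (by linarith)]
        linarith
    · rintro y ⟨h1, h2⟩
      obtain ⟨p, hp, hpy⟩ := exists_lt_of_csInf_lt hne h1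
      obtain ⟨q, hq, hqy⟩ := exists_lt_of_lt_csSup hne h2
      exact (inferInstance : OrdConnected (ordConnectedComponent O x.1)).out hp hq
        ⟨hpy.le, hqy.le⟩
  have hdisj : Pairwise (Function.onFun Disjoint fun x : S => ordConnectedComponent O x.1) := by
    intro x y hxy
    rw [Function.onFun, Set.disjoint_left]
    intro z hz1 hz2
    apply hxy
    apply Subtype.ext
    refine eq_of_mem_ordConnectedSection_of_uIcc_subset x.2 y.2 ?_
    exact mem_ordConnectedComponent_trans hz1 (mem_ordConnectedComponent_comm.1 hz2)
  have hlt (x : S) : sInf (ordConnectedComponent O x.1) < sSup (ordConnectedComponent O x.1) := by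
    have : x.1 ∈ ordConnectedComponent O x.1 := self_mem_ordConnectedComponent.2 (hSO x.2)
    rw [hIoo x] at this
    exact this.1.trans this.2
  have hend (x : S) (e : ℝ) (he : e ∈ O) (hcl : e ∈ closure (ordConnectedComponent O x.1)) :
      e ∈ ordConnectedComponent O x.1 := by
    have h1 : ordConnectedComponent O e ∈ nhds e :=
      ordConnectedComponent_mem_nhds.2 (hO.mem_nhds he)
    obtain ⟨y, hy1, hy2⟩ := mem_closure_iff_nhds.1 hcl _ h1
    exact mem_ordConnectedComponent_trans hy2 (mem_ordConnectedComponent_comm.1 hy1)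
  refine ⟨S, ?_, fun x => sInf (ordConnectedComponent O x.1),
    fun x => sSup (ordConnectedComponent O x.1), hlt, ?_, ?_, ?_⟩
  · have h1 : (univ : Set S).PairwiseDisjoint fun x : S => ordConnectedComponent O x.1 :=
      fun x _ y _ hxy => hdisj hxy
    exact countable_univ_iff.1 (h1.countable_of_isOpen (fun x _ => hopen x.1)
      (fun x _ => nonempty_ordConnectedComponent.2 (hSO x.2)))
  · intro x y hxy
    have := hdisj hxy
    simp only [Function.onFun] at this ⊢
    rwa [← hIoo x, ← hIoo y]
  · apply Subset.antisymm
    · refine iUnion_subset fun x => ?_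
      rw [← hIoo x]
      exact ordConnectedComponent_subset
    · intro y hy
      refine mem_iUnion.2 ⟨⟨ordConnectedProj O ⟨y, hy⟩, mem_range_self _⟩, ?_⟩
      rw [← hIoo ⟨ordConnectedProj O ⟨y, hy⟩, mem_range_self _⟩]
      exact mem_ordConnectedComponent_ordConnectedProj O ⟨y, hy⟩
  · intro x
    have hcl : closure (ordConnectedComponent O x.1) =
        Icc (sInf (ordConnectedComponent O x.1)) (sSup (ordConnectedComponent O x.1)) := by
      conv_lhs => rw [hIoo x]
      exact closure_Ioo (hlt x).ne
    constructor
    · intro he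
      have := hend x _ he (by rw [hcl]; exact left_mem_Icc.2 (hlt x).le)
      rw [hIoo x] at this
      exact lt_irrefl _ this.1
    · intro he
      have := hend x _ he (by rw [hcl]; exact right_mem_Icc.2 (hlt x).le)
      rw [hIoo x] at this
      exact lt_irrefl _ this.2

section ChainRule

variable {N : ℕ}

/-- `B` is an integrand with time derivative `β`, supported in a ball, controlled by `w`, and such
that the integral of `β` is bounded above. -/
structure IsAdm (w : EuclideanSpace ℝ (Fin N) → ℝ → ℝ) (r a b : ℝ)
    (B β : EuclideanSpace ℝ (Fin N) → ℝ → ℝ) (C : ℝ) : Prop where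
  cont : ∀ t ∈ Icc a b, Continuous fun z => B z t
  cont' : ∀ t ∈ Icc a b, Continuous fun z => β z t
  deriv : ∀ z, ∀ t ∈ Icc a b, HasDerivAt (B z) (β z t) t
  contTime : ∀ z, ContinuousOn (β z) (Icc a b)
  supp : ∀ z, r < ‖z‖ → ∀ t ∈ Icc a b, B z t = 0
  supp' : ∀ z, r < ‖z‖ → ∀ t ∈ Icc a b, β z t = 0
  bdd : ∀ z, ∀ t ∈ Icc a b, |B z t| ≤ C
  lip : ∀ z, ∀ s ∈ Icc a b, ∀ t ∈ Icc a b, |B z t - B z s| ≤ C * (|t - s| + |w z t - w z s|)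
  dbdd : ∀ z, ∀ t ∈ Icc a b, |β z t| ≤ C * (1 + |_root_.deriv (w z) t|)
  upper : ∀ t ∈ Icc a b, ∫ z, β z t ≤ C

lemma IsAdm.mono {w : EuclideanSpace ℝ (Fin N) → ℝ → ℝ} {r a b a' b' C : ℝ}
    {B β : EuclideanSpace ℝ (Fin N) → ℝ → ℝ}
    (h : IsAdm w r a b B β C) (ha : a ≤ a') (hb : b' ≤ b) : IsAdm w r a' b' B β C := by
  have hs : Icc a' b' ⊆ Icc a b := Icc_subset_Icc ha hb
  exact ⟨fun t ht => h.cont t (hs ht), fun t ht => h.cont' t (hs ht),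
    fun z t ht => h.deriv z t (hs ht), fun z => (h.contTime z).mono hs,
    fun z hz t ht => h.supp z hz t (hs ht), fun z hz t ht => h.supp' z hz t (hs ht),
    fun z t ht => h.bdd z t (hs ht), fun z s hs' t ht => h.lip z s (hs hs') t (hs ht),
    fun z t ht => h.dbdd z t (hs ht), fun t ht => h.upper t (hs ht)⟩

lemma integrable_of_eq_zero {F : EuclideanSpace ℝ (Fin N) → ℝ} (hF : Continuous F) {r : ℝ}
    (h0 : ∀ z, r < ‖z‖ → F z = 0) : Integrable F := by
  refine hF.integrable_of_hasCompactSupport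
    (HasCompactSupport.intro (isCompact_closedBall 0 r) fun z hz => h0 z ?_)
  simpa using hz

/-- The balance law on a time interval. -/
def Balance (a b : ℝ) (B β : EuclideanSpace ℝ (Fin N) → ℝ → ℝ) : Prop :=
  IntervalIntegrable (fun t => ∫ z, β z t) volume a b ∧
    (∫ z, B z b) - (∫ z, B z a) = ∫ t in a..b, ∫ z, β z t

/-- The balance law holds on `[a, b]` for all admissible integrands supported inside the ball of
radius `R`. -/
def BalancedOn (w : EuclideanSpace ℝ (Fin N) → ℝ → ℝ) (R a b : ℝ) : Prop :=
  ∀ r < R, ∀ B β C, IsAdm w r a b B β C → Balance a b B β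

variable {w : EuclideanSpace ℝ (Fin N) → ℝ → ℝ} {R : ℝ}

lemma BalancedOn.trans {a b c : ℝ} (hab : a ≤ b) (hbc : b ≤ c) (h1 : BalancedOn w R a b)
    (h2 : BalancedOn w R b c) : BalancedOn w R a c := by
  intro r hr B β C h
  obtain ⟨i1, e1⟩ := h1 r hr B β C (h.mono le_rfl hbc)
  obtain ⟨i2, e2⟩ := h2 r hr B β C (h.mono hab le_rfl)
  refine ⟨i1.trans i2, ?_⟩
  rw [← intervalIntegral.integral_add_adjacent_intervals i1 i2]
  linarith

lemma BalancedOn.refl (a : ℝ) : BalancedOn w R a a := by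
  intro r hr B β C h
  exact ⟨IntervalIntegrable.refl, by simp⟩

lemma balancedOn_of_local {s : Set ℝ} (hs : IsPreconnected s)
    (hloc : ∀ t ∈ s, ∃ ε > 0, ∀ a ∈ Ioo (t - ε) (t + ε), ∀ b ∈ Ioo (t - ε) (t + ε), a ≤ b →
      BalancedOn w R a b) {a b : ℝ} (ha : a ∈ s) (hb : b ∈ s) (hab : a ≤ b) :
    BalancedOn w R a b := by
  let P : ℝ → ℝ → Prop := fun x y => ∀ a ∈ uIcc x y, ∀ b ∈ uIcc x y, a ≤ b → BalancedOn w R a b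
  have hP : P a b := by
    refine hs.induction₂' P ?_ ?_ ha hb
    · intro x hx
      obtain ⟨ε, hε, h⟩ := hloc x hx
      have : ∀ᶠ y in nhdsWithin x s, y ∈ Ioo (x - ε) (x + ε) :=
        nhdsWithin_le_nhds (Ioo_mem_nhds (by linarith) (by linarith))
      have key : ∀ y ∈ Ioo (x - ε) (x + ε), P x y := by
        intro y hy a ha b hb hab
        have hsub : uIcc x y ⊆ Ioo (x - ε) (x + ε) :=
          ordConnected_Ioo.uIcc_subset ⟨by linarith, by linarith⟩ hy
        exact h a (hsub ha) b (hsub hb) hab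
      filter_upwards [this] with y hy
      refine ⟨key y hy, ?_⟩
      intro a ha b hb
      rw [uIcc_comm] at ha hb
      exact key y hy a ha b hb
    · intro x y z _ _ _ hxy hyz a ha b hb hab
      simp only [P, mem_uIcc] at *
      have hya : ∀ c, y ≤ c → c ≤ a → False ∨ True := fun _ _ _ => Or.inr trivial
      by_cases h1 : (x ≤ a ∧ a ≤ y ∨ y ≤ a ∧ a ≤ x) ∧ (x ≤ b ∧ b ≤ y ∨ y ≤ b ∧ b ≤ x)
      · exact hxy a h1.1 b h1.2 hab
      by_cases h2 : (y ≤ a ∧ a ≤ z ∨ z ≤ a ∧ a ≤ y) ∧ (y ≤ b ∧ b ≤ z ∨ z ≤ b ∧ b ≤ y)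
      · exact hyz a h2.1 b h2.2 hab
      have hay : a ≤ y := by grind
      have hyb : y ≤ b := by grind
      refine BalancedOn.trans hay hyb ?_ ?_
      · rcases le_total x z with h | h
        · exact hxy a (by grind) y (by grind) hay
        · exact hyz a (by grind) y (by grind) hay
      · rcases le_total x z with h | h
        · exact hyz y (by grind) b (by grind) hyb
        · exact hxy y (by grind) b (by grind) hyb
  exact hP a left_mem_uIcc b right_mem_uIcc hab

lemma IsAdm.integrable {r a b C : ℝ} {B β : EuclideanSpace ℝ (Fin N) → ℝ → ℝ}
    (h : IsAdm w r a b B β C) {t : ℝ} (ht : t ∈ Icc a b) : Integrable fun z => B z t :=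
  integrable_of_eq_zero (h.cont t ht) fun z hz => h.supp z hz t ht

lemma IsAdm.abs_sub_le {r a b C : ℝ} {B β : EuclideanSpace ℝ (Fin N) → ℝ → ℝ}
    (h : IsAdm w r a b B β C) {s t : ℝ} (hs : s ∈ Icc a b) (ht : t ∈ Icc a b) :
    |(∫ z, B z t) - ∫ z, B z s| ≤ 2 * C * (volume (Metric.closedBall
      (0 : EuclideanSpace ℝ (Fin N)) r)).toReal := by
  rw [← integral_sub (h.integrable ht) (h.integrable hs),
    ← setIntegral_eq_integral_of_forall_compl_eq_zero
      (s := Metric.closedBall (0 : EuclideanSpace ℝ (Fin N)) r)]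
  · rw [← Real.norm_eq_abs]
    refine norm_setIntegral_le_of_norm_le_const (μ := volume)
      (isCompact_closedBall (0 : EuclideanSpace ℝ (Fin N)) r).measure_lt_top
      (fun z _ => ?_)
    rw [Real.norm_eq_abs]
    linarith [abs_sub (B z t) (B z s), h.bdd z t ht, h.bdd z s hs]
  · intro z hz
    have : r < ‖z‖ := by simpa using hz
    rw [h.supp z this t ht, h.supp z this s hs, sub_zero]

lemma IsAdm.continuousOn {r a b C : ℝ} {B β : EuclideanSpace ℝ (Fin N) → ℝ → ℝ}
    (h : IsAdm w r a b B β C) : ContinuousOn (fun t => ∫ z, B z t) (Icc a b) := by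
  refine continuousOn_of_dominated
    (bound := (Metric.closedBall (0 : EuclideanSpace ℝ (Fin N)) r).indicator fun _ => C)
    (fun t ht => (h.cont t ht).aestronglyMeasurable) (fun t ht => ae_of_all _ fun z => ?_) ?_
    (ae_of_all _ fun z => fun t ht => (h.deriv z t ht).continuousAt.continuousWithinAt)
  · by_cases hz : z ∈ Metric.closedBall (0 : EuclideanSpace ℝ (Fin N)) r
    · rw [indicator_of_mem hz]; exact h.bdd z t ht
    · rw [indicator_of_notMem hz, h.supp z (by simpa using hz) t ht, norm_zero]
  · exact (integrableOn_const (isCompact_closedBall _ _).measure_lt_top.ne).integrable_indicator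
      measurableSet_closedBall

lemma IsAdm.integrableOn {r a b C : ℝ} {B β : EuclideanSpace ℝ (Fin N) → ℝ → ℝ}
    (h : IsAdm w r a b B β C) (hab : a < b)
    (hbal : ∀ a' ∈ Ioo a b, ∀ b' ∈ Ioo a b, a' ≤ b' → Balance a' b' B β) :
    IntegrableOn (fun t => ∫ z, β z t) (Ioc a b) := by
  set V := (volume (Metric.closedBall (0 : EuclideanSpace ℝ (Fin N)) r)).toReal
  have hC : 0 ≤ C := (abs_nonneg _).trans (h.bdd 0 a (left_mem_Icc.2 hab.le))
  have hV : 0 ≤ V := ENNReal.toReal_nonneg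
  set δ := (b - a) / 2
  have hδ' : b - a = 2 * δ := by simp only [δ]; ring
  have hδ : 0 < δ := by linarith
  have hu : Tendsto (fun n : ℕ => δ / ((n : ℝ) + 2)) atTop (nhds 0) :=
    tendsto_const_nhds.div_atTop
      (tendsto_atTop_add_const_right _ _ tendsto_natCast_atTop_atTop)
  have hpos (n : ℕ) : 0 < δ / ((n : ℝ) + 2) := by positivity
  have hle (n : ℕ) : δ / ((n : ℝ) + 2) ≤ δ / 2 := by gcongr; linarith [n.cast_nonneg (α := ℝ)]
  have ha' (n : ℕ) : a + δ / ((n : ℝ) + 2) ∈ Ioo a b :=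
    ⟨by linarith [hpos n], by linarith [hle n, hpos n]⟩
  have hb' (n : ℕ) : b - δ / ((n : ℝ) + 2) ∈ Ioo a b :=
    ⟨by linarith [hle n, hpos n], by linarith [hpos n]⟩
  have hab' (n : ℕ) : a + δ / ((n : ℝ) + 2) ≤ b - δ / ((n : ℝ) + 2) := by
    linarith [hle n, hpos n]
  refine integrableOn_Ioc_of_intervalIntegral_norm_bounded (l := atTop)
    (I := 2 * C * (b - a) + 2 * C * V)
    (a := fun n : ℕ => a + δ / ((n : ℝ) + 2)) (b := fun n : ℕ => b - δ / ((n : ℝ) + 2))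
    (fun n => ?_) (by simpa using hu.const_add a) (by simpa using hu.const_sub b)
    (Eventually.of_forall fun n => ?_)
  · exact ((intervalIntegrable_iff_integrableOn_Ioc_of_le (hab' n)).1
      (hbal _ (ha' n) _ (hb' n) (hab' n)).1)
  · obtain ⟨hi, he⟩ := hbal _ (ha' n) _ (hb' n) (hab' n)
    have h1 : ∀ t ∈ Ioc (a + δ / ((n : ℝ) + 2)) (b - δ / ((n : ℝ) + 2)),
        ‖∫ z, β z t‖ ≤ 2 * C - ∫ z, β z t := by
      intro t ht
      have := h.upper t ⟨((ha' n).1.trans ht.1).le, ht.2.trans (hb' n).2.le⟩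
      rw [Real.norm_eq_abs, abs_le]
      constructor <;> linarith
    have hbd := h.abs_sub_le (s := a + δ / ((n : ℝ) + 2)) (t := b - δ / ((n : ℝ) + 2))
      ⟨(ha' n).1.le, (ha' n).2.le⟩ ⟨(hb' n).1.le, (hb' n).2.le⟩
    calc _ ≤ ∫ t in (a + δ / ((n : ℝ) + 2))..(b - δ / ((n : ℝ) + 2)), (2 * C - ∫ z, β z t) := by
            rw [intervalIntegral.integral_of_le (hab' n), ]
            refine setIntegral_mono_on hi.1.norm
              ((intervalIntegrable_const.sub hi).1) measurableSet_Ioc h1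
      _ = 2 * C * ((b - δ / ((n : ℝ) + 2)) - (a + δ / ((n : ℝ) + 2))) -
          ((∫ z, B z (b - δ / ((n : ℝ) + 2))) - ∫ z, B z (a + δ / ((n : ℝ) + 2))) := by
            rw [intervalIntegral.integral_sub intervalIntegrable_const hi, he]
            simp; ring
      _ ≤ 2 * C * (b - a) + 2 * C * V := by
            have h2 : 2 * C * ((b - δ / ((n : ℝ) + 2)) - (a + δ / ((n : ℝ) + 2))) ≤
                2 * C * (b - a) := by
              gcongr 2 * C * ?_
              linarith [hpos n]
            linarith [(abs_le.1 hbd).1]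

lemma IsAdm.balance_of_Ioo {r a b C : ℝ} {B β : EuclideanSpace ℝ (Fin N) → ℝ → ℝ}
    (h : IsAdm w r a b B β C) (hab : a < b)
    (hbal : ∀ a' ∈ Ioo a b, ∀ b' ∈ Ioo a b, a' ≤ b' → Balance a' b' B β) :
    Balance a b B β := by
  have hi := h.integrableOn hab hbal
  have hii : IntervalIntegrable (fun t => ∫ z, β z t) volume a b :=
    (intervalIntegrable_iff_integrableOn_Ioc_of_le hab.le).2 hi
  refine ⟨hii, ?_⟩
  set c := (a + b) / 2
  have hc : c ∈ Ioo a b := ⟨by simp only [c]; linarith, by simp only [c]; linarith⟩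
  have hcont : ContinuousOn (fun x => ∫ t in c..x, ∫ z, β z t) (Icc a b) := by
    have := intervalIntegral.continuousOn_primitive_interval' hii
      (by rw [uIcc_of_le hab.le]; exact Ioo_subset_Icc_self hc)
    rwa [uIcc_of_le hab.le] at this
  have heq : EqOn (fun x => ∫ t in c..x, ∫ z, β z t) (fun x => (∫ z, B z x) - ∫ z, B z c)
      (Ioo a b) := by
    intro x hx
    rcases le_total c x with hcx | hxc
    · exact (hbal c hc x hx hcx).2.symm
    · simp only
      rw [intervalIntegral.integral_symm, ← (hbal x hx c hc hxc).2]
      ring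
  have heq' := heq.of_subset_closure hcont (h.continuousOn.sub continuousOn_const)
    Ioo_subset_Icc_self (closure_Ioo hab.ne).ge
  have e1 := heq' (left_mem_Icc.2 hab.le)
  have e2 := heq' (right_mem_Icc.2 hab.le)
  simp only at e1 e2
  have hca : IntervalIntegrable (fun t => ∫ z, β z t) volume a c :=
    hii.mono_set (by rw [uIcc_of_le hab.le, uIcc_of_le hc.1.le]; exact Icc_subset_Icc_right hc.2.le)
  have hcb : IntervalIntegrable (fun t => ∫ z, β z t) volume c b :=
    hii.mono_set (by rw [uIcc_of_le hab.le, uIcc_of_le hc.2.le]; exact Icc_subset_Icc_left hc.1.le)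
  rw [← intervalIntegral.integral_add_adjacent_intervals hca hcb, e2,
    intervalIntegral.integral_symm, e1]
  ring

lemma balancedOn_of_Ioo {a b : ℝ} (hab : a ≤ b)
    (hbal : ∀ a' ∈ Ioo a b, ∀ b' ∈ Ioo a b, a' ≤ b' → BalancedOn w R a' b') :
    BalancedOn w R a b := by
  rcases hab.eq_or_lt with rfl | hlt
  · exact BalancedOn.refl a
  · intro r hr B β C h
    exact h.balance_of_Ioo hlt fun a' ha' b' hb' hab' =>
      hbal a' ha' b' hb' hab' r hr B β C (h.mono ha'.1.le hb'.2.le)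

end ChainRule

section ChainRule

variable {N : ℕ} {w : EuclideanSpace ℝ (Fin N) → ℝ → ℝ} {R : ℝ}

lemma IsAdm.ball_integral {r a b C : ℝ} {B β : EuclideanSpace ℝ (Fin N) → ℝ → ℝ}
    (h : IsAdm w r a b B β C) {t : ℝ} (ht : t ∈ Icc a b) :
    ∫ z in Metric.closedBall 0 r, B z t = ∫ z, B z t :=
  setIntegral_eq_integral_of_forall_compl_eq_zero fun z hz => h.supp z (by simpa using hz) t ht

lemma IsAdm.ball_integral' {r a b C : ℝ} {B β : EuclideanSpace ℝ (Fin N) → ℝ → ℝ}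
    (h : IsAdm w r a b B β C) {t : ℝ} (ht : t ∈ Icc a b) :
    ∫ z in Metric.closedBall 0 r, β z t = ∫ z, β z t :=
  setIntegral_eq_integral_of_forall_compl_eq_zero fun z hz => h.supp' z (by simpa using hz) t ht

lemma IsAdm.intervalIntegral_eq {r a b C : ℝ} {B β : EuclideanSpace ℝ (Fin N) → ℝ → ℝ}
    (h : IsAdm w r a b B β C) (z : EuclideanSpace ℝ (Fin N)) {c d : ℝ} (hc : a ≤ c) (hcd : c ≤ d)
    (hd : d ≤ b) : ∫ t in Ioo c d, β z t = B z d - B z c := by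
  have hs : Icc c d ⊆ Icc a b := Icc_subset_Icc hc hd
  rw [← integral_Ioc_eq_integral_Ioo, ← intervalIntegral.integral_of_le hcd]
  refine intervalIntegral.integral_eq_sub_of_hasDerivAt (fun t ht => ?_) ?_
  · rw [uIcc_of_le hcd] at ht
    exact h.deriv z t (hs ht)
  · exact ((h.contTime z).mono hs).intervalIntegrable_of_Icc hcd

lemma IsAdm.prod_integrable {r a b C n : ℝ} {B β : EuclideanSpace ℝ (Fin N) → ℝ → ℝ}
    (h : IsAdm w r a b B β C) (hab : a ≤ b) {S : Set ℝ} (hS : MeasurableSet S) (hSab : S ⊆ Icc a b)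
    (hn : ∀ t ∈ S, ∀ z, ‖z‖ ≤ r → |_root_.deriv (w z) t| ≤ n) :
    Integrable (Function.uncurry β)
      ((volume.restrict (Metric.closedBall 0 r)).prod (volume.restrict S)) := by
  have hC : 0 ≤ C := (abs_nonneg _).trans (h.bdd 0 a (left_mem_Icc.2 hab))
  rw [Measure.prod_restrict]
  have hmS : MeasurableSet (Metric.closedBall (0 : EuclideanSpace ℝ (Fin N)) r ×ˢ S) :=
    measurableSet_closedBall.prod hS
  set πt : ℝ → ℝ := fun t => max a (min b t)
  have hπ (t : ℝ) : πt t ∈ Icc a b := ⟨le_max_left _ _, max_le hab (min_le_left _ _)⟩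
  have hπc : Continuous πt := by fun_prop
  have hπeq (t : ℝ) (ht : t ∈ Icc a b) : πt t = t := by
    simp only [πt]; rw [min_eq_right ht.2, max_eq_right ht.1]
  have hmeas : Measurable (Function.uncurry fun z t => β z (πt t)) := by
    refine measurable_uncurry_of_continuous_of_measurable (fun t => h.cont' _ (hπ t)) fun z => ?_
    exact ((h.contTime z).comp_continuous hπc hπ).measurable
  have h_int : IntegrableOn (Function.uncurry fun z t => β z (πt t))
      (Metric.closedBall (0 : EuclideanSpace ℝ (Fin N)) r ×ˢ S) (volume.prod volume) := by
    refine Measure.integrableOn_of_bounded (M := C * (1 + n)) ?_ hmeas.aestronglyMeasurable ?_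
    · rw [Measure.prod_prod]
      refine (ENNReal.mul_lt_top (isCompact_closedBall _ _).measure_lt_top ?_).ne
      exact (measure_mono hSab).trans_lt (by simp)
    · refine (ae_restrict_iff' hmS).2 (ae_of_all _ ?_)
      rintro ⟨z, t⟩ ⟨hz, ht⟩
      simp only [Function.uncurry]
      rw [hπeq t (hSab ht)]
      refine (h.dbdd z t (hSab ht)).trans ?_
      gcongr
      exact hn t ht z (by simpa using hz)
  refine h_int.congr_fun ?_ hmS
  rintro ⟨z, t⟩ ⟨hz, ht⟩
  simp only [Function.uncurry]
  rw [hπeq t (hSab ht)]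

/-- If the time derivative of `w` is bounded on a closed set of times and the balance law holds
across the complementary gaps, then it holds throughout. -/
lemma balancedOn_of_gaps
    (hkato : ∀ r < R, ∀ n : ℝ, ∃ C, ∀ c d, c ≤ d → BalancedOn w R c d →
      (∀ z, ‖z‖ ≤ R → |deriv (w z) c| ≤ n) →
      ∫ z in Metric.closedBall 0 r, |w z d - w z c| ≤ C * (d - c))
    (hwz : ∀ t, Continuous fun z => w z t)
    {E : Set ℝ} (hE : IsClosed E) {a b n : ℝ} (hab : a < b)
    (hn : ∀ t ∈ E, t ∈ Icc a b → ∀ z, ‖z‖ ≤ R → |deriv (w z) t| ≤ n)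
    (hgap : ∀ c d, a ≤ c → c ≤ d → d ≤ b → (∀ t ∈ Ioo c d, t ∉ E) → BalancedOn w R c d) :
    BalancedOn w R a b := by
  intro r hr B β C h
  have hC : 0 ≤ C := (abs_nonneg _).trans (h.bdd 0 a (left_mem_Icc.2 hab.le))
  obtain ⟨CK, hCK0, hCK⟩ : ∃ CK, 0 ≤ CK ∧ ∀ c d, c ≤ d → BalancedOn w R c d →
      (∀ z, ‖z‖ ≤ R → |deriv (w z) c| ≤ n) →
      ∫ z in Metric.closedBall 0 r, |w z d - w z c| ≤ CK * (d - c) := by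
    obtain ⟨CK, hCK⟩ := hkato r hr n
    refine ⟨|CK|, abs_nonneg _, fun c d hcd h1 h2 => (hCK c d hcd h1 h2).trans ?_⟩
    have : 0 ≤ d - c := by linarith
    gcongr
    exact le_abs_self _
  set g : ℝ → ℝ := fun t => ∫ z, β z t
  set V := (volume (Metric.closedBall (0 : EuclideanSpace ℝ (Fin N)) r)).toReal
  have hV : 0 ≤ V := ENNReal.toReal_nonneg
  set S := Ioo a b ∩ E
  have hSm : MeasurableSet S := measurableSet_Ioo.inter hE.measurableSet
  have hSab : S ⊆ Icc a b := fun t ht => Ioo_subset_Icc_self ht.1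
  obtain ⟨ι, _, c, d, hcd, hdisj, hU, hend⟩ := exists_iUnion_Ioo_of_isOpen
    (O := Ioo a b \ E) (isOpen_Ioo.sdiff hE) sdiff_subset
  have hsubO (i : ι) : Ioo (c i) (d i) ⊆ Ioo a b \ E := by
    rw [← hU]; exact subset_iUnion (fun i => Ioo (c i) (d i)) i
  have hac (i : ι) : a ≤ c i ∧ d i ≤ b :=
    (Ioo_subset_Ioo_iff (hcd i)).1 ((hsubO i).trans sdiff_subset)
  have hci (i : ι) : c i ∈ Icc a b := ⟨(hac i).1, (hcd i).le.trans (hac i).2⟩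
  have hdi (i : ι) : d i ∈ Icc a b := ⟨(hac i).1.trans (hcd i).le, (hac i).2⟩
  have hcE (i : ι) : c i = a ∨ c i ∈ E := by
    by_contra! hcon
    exact (hend i).1 ⟨⟨lt_of_le_of_ne (hac i).1 (Ne.symm hcon.1), (hcd i).trans_le (hac i).2⟩,
      hcon.2⟩
  have hbal (i : ι) : BalancedOn w R (c i) (d i) :=
    hgap _ _ (hac i).1 (hcd i).le (hac i).2 fun t ht => ((hsubO i) ht).2
  have hBal (i : ι) : Balance (c i) (d i) B β :=
    hbal i r hr B β C (h.mono (hac i).1 (hac i).2)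
  have hLsum : Summable fun i => d i - c i := by
    have h1 : ∑' i, volume (Ioo (c i) (d i)) ≠ ⊤ := by
      rw [← measure_iUnion hdisj fun i => measurableSet_Ioo, hU]
      exact ((measure_mono sdiff_subset).trans_lt (by simp : volume (Ioo a b) < ⊤)).ne
    have h2 := ENNReal.summable_toReal h1
    refine h2.congr fun i => ?_
    rw [Real.volume_Ioo, ENNReal.toReal_ofReal (by linarith [hcd i])]
  set D : ι → EuclideanSpace ℝ (Fin N) → ℝ := fun i z => B z (d i) - B z (c i)
  have hDcont (i : ι) : Continuous (D i) := (h.cont _ (hdi i)).sub (h.cont _ (hci i))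
  have hDint (i : ι) : IntegrableOn (D i) (Metric.closedBall 0 r) :=
    (hDcont i).continuousOn.integrableOn_compact (isCompact_closedBall _ _)
  set bound : ι → ℝ := fun i => C * (V + CK) * (d i - c i) + if c i = a then 2 * C * V else 0
  have hbsum : Summable bound := by
    refine (hLsum.mul_left _).add (summable_of_hasFiniteSupport ?_)
    refine Set.Subsingleton.finite ?_
    intro i hi j hj
    have hi' : c i = a := by
      by_contra hne; simp [hne] at hi
    have hj' : c j = a := by
      by_contra hne; simp [hne] at hj
    by_contra hne
    have hdj := hdisj hne
    simp only [Function.onFun, Set.disjoint_left] at hdj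
    have h1 := hcd i
    have h2 := hcd j
    set e := (a + min (d i) (d j)) / 2
    have hm : a < min (d i) (d j) := lt_min (hi' ▸ h1) (hj' ▸ h2)
    have he1 : a < e := by simp only [e]; linarith
    have he2 : e < min (d i) (d j) := by simp only [e]; linarith
    exact hdj ⟨hi' ▸ he1, he2.trans_le (min_le_left _ _)⟩
      ⟨hj' ▸ he1, he2.trans_le (min_le_right _ _)⟩
  have hDbound (i : ι) : ∫ z in Metric.closedBall 0 r, ‖D i z‖ ≤ bound i := by
    have hwint : IntegrableOn (fun z => |w z (d i) - w z (c i)|) (Metric.closedBall 0 r) :=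
      ((hwz _).sub (hwz _)).abs.continuousOn.integrableOn_compact (isCompact_closedBall _ _)
    have hlen : 0 ≤ d i - c i := by linarith [hcd i]
    by_cases hca : c i ∈ E
    · have hk := hCK (c i) (d i) (hcd i).le (hbal i) (hn _ hca (hci i))
      calc ∫ z in Metric.closedBall 0 r, ‖D i z‖
          ≤ ∫ z in Metric.closedBall 0 r, C * ((d i - c i) + |w z (d i) - w z (c i)|) := by
            refine integral_mono (hDint i).norm
              (((integrableOn_const (isCompact_closedBall _ _).measure_lt_top.ne).add
                hwint).const_mul C) fun z => ?_
            have := h.lip z _ (hci i) _ (hdi i)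
            rwa [abs_of_nonneg hlen] at this
        _ = C * ((d i - c i) * V + ∫ z in Metric.closedBall 0 r, |w z (d i) - w z (c i)|) := by
            have hci : IntegrableOn (fun _ : EuclideanSpace ℝ (Fin N) => d i - c i)
                (Metric.closedBall 0 r) :=
              integrableOn_const (isCompact_closedBall _ _).measure_lt_top.ne
            rw [integral_const_mul, integral_add hci hwint,
              setIntegral_const, smul_eq_mul, mul_comm]
            simp only [V, Measure.real]
            ring
        _ ≤ C * ((d i - c i) * V + CK * (d i - c i)) := by gcongr
        _ = C * (V + CK) * (d i - c i) := by ring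
        _ ≤ bound i := by
            simp only [bound]
            split_ifs
            · have : 0 ≤ 2 * C * V := by positivity
              linarith
            · simp
    · have hca' : c i = a := (hcE i).resolve_right hca
      calc ∫ z in Metric.closedBall 0 r, ‖D i z‖
          ≤ ∫ z in Metric.closedBall (0 : EuclideanSpace ℝ (Fin N)) r, 2 * C := by
            refine integral_mono (hDint i).norm
              (integrableOn_const (isCompact_closedBall _ _).measure_lt_top.ne) fun z => ?_
            have h1 := abs_sub (B z (d i)) (B z (c i))
            have h2 := h.bdd z _ (hdi i)
            have h3 := h.bdd z _ (hci i)
            simp only [Real.norm_eq_abs, D]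
            linarith
        _ = 2 * C * V := by
            rw [setIntegral_const, smul_eq_mul, mul_comm]; rfl
        _ ≤ bound i := by
            simp only [bound, hca', if_true]
            have : 0 ≤ C * (V + CK) * (d i - a) := by
              have : 0 ≤ d i - a := by linarith [hca']
              positivity
            linarith
  have hDsum : Summable fun i => ∫ z in Metric.closedBall 0 r, ‖D i z‖ :=
    Summable.of_nonneg_of_le (fun i => integral_nonneg fun z => norm_nonneg _) hDbound hbsum
  have hDeq (i : ι) : ∫ z in Metric.closedBall 0 r, D i z = ∫ t in Ioo (c i) (d i), g t := by
    rw [← integral_Ioc_eq_integral_Ioo, ← intervalIntegral.integral_of_le (hcd i).le,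
      ← (hBal i).2, ← h.ball_integral (hdi i), ← h.ball_integral (hci i)]
    exact integral_sub (h.integrable (hdi i)).integrableOn (h.integrable (hci i)).integrableOn
  have hgi (i : ι) : IntegrableOn g (Ioo (c i) (d i)) :=
    ((intervalIntegrable_iff_integrableOn_Ioc_of_le (hcd i).le).1 (hBal i).1).mono_set
      Ioo_subset_Ioc_self
  have hgbound (i : ι) : ∫ t in Ioo (c i) (d i), ‖g t‖ ≤
      2 * C * (d i - c i) + ∫ z in Metric.closedBall 0 r, ‖D i z‖ := by
    have h2C : IntegrableOn (fun _ => 2 * C) (Ioo (c i) (d i)) := integrableOn_const (by simp)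
    calc ∫ t in Ioo (c i) (d i), ‖g t‖ ≤ ∫ t in Ioo (c i) (d i), (2 * C - g t) := by
          refine setIntegral_mono_on (hgi i).norm (h2C.sub (hgi i)) measurableSet_Ioo ?_
          intro t ht
          have := h.upper t ⟨(hac i).1.trans ht.1.le, ht.2.le.trans (hac i).2⟩
          rw [Real.norm_eq_abs, abs_le]
          constructor <;> simp only [g] <;> linarith
      _ = 2 * C * (d i - c i) - ∫ z in Metric.closedBall 0 r, D i z := by
          rw [integral_sub h2C (hgi i), hDeq i]
          simp [max_eq_left (sub_nonneg.2 (hcd i).le), mul_comm]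
      _ ≤ _ := by
          have := (abs_le.1 (norm_integral_le_integral_norm
            (μ := volume.restrict (Metric.closedBall 0 r)) (D i))).1
          linarith
  have hgsum : Summable fun i => ∫ t in Ioo (c i) (d i), ‖g t‖ :=
    Summable.of_nonneg_of_le (fun i => integral_nonneg fun z => norm_nonneg _) hgbound
      ((hLsum.mul_left _).add hDsum)
  have hgO : IntegrableOn g (Ioo a b \ E) := by
    rw [← hU]
    exact integrableOn_iUnion_of_summable_integral_norm hgi hgsum
  have hgOsum : HasSum (fun i => ∫ t in Ioo (c i) (d i), g t) (∫ t in Ioo a b \ E, g t) := by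
    rw [← hU] at hgO ⊢
    exact hasSum_integral_iUnion (fun i => measurableSet_Ioo) hdisj hgO
  have hprod := h.prod_integrable hab.le hSm hSab
    fun t ht z hz => hn t ht.2 (hSab ht) z (hz.trans hr.le)
  have hgS : IntegrableOn g S := by
    refine (hprod.integral_prod_right).congr ((ae_restrict_iff' hSm).2 (ae_of_all _ fun t ht => ?_))
    exact h.ball_integral' (hSab ht)
  have hswap : ∫ z in Metric.closedBall 0 r, ∫ t in S, β z t = ∫ t in S, g t := by
    rw [integral_integral_swap hprod]
    exact setIntegral_congr_fun hSm fun t ht => h.ball_integral' (hSab ht)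
  have hpt (z : EuclideanSpace ℝ (Fin N)) :
      B z b - B z a = (∫ t in S, β z t) + ∑' i, D i z := by
    have hβi : IntegrableOn (β z) (Ioo a b) :=
      ((h.contTime z).integrableOn_Icc).mono_set Ioo_subset_Icc_self
    rw [← h.intervalIntegral_eq z le_rfl hab.le le_rfl,
      ← integral_inter_add_sdiff hE.measurableSet hβi]
    congr 1
    have hO : IntegrableOn (β z) (Ioo a b \ E) := hβi.mono_set sdiff_subset
    have := hasSum_integral_iUnion (f := β z) (μ := volume)
      (s := fun i => Ioo (c i) (d i)) (fun i => measurableSet_Ioo) hdisj (by rwa [hU])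
    rw [hU] at this
    rw [← this.tsum_eq]
    exact tsum_congr fun i => h.intervalIntegral_eq z (hac i).1 (hcd i).le (hac i).2
  have hSint : IntegrableOn (fun z => ∫ t in S, β z t) (Metric.closedBall 0 r) :=
    hprod.integral_prod_left
  have hDtot := hasSum_integral_of_summable_integral_norm hDint hDsum
  have hDint' : IntegrableOn (fun z => ∑' i, D i z) (Metric.closedBall 0 r) := by
    have h1 : IntegrableOn (fun z => (B z b - B z a) - ∫ t in S, β z t)
        (Metric.closedBall 0 r) :=
      ((h.integrable (right_mem_Icc.2 hab.le)).integrableOn.sub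
        (h.integrable (left_mem_Icc.2 hab.le)).integrableOn).sub hSint
    refine h1.congr (ae_of_all _ fun z => ?_)
    simp only [hpt z]
    ring
  refine ⟨(intervalIntegrable_iff_integrableOn_Ioo_of_le hab.le).2 ?_, ?_⟩
  · have := hgS.union hgO
    rwa [inter_union_sdiff] at this
  · have hgIoo : IntegrableOn g (Ioo a b) := by
      have := hgS.union hgO
      rwa [inter_union_sdiff] at this
    rw [intervalIntegral.integral_of_le hab.le, integral_Ioc_eq_integral_Ioo,
      ← integral_inter_add_sdiff hE.measurableSet hgIoo, ← hswap, ← hgOsum.tsum_eq,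
      ← tsum_congr hDeq, hDtot.tsum_eq, ← integral_add hSint hDint',
      ← h.ball_integral (right_mem_Icc.2 hab.le), ← h.ball_integral (left_mem_Icc.2 hab.le),
      ← integral_sub (h.integrable (right_mem_Icc.2 hab.le)).integrableOn
        (h.integrable (left_mem_Icc.2 hab.le)).integrableOn]
    exact integral_congr_ae (ae_of_all _ hpt)

/-- The balance law holds on every time interval. -/
theorem balancedOn_all
    (hkato : ∀ r < R, ∀ n : ℝ, ∃ C, ∀ c d, c ≤ d → BalancedOn w R c d →
      (∀ z, ‖z‖ ≤ R → |deriv (w z) c| ≤ n) →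
      ∫ z in Metric.closedBall 0 r, |w z d - w z c| ≤ C * (d - c))
    (hwz : ∀ t, Continuous fun z => w z t)
    (hwt : ∀ z, Continuous (deriv (w z))) (hwtz : ∀ t, Continuous fun z => deriv (w z) t)
    {a b : ℝ} (hab : a ≤ b) : BalancedOn w R a b := by
  set G : Set ℝ := {t | ∃ ε > 0, ∀ a ∈ Ioo (t - ε) (t + ε), ∀ b ∈ Ioo (t - ε) (t + ε), a ≤ b →
      BalancedOn w R a b}
  suffices hG : G = univ by
    refine balancedOn_of_local isPreconnected_univ (fun t _ => ?_) (mem_univ a) (mem_univ b) hab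
    have : t ∈ G := hG ▸ mem_univ t
    exact this
  have hGopen : IsOpen G := by
    rw [Metric.isOpen_iff]
    rintro t ⟨ε, hε, h⟩
    refine ⟨ε / 2, by linarith, fun s hs => ⟨ε / 2, by linarith, fun a ha b hb => ?_⟩⟩
    rw [Metric.mem_ball, Real.dist_eq, abs_lt] at hs
    exact h a ⟨by linarith [ha.1], by linarith [ha.2]⟩ b ⟨by linarith [hb.1], by linarith [hb.2]⟩
  by_contra hne
  obtain ⟨t0, ht0⟩ := (ne_univ_iff_exists_notMem G).1 hne
  have hEc : IsClosed Gᶜ := hGopen.isClosed_compl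
  have : CompleteSpace (Gᶜ : Set ℝ) := hEc.completeSpace_coe
  have : Nonempty (Gᶜ : Set ℝ) := ⟨⟨t0, ht0⟩⟩
  set A : ℕ → Set (Gᶜ : Set ℝ) := fun n => {t | ∀ z, ‖z‖ ≤ R → |deriv (w z) t| ≤ n}
  have hA (n : ℕ) : IsClosed (A n) := by
    simp only [A, ofPred_forall]
    refine isClosed_iInter fun z => isClosed_iInter fun _ => ?_
    exact isClosed_le (((hwt z).comp continuous_subtype_val).abs) continuous_const
  have hcov : ⋃ n, A n = univ := by
    refine eq_univ_of_forall fun t => ?_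
    obtain ⟨C, hC⟩ :=
      (isCompact_closedBall (0 : EuclideanSpace ℝ (Fin N)) R).exists_bound_of_continuousOn
      (hwtz t).continuousOn
    obtain ⟨n, hn⟩ := exists_nat_ge C
    exact mem_iUnion.2 ⟨n, fun z hz => (hC z (by simpa using hz)).trans hn⟩
  obtain ⟨n, ⟨t1, ht1⟩⟩ := nonempty_interior_of_iUnion_of_closed hA hcov
  rw [mem_interior_iff_mem_nhds, Metric.mem_nhds_iff] at ht1
  obtain ⟨ε, hε, hball⟩ := ht1
  refine t1.2 ⟨ε, hε, fun a ha b hb hab => ?_⟩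
  rcases hab.eq_or_lt with rfl | hlt
  · exact BalancedOn.refl a
  refine balancedOn_of_gaps hkato hwz hEc hlt (n := n) ?_ ?_
  · intro t ht htab
    refine hball (a := ⟨t, ht⟩) ?_
    rw [Metric.mem_ball, Subtype.dist_eq, Real.dist_eq, abs_lt]
    constructor
    · linarith [ha.1, htab.1]
    · linarith [hb.2, htab.2]
  · intro c d _ hcd _ hE
    refine balancedOn_of_Ioo hcd fun a' ha' b' hb' hab' => ?_
    refine balancedOn_of_local isPreconnected_Ioo (fun t ht => ?_) ha' hb' hab'
    have : t ∈ G := not_not.1 (hE t ht)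
    exact this

end ChainRule

section Kato

variable {N : ℕ}

/-- `g` is differentiable at `x` and its partial derivative in the direction `i` is `g'`. -/
def HasPd (i : Fin N) (g : EuclideanSpace ℝ (Fin N) → ℝ) (g' : ℝ)
    (x : EuclideanSpace ℝ (Fin N)) : Prop :=
  DifferentiableAt ℝ g x ∧ pd i g x = g'

section HasPd

variable {i : Fin N} {g h : EuclideanSpace ℝ (Fin N) → ℝ} {g' h' : ℝ}
  {x : EuclideanSpace ℝ (Fin N)}

lemma ContDiff.hasPd {n : WithTop ℕ∞} (hg : ContDiff ℝ n g) (hn : n ≠ 0) (i : Fin N)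
    (x : EuclideanSpace ℝ (Fin N)) : HasPd i g (pd i g x) x :=
  ⟨hg.differentiable hn x, rfl⟩

lemma HasPd.congr (hg : HasPd i g g' x) {k : ℝ} (h : g' = k) : HasPd i g k x := h ▸ hg

lemma HasPd.mul (hg : HasPd i g g' x) (hh : HasPd i h h' x) :
    HasPd i (fun y => g y * h y) (g' * h x + g x * h') x :=
  ⟨hg.1.mul hh.1, by rw [pd_mul hg.1 hh.1, hg.2, hh.2]⟩

lemma HasPd.add (hg : HasPd i g g' x) (hh : HasPd i h h' x) :
    HasPd i (fun y => g y + h y) (g' + h') x :=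
  ⟨hg.1.add hh.1, by rw [pd_add hg.1 hh.1, hg.2, hh.2]⟩

lemma HasPd.sub (hg : HasPd i g g' x) (hh : HasPd i h h' x) :
    HasPd i (fun y => g y - h y) (g' - h') x :=
  ⟨hg.1.sub hh.1, by rw [pd_sub hg.1 hh.1, hg.2, hh.2]⟩

lemma HasPd.comp {G : ℝ → ℝ} {G' : ℝ} (hG : HasDerivAt G G' (g x)) (hg : HasPd i g g' x) :
    HasPd i (fun y => G (g y)) (G' * g') x :=
  ⟨hG.differentiableAt.comp x hg.1, by rw [pd_comp hG hg.1, hg.2]⟩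

end HasPd

lemma continuous_lap {g : EuclideanSpace ℝ (Fin N) → ℝ} (hg : ContDiff ℝ 2 g) :
    Continuous (lap g) := by
  simp_rw [funext (lap_eq_sum_pd hg)]
  exact continuous_finsetSum _ fun i _ => continuous_pd (contDiff_pd_one hg i) i

lemma hasCompactSupport_lap {g : EuclideanSpace ℝ (Fin N) → ℝ} (hg : ContDiff ℝ 2 g)
    (hc : HasCompactSupport g) : HasCompactSupport (lap g) := by
  refine HasCompactSupport.intro hc fun x hx => ?_
  rw [lap_eq_sum_pd hg]
  refine Finset.sum_eq_zero fun i _ => image_eq_zero_of_notMem_tsupport fun h => hx ?_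
  exact tsupport_pd_subset g i (tsupport_pd_subset _ i h)

lemma lap_sub {g h : EuclideanSpace ℝ (Fin N) → ℝ} (hg : ContDiff ℝ 2 g) (hh : ContDiff ℝ 2 h)
    (x : EuclideanSpace ℝ (Fin N)) : lap (fun y => g y - h y) x = lap g x - lap h x := by
  rw [lap_eq_sum_pd (hg.sub hh), lap_eq_sum_pd hg, lap_eq_sum_pd hh, ← Finset.sum_sub_distrib]
  refine Finset.sum_congr rfl fun i _ => ?_
  have h1 : pd i (fun y => g y - h y) = fun y => pd i g y - pd i h y := by
    funext y
    exact pd_sub (hg.differentiable (by norm_num) y) (hh.differentiable (by norm_num) y)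
  rw [h1]
  exact pd_sub ((contDiff_pd_one hg i).differentiable (by norm_num) x)
    ((contDiff_pd_one hh i).differentiable (by norm_num) x)

/-- Kato's inequality for a nondecreasing function `h` with primitive `H`. -/
lemma integral_mul_lap_le {q ρ : EuclideanSpace ℝ (Fin N) → ℝ} {h h' H : ℝ → ℝ}
    (hq : ContDiff ℝ 2 q) (hρ : ContDiff ℝ 2 ρ) (hρc : HasCompactSupport ρ) (hρ0 : ∀ z, 0 ≤ ρ z)
    (hh : ∀ y, HasDerivAt h (h' y) y) (hh' : Continuous h') (hmono : ∀ y, 0 ≤ h' y)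
    (hH : ∀ y, HasDerivAt H (h y) y) :
    ∫ z, ρ z * h (q z) * lap q z ≤ ∫ z, lap ρ z * H (q z) := by
  have hhc : ContDiff ℝ 1 h := by
    rw [contDiff_one_iff_deriv]
    exact ⟨fun y => (hh y).differentiableAt, by rwa [funext fun y => (hh y).deriv]⟩
  have hHc : ContDiff ℝ 1 H := by
    rw [contDiff_one_iff_deriv]
    refine ⟨fun y => (hH y).differentiableAt, ?_⟩
    rw [funext fun y => (hH y).deriv]
    exact hhc.continuous
  have hq1 : ContDiff ℝ 1 q := hq.of_le (by norm_num)
  have hρ1 : ContDiff ℝ 1 ρ := hρ.of_le (by norm_num)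
  let F : Fin N → EuclideanSpace ℝ (Fin N) → ℝ := fun i z =>
    ρ z * (h (q z) * pd i q z) - pd i ρ z * H (q z)
  have hF (i : Fin N) : ContDiff ℝ 1 (F i) :=
    (hρ1.mul ((hhc.comp hq1).mul (contDiff_pd_one hq i))).sub
      ((contDiff_pd_one hρ i).mul (hHc.comp hq1))
  have hFc (i : Fin N) : HasCompactSupport (F i) :=
    (hρc.mul_right).sub (hasCompactSupport_pd hρc i).mul_right
  have hpd (i : Fin N) (z : EuclideanSpace ℝ (Fin N)) : pd i (F i) z =
      ρ z * h (q z) * pd i (pd i q) z + ρ z * h' (q z) * pd i q z ^ 2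
        - pd i (pd i ρ) z * H (q z) := by
    have hn : (1 : WithTop ℕ∞) ≠ 0 := one_ne_zero
    have e1 := hq1.hasPd hn i z
    refine (((hρ1.hasPd hn i z).mul ((HasPd.comp (hh (q z)) e1).mul
      ((contDiff_pd_one hq i).hasPd hn i z))).sub
      (((contDiff_pd_one hρ i).hasPd hn i z).mul (HasPd.comp (hH (q z)) e1))).2.trans ?_
    ring
  have h_int : ∫ z, ∑ i, pd i (F i) z = 0 := by
    rw [integral_finsetSum _ fun i _ =>
      (continuous_pd (hF i) i).integrable_of_hasCompactSupport (hasCompactSupport_pd (hFc i) i)]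
    exact Finset.sum_eq_zero fun i _ => integral_pd_eq_zero (hF i) (hFc i) i
  have hI1 : Integrable fun z => ρ z * h (q z) * lap q z :=
    ((hρ1.continuous.mul (hhc.continuous.comp hq1.continuous)).mul
      (continuous_lap hq)).integrable_of_hasCompactSupport hρc.mul_right.mul_right
  have hI2 : Integrable fun z => lap ρ z * H (q z) :=
    ((continuous_lap hρ).mul (hHc.continuous.comp hq1.continuous)).integrable_of_hasCompactSupport
      (hasCompactSupport_lap hρ hρc).mul_right
  have hI3 : Integrable fun z => ∑ i, pd i (F i) z :=
    integrable_finsetSum _ fun i _ =>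
      (continuous_pd (hF i) i).integrable_of_hasCompactSupport (hasCompactSupport_pd (hFc i) i)
  have := integral_mono (hI1.sub hI2) hI3 fun z => by
    simp only [hpd, Pi.sub_apply]
    rw [lap_eq_sum_pd hq, lap_eq_sum_pd hρ, Finset.mul_sum, Finset.sum_mul,
      ← Finset.sum_sub_distrib]
    refine Finset.sum_le_sum fun i _ => ?_
    have := mul_nonneg (mul_nonneg (hρ0 z) (hmono (q z))) (sq_nonneg (pd i q z))
    linarith
  rw [h_int, integral_sub' hI1 hI2] at this
  linarith

/-- A bounded classical solution of `w_t = Δ φ(w) + f(w)` on all of space-time. -/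
structure IsSol (φ f : ℝ → ℝ) (c M : ℝ) (w : EuclideanSpace ℝ (Fin N) → ℝ → ℝ) : Prop where
  cpos : 0 < c
  contDiff_phi : ContDiff ℝ 4 φ
  le_deriv : ∀ s, c ≤ deriv φ s
  contDiff_f : ContDiff ℝ 2 f
  bdd : ∀ z t, |w z t| ≤ M
  space : ∀ t, ContDiff ℝ 2 fun z => w z t
  time : ∀ z, ContDiff ℝ 1 (w z)
  eq : ∀ z t, deriv (w z) t = lap (fun y => φ (w y t)) z + f (w z t)

variable {φ f : ℝ → ℝ} {c M : ℝ} {w : EuclideanSpace ℝ (Fin N) → ℝ → ℝ}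

lemma IsSol.contDiff_comp (hs : IsSol φ f c M w) (t : ℝ) : ContDiff ℝ 2 fun z => φ (w z t) :=
  (hs.contDiff_phi.of_le (by norm_num)).comp (hs.space t)

lemma IsSol.continuous_deriv_time (hs : IsSol φ f c M w) (z) : Continuous (deriv (w z)) :=
  (hs.time z).continuous_deriv (by norm_num)

lemma IsSol.continuous_deriv_space (hs : IsSol φ f c M w) (t : ℝ) :
    Continuous fun z => deriv (w z) t := by
  simp_rw [hs.eq]
  exact (continuous_lap (hs.contDiff_comp t)).add
    (hs.contDiff_f.continuous.comp (hs.space t).continuous)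

lemma IsSol.hasDerivAt (hs : IsSol φ f c M w) (z) (t : ℝ) : HasDerivAt (w z) (deriv (w z) t) t :=
  ((hs.time z).differentiable (by norm_num) t).hasDerivAt

/-- The comparison density `∫_v^x h(φ(s) - φ(v)) ds`. -/
noncomputable def compDens (φ h : ℝ → ℝ) (v x : ℝ) : ℝ := ∫ s in v..x, h (φ s - φ v)

lemma continuous_compDens {h : ℝ → ℝ} (hφ : Continuous φ) (hh : Continuous h) :
    Continuous fun p : ℝ × ℝ => compDens φ h p.1 p.2 := by
  have hc : Continuous (Function.uncurry fun (p : ℝ × ℝ) s => h (φ s - φ p.1)) := by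
    unfold Function.uncurry; fun_prop
  have e (p : ℝ × ℝ) : compDens φ h p.1 p.2 =
      (∫ s in (0 : ℝ)..p.2, h (φ s - φ p.1)) - ∫ s in (0 : ℝ)..p.1, h (φ s - φ p.1) := by
    have hi (a b : ℝ) : IntervalIntegrable (fun s => h (φ s - φ p.1)) volume a b :=
      Continuous.intervalIntegrable (by fun_prop) a b
    rw [intervalIntegral.integral_interval_sub_left (hi _ _) (hi _ _)]
    rfl
  simp_rw [e]
  exact (intervalIntegral.continuous_parametric_intervalIntegral_of_continuous hc
    continuous_snd).sub (intervalIntegral.continuous_parametric_intervalIntegral_of_continuous hc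
    continuous_fst)

lemma hasDerivAt_compDens {h : ℝ → ℝ} (hφ : Continuous φ) (hh : Continuous h) (v x : ℝ) :
    HasDerivAt (compDens φ h v) (h (φ x - φ v)) x := by
  have hc : Continuous fun s => h (φ s - φ v) := by fun_prop
  exact intervalIntegral.integral_hasDerivAt_right (hc.intervalIntegrable _ _)
    (hc.stronglyMeasurableAtFilter _ _) hc.continuousAt

/-- The comparison functional is absolutely continuous along the flow, and its time derivative
satisfies a Kato type inequality. -/
lemma IsSol.compDens_balance (hs : IsSol φ f c M w) {R r a b : ℝ} (hr : r < R)
    (hbal : BalancedOn w R a b) {v ρ : EuclideanSpace ℝ (Fin N) → ℝ} {h h' H : ℝ → ℝ}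
    (hv : ContDiff ℝ 2 v) (hvM : ∀ z, |v z| ≤ M)
    (hρ : ContDiff ℝ 2 ρ) (hρr : ∀ z, r < ‖z‖ → ρ z = 0) (hρ0 : ∀ z, 0 ≤ ρ z)
    (hh : ∀ y, HasDerivAt h (h' y) y) (hh' : Continuous h') (hmono : ∀ y, 0 ≤ h' y)
    (hH : ∀ y, HasDerivAt H (h y) y) :
    Balance a b (fun z t => ρ z * compDens φ h (v z) (w z t))
      (fun z t => ρ z * (h (φ (w z t) - φ (v z)) * deriv (w z) t)) ∧
    ContinuousOn (fun t => ∫ z, ρ z * compDens φ h (v z) (w z t)) (Icc a b) ∧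
    ∀ t, ∫ z, ρ z * (h (φ (w z t) - φ (v z)) * deriv (w z) t) ≤
      ∫ z, (lap ρ z * H (φ (w z t) - φ (v z)) + ρ z * (h (φ (w z t) - φ (v z)) *
        (lap (fun y => φ (v y)) z + f (w z t)))) := by
  have hφc := hs.contDiff_phi.continuous
  have hhc : Continuous h := continuous_iff_continuousAt.2 fun y => (hh y).continuousAt
  have hHc : Continuous H := continuous_iff_continuousAt.2 fun y => (hH y).continuousAt
  have hφv : ContDiff ℝ 2 fun y => φ (v y) := (hs.contDiff_phi.of_le (by norm_num)).comp hv
  have hρc : HasCompactSupport ρ :=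
    HasCompactSupport.intro (isCompact_closedBall 0 r) fun z hz => hρr z (by simpa using hz)
  have hwc (t : ℝ) : Continuous fun z => w z t := (hs.space t).continuous
  have hvc := hv.continuous
  have hρcont := hρ.continuous
  have hlc := continuous_lap hφv
  have hfc := hs.contDiff_f.continuous
  have hlρ := continuous_lap hρ
  have hM : 0 ≤ M := (abs_nonneg _).trans (hvM 0)
  have hupper (t : ℝ) : ∫ z, ρ z * (h (φ (w z t) - φ (v z)) * deriv (w z) t) ≤
      ∫ z, (lap ρ z * H (φ (w z t) - φ (v z)) + ρ z * (h (φ (w z t) - φ (v z)) *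
        (lap (fun y => φ (v y)) z + f (w z t)))) := by
    have hwt := hwc t
    have k := integral_mul_lap_le ((hs.contDiff_comp t).sub hφv) hρ hρc hρ0 hh hh' hmono hH
    have i1 : Integrable fun z => ρ z * h (φ (w z t) - φ (v z)) *
        lap (fun y => φ (w y t) - φ (v y)) z :=
      Continuous.integrable_of_hasCompactSupport
        ((by fun_prop : Continuous fun z => ρ z * h (φ (w z t) - φ (v z))).mul
          (continuous_lap ((hs.contDiff_comp t).sub hφv))) hρc.mul_right.mul_right
    have i2 : Integrable fun z => lap ρ z * H (φ (w z t) - φ (v z)) :=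
      Continuous.integrable_of_hasCompactSupport (by fun_prop)
        (hasCompactSupport_lap hρ hρc).mul_right
    have i3 : Integrable fun z => ρ z * (h (φ (w z t) - φ (v z)) *
        (lap (fun y => φ (v y)) z + f (w z t))) :=
      Continuous.integrable_of_hasCompactSupport (by fun_prop) hρc.mul_right
    rw [integral_add i2 i3]
    refine le_trans (le_of_eq ?_) (add_le_add_left k _)
    rw [← integral_add i1 i3]
    refine integral_congr_ae (ae_of_all _ fun z => ?_)
    simp only
    rw [hs.eq, lap_sub (hs.contDiff_comp t) hφv]
    ring
  obtain ⟨K, hK⟩ : ∃ K, ∀ s ∈ Icc (-M) M, ∀ x ∈ Icc (-M) M, |h (φ s - φ x)| ≤ K := by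
    obtain ⟨K, hK⟩ := ((isCompact_Icc (a := -M) (b := M)).prod
      (isCompact_Icc (a := -M) (b := M))).exists_bound_of_continuousOn
      (f := fun p => h (φ p.1 - φ p.2)) (by fun_prop)
    exact ⟨K, fun s h1 x h2 => hK (s, x) ⟨h1, h2⟩⟩
  obtain ⟨K2, hK2⟩ : ∃ K, ∀ s ∈ Icc (-M) M, ∀ x ∈ Icc (-M) M, |H (φ s - φ x)| ≤ K := by
    obtain ⟨K, hK⟩ := ((isCompact_Icc (a := -M) (b := M)).prod
      (isCompact_Icc (a := -M) (b := M))).exists_bound_of_continuousOn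
      (f := fun p => H (φ p.1 - φ p.2)) (by fun_prop)
    exact ⟨K, fun s h1 x h2 => hK (s, x) ⟨h1, h2⟩⟩
  obtain ⟨K3, hK3⟩ : ∃ K, ∀ s ∈ Icc (-M) M, |f s| ≤ K :=
    (isCompact_Icc (a := -M) (b := M)).exists_bound_of_continuousOn (f := f) hfc.continuousOn
  obtain ⟨Kρ, hKρ⟩ := hρc.exists_bound_of_continuous hρcont
  have mv (z) : v z ∈ Icc (-M) M := abs_le.1 (hvM z)
  have mw (z t) : w z t ∈ Icc (-M) M := abs_le.1 (hs.bdd z t)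
  have hKρ0 : 0 ≤ Kρ := (norm_nonneg _).trans (hKρ 0)
  have hK0 : 0 ≤ K := (abs_nonneg _).trans (hK _ (mv 0) _ (mv 0))
  have hMdiff (v x y : ℝ) (hv : v ∈ Icc (-M) M) (hx : x ∈ Icc (-M) M) (hy : y ∈ Icc (-M) M) :
      |compDens φ h v x - compDens φ h v y| ≤ K * |x - y| := by
    have hi (a b : ℝ) : IntervalIntegrable (fun s => h (φ s - φ v)) volume a b :=
      Continuous.intervalIntegrable (by fun_prop) a b
    unfold compDens
    rw [intervalIntegral.integral_interval_sub_left (hi _ _) (hi _ _)]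
    refine intervalIntegral.norm_integral_le_of_norm_le_const (f := fun s => h (φ s - φ v))
      fun s hs' => hK s ?_ v hv
    exact ordConnected_Icc.uIcc_subset hy hx (uIoc_subset_uIcc hs')
  set UB : ℝ := ∫ z, (|lap ρ z| * K2 + ρ z * (K * (|lap (fun y => φ (v y)) z| + K3)))
  have hupper' (t : ℝ) : ∫ z, ρ z * (h (φ (w z t) - φ (v z)) * deriv (w z) t) ≤ UB := by
    have hwt := hwc t
    refine (hupper t).trans (integral_mono ?_ ?_ fun z => ?_)
    · refine (Continuous.integrable_of_hasCompactSupport (by fun_prop)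
        (hasCompactSupport_lap hρ hρc).mul_right).add
        (Continuous.integrable_of_hasCompactSupport (by fun_prop) hρc.mul_right)
    · refine (Continuous.integrable_of_hasCompactSupport (by fun_prop)
        (hasCompactSupport_lap hρ hρc).norm.mul_right).add
        (Continuous.integrable_of_hasCompactSupport (by fun_prop) hρc.mul_right)
    · refine add_le_add ?_ (mul_le_mul_of_nonneg_left ?_ (hρ0 z))
      · refine (le_abs_self _).trans ?_
        rw [abs_mul]
        exact mul_le_mul_of_nonneg_left (hK2 _ (mw z t) _ (mv z)) (abs_nonneg _)
      · refine (le_abs_self _).trans ?_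
        rw [abs_mul]
        refine mul_le_mul (hK _ (mw z t) _ (mv z)) ?_ (abs_nonneg _) hK0
        exact (abs_add_le _ _).trans (by gcongr; exact hK3 _ (mw z t))
  have hcd := continuous_compDens hφc hhc
  have hadm : IsAdm w r a b (fun z t => ρ z * compDens φ h (v z) (w z t))
      (fun z t => ρ z * (h (φ (w z t) - φ (v z)) * deriv (w z) t))
      (max UB (Kρ * (K * (1 + 2 * M)))) := by
    have le2 : Kρ * K ≤ max UB (Kρ * (K * (1 + 2 * M))) := by
      refine le_trans ?_ (le_max_right _ _)
      refine mul_le_mul_of_nonneg_left ?_ hKρ0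
      exact le_mul_of_one_le_right hK0 (by linarith)
    refine ⟨fun t _ => ?_, fun t _ => ?_, fun z t _ => ?_, fun z => ?_, fun z hz t _ => ?_,
      fun z hz t _ => ?_, fun z t _ => ?_, fun z s _ t _ => ?_, fun z t _ => ?_, fun t _ => ?_⟩
    · exact hρcont.mul (hcd.comp (hvc.prodMk (hwc t)))
    · have := hs.continuous_deriv_space t
      have := hwc t
      fun_prop
    · exact ((hasDerivAt_compDens hφc hhc (v z) (w z t)).comp t (hs.hasDerivAt z t)).const_mul _
    · have := hs.continuous_deriv_time z
      have := (hs.time z).continuous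
      fun_prop
    · simp [hρr z hz]
    · simp [hρr z hz]
    · refine le_trans ?_ (le_max_right _ _)
      rw [abs_mul]
      refine mul_le_mul (hKρ z) ?_ (abs_nonneg _) hKρ0
      have := hMdiff (v z) (w z t) (v z) (mv z) (mw z t) (mv z)
      have e : compDens φ h (v z) (v z) = 0 := by simp [compDens]
      rw [e, sub_zero] at this
      refine this.trans (mul_le_mul_of_nonneg_left ?_ hK0)
      rw [abs_le]
      constructor <;> linarith [(mv z).1, (mv z).2, (mw z t).1, (mw z t).2]
    · rw [← mul_sub, abs_mul]
      calc |ρ z| * |compDens φ h (v z) (w z t) - compDens φ h (v z) (w z s)|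
          ≤ Kρ * (K * |w z t - w z s|) :=
            mul_le_mul (hKρ z) (hMdiff _ _ _ (mv z) (mw z t) (mw z s)) (abs_nonneg _) hKρ0
        _ = Kρ * K * |w z t - w z s| := by ring
        _ ≤ _ := mul_le_mul le2 (by linarith [abs_nonneg (t - s)]) (abs_nonneg _)
            ((mul_nonneg hKρ0 hK0).trans le2)
    · rw [abs_mul, abs_mul]
      calc |ρ z| * (|h (φ (w z t) - φ (v z))| * |deriv (w z) t|)
          ≤ Kρ * (K * |deriv (w z) t|) :=
            mul_le_mul (hKρ z) (mul_le_mul_of_nonneg_right (hK _ (mw z t) _ (mv z)) (abs_nonneg _))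
              (by positivity) hKρ0
        _ = Kρ * K * |deriv (w z) t| := by ring
        _ ≤ _ := mul_le_mul le2 (by linarith) (abs_nonneg _)
            ((mul_nonneg hKρ0 hK0).trans le2)
    · exact (hupper' t).trans (le_max_left _ _)
  exact ⟨hbal r hr _ _ _ hadm, hadm.continuousOn, hupper⟩

end Kato

section KatoApplied

/-- A smooth approximation of the absolute value. -/
noncomputable def smAbs (ε y : ℝ) : ℝ := √(ε ^ 2 + y ^ 2)

lemma smAbs_pos {ε : ℝ} (hε : 0 < ε) (y : ℝ) : 0 < smAbs ε y := sqrt_pos.2 (by positivity)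

lemma sq_smAbs (ε y : ℝ) : smAbs ε y ^ 2 = ε ^ 2 + y ^ 2 := sq_sqrt (by positivity)

lemma abs_le_smAbs (ε y : ℝ) : |y| ≤ smAbs ε y := abs_le_sqrt (by nlinarith [sq_nonneg ε])

lemma smAbs_le {ε : ℝ} (hε : 0 ≤ ε) (y : ℝ) : smAbs ε y ≤ ε + |y| :=
  (sqrt_le_left (by positivity)).2 (by nlinarith [sq_abs y, abs_nonneg y])

lemma hasDerivAt_smAbs {ε : ℝ} (hε : 0 < ε) (y : ℝ) :
    HasDerivAt (smAbs ε) (y / smAbs ε y) y := by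
  have := ((hasDerivAt_pow 2 y).const_add (ε ^ 2)).sqrt (by positivity)
  refine this.congr_deriv ?_
  have := smAbs_pos hε y
  change _ / (2 * smAbs ε y) = _
  field_simp
  ring

lemma hasDerivAt_div_smAbs {ε : ℝ} (hε : 0 < ε) (y : ℝ) :
    HasDerivAt (fun y => y / smAbs ε y) (ε ^ 2 / smAbs ε y ^ 3) y := by
  have h0 := smAbs_pos hε y
  refine ((hasDerivAt_id y).div (hasDerivAt_smAbs hε y) h0.ne').congr_deriv ?_
  have := sq_smAbs ε y
  simp only [id]
  field_simp
  linarith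

lemma continuous_smAbs (ε : ℝ) : Continuous (smAbs ε) := by unfold smAbs; fun_prop

lemma abs_div_smAbs_le {ε : ℝ} (hε : 0 < ε) (y : ℝ) : |y / smAbs ε y| ≤ 1 := by
  rw [abs_div, abs_of_pos (smAbs_pos hε y), div_le_one (smAbs_pos hε y)]
  exact abs_le_smAbs ε y

variable {N : ℕ} {φ f : ℝ → ℝ} {c M : ℝ} {w : EuclideanSpace ℝ (Fin N) → ℝ → ℝ}

lemma abs_sub_le_compDens {ε : ℝ} (hε : 0 < ε) (hc : 0 < c) (hφ : Differentiable ℝ φ)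
    (hφ' : ∀ s, c ≤ deriv φ s) (v x : ℝ) :
    |x - v| - ε / c ≤ compDens φ (fun y => y / smAbs ε y) v x := by
  have hcont : Continuous fun y => y / smAbs ε y :=
    continuous_id.div (continuous_smAbs ε) fun y => (smAbs_pos hε y).ne'
  have hd (x : ℝ) := hasDerivAt_compDens hφ.continuous hcont v x
  have hq (x : ℝ) : HasDerivAt (fun x => φ x - φ v) (deriv φ x) x :=
    (hφ x).hasDerivAt.sub_const _
  have hs (x : ℝ) := (hasDerivAt_smAbs hε (φ x - φ v)).comp x (hq x)
  have e0 : compDens φ (fun y => y / smAbs ε y) v v = 0 := by simp [compDens]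
  have e1 : smAbs ε 0 = ε := by simp [smAbs, sqrt_sq hε.le]
  have hφc (x : ℝ) : 0 ≤ deriv φ x / c - 1 := by
    rw [sub_nonneg, one_le_div hc]; exact hφ' x
  rcases le_total v x with h | h
  · have hm : Monotone fun x => compDens φ (fun y => y / smAbs ε y) v x - (x - v) -
        (1 / c) * (smAbs ε (φ x - φ v) - (φ x - φ v)) := by
      refine monotone_of_hasDerivAt_nonneg (fun x => ((hd x).sub
        ((hasDerivAt_id x).sub_const v)).sub (((hs x).sub (hq x)).const_mul (1 / c))) fun x => ?_
      have h1 := (abs_le.1 (abs_div_smAbs_le hε (φ x - φ v))).2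
      have := mul_nonneg (sub_nonneg.2 h1) (hφc x)
      simp only [Pi.zero_apply]
      refine this.trans (le_of_eq ?_)
      ring
    have := hm h
    simp only [sub_self, e0, e1, sub_zero, zero_sub] at this
    have h3 : 0 ≤ (1 / c) * (smAbs ε (φ x - φ v) - (φ x - φ v)) :=
      mul_nonneg (by positivity) (by linarith [abs_le_smAbs ε (φ x - φ v), le_abs_self (φ x - φ v)])
    rw [abs_of_nonneg (by linarith), div_eq_inv_mul, ← one_div]
    linarith
  · have hm : Antitone fun x => compDens φ (fun y => y / smAbs ε y) v x + (x - v) -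
        (1 / c) * (smAbs ε (φ x - φ v) + (φ x - φ v)) := by
      refine antitone_of_hasDerivAt_nonpos (fun x => ((hd x).add
        ((hasDerivAt_id x).sub_const v)).sub (((hs x).add (hq x)).const_mul (1 / c))) fun x => ?_
      have h1 := (abs_le.1 (abs_div_smAbs_le hε (φ x - φ v))).1
      have := mul_nonneg (neg_le_iff_add_nonneg.1 h1) (hφc x)
      simp only [Pi.zero_apply]
      rw [← neg_nonneg]
      refine this.trans (le_of_eq ?_)
      ring
    have := hm h
    simp only [sub_self, e0, e1, add_zero, zero_sub] at this
    have h3 : 0 ≤ (1 / c) * (smAbs ε (φ x - φ v) + (φ x - φ v)) :=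
      mul_nonneg (by positivity)
        (by linarith [abs_le_smAbs ε (φ x - φ v), neg_abs_le (φ x - φ v)])
    rw [abs_of_nonpos (by linarith), div_eq_inv_mul, ← one_div]
    linarith

/-- A smooth cutoff between two concentric balls. -/
lemma exists_cutoff {r R : ℝ} (hr : r < R) (hR : 0 < R) :
    ∃ ρ : EuclideanSpace ℝ (Fin N) → ℝ, ContDiff ℝ 2 ρ ∧ (∀ z, 0 ≤ ρ z) ∧
      (∀ z, ‖z‖ ≤ r → ρ z = 1) ∧ ∃ r' < R, ∀ z, r' < ‖z‖ → ρ z = 0 := by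
  have h1 : r ≤ max r (R / 2) := le_max_left _ _
  have h2 : R / 2 ≤ max r (R / 2) := le_max_right _ _
  have h3 : max r (R / 2) < R := max_lt hr (by linarith)
  let b : ContDiffBump (0 : EuclideanSpace ℝ (Fin N)) :=
    ⟨max r (R / 2), (max r (R / 2) + R) / 2, by linarith, by linarith⟩
  refine ⟨b, b.contDiff, fun z => b.nonneg, fun z hz => ?_, (max r (R / 2) + R) / 2, by linarith,
    fun z hz => ?_⟩
  · refine b.one_of_mem_closedBall ?_
    rw [mem_closedBall_zero_iff]
    exact hz.trans h1
  · refine b.zero_of_le_dist ?_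
    simpa using hz.le

lemma IsSol.kato (hs : IsSol φ f c M w) {R : ℝ} (hR : 0 < R) {r : ℝ} (hr : r < R) (n : ℝ) :
    ∃ C, ∀ a b, a ≤ b → BalancedOn w R a b → (∀ z, ‖z‖ ≤ R → |deriv (w z) a| ≤ n) →
      ∫ z in Metric.closedBall 0 r, |w z b - w z a| ≤ C * (b - a) := by
  obtain ⟨ρ, hρ, hρ0, hρ1, r', hr', hρr⟩ := exists_cutoff (N := N) hr hR
  have hρc : HasCompactSupport ρ :=
    HasCompactSupport.intro (isCompact_closedBall 0 r') fun z hz => hρr z (by simpa using hz)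
  have hφc := hs.contDiff_phi.continuous
  have hfc := hs.contDiff_f.continuous
  have hφd : Differentiable ℝ φ := hs.contDiff_phi.differentiable (by norm_num)
  have hρcont := hρ.continuous
  have hlρ := continuous_lap hρ
  obtain ⟨K3, hK3⟩ : ∃ K, ∀ s ∈ Icc (-M) M, |f s| ≤ K :=
    (isCompact_Icc (a := -M) (b := M)).exists_bound_of_continuousOn (f := f) hfc.continuousOn
  obtain ⟨K1, hK1⟩ : ∃ K, ∀ s ∈ Icc (-M) M, |φ s| ≤ K :=
    (isCompact_Icc (a := -M) (b := M)).exists_bound_of_continuousOn (f := φ) hφc.continuousOn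
  have mw (z t) : w z t ∈ Icc (-M) M := abs_le.1 (hs.bdd z t)
  have hlρc := hasCompactSupport_lap hρ hρc
  refine ⟨∫ z, (|lap ρ z| * (1 + 2 * K1) + ρ z * (|n| + 2 * K3)), fun a b hab hbal hn => ?_⟩
  set UB := ∫ z, (|lap ρ z| * (1 + 2 * K1) + ρ z * (|n| + 2 * K3)) with hUB
  have hwa : Continuous fun z => w z a := (hs.space a).continuous
  have hwb : Continuous fun z => w z b := (hs.space b).continuous
  have main (ε : ℝ) (hε : 0 < ε) (hε1 : ε ≤ 1) :
      ∫ z, ρ z * (|w z b - w z a| - ε / c) ≤ UB * (b - a) := by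
    have hcont : Continuous fun y => y / smAbs ε y :=
      continuous_id.div (continuous_smAbs ε) fun y => (smAbs_pos hε y).ne'
    obtain ⟨⟨hi, he⟩, -, hu⟩ := hs.compDens_balance hr' hbal (v := fun z => w z a) (ρ := ρ)
      (h := fun y => y / smAbs ε y) (h' := fun y => ε ^ 2 / smAbs ε y ^ 3) (H := smAbs ε)
      (hs.space a) (fun z => hs.bdd z a) hρ hρr hρ0 (hasDerivAt_div_smAbs hε)
      (continuous_const.div ((continuous_smAbs ε).pow 3) fun y => (pow_pos (smAbs_pos hε y) 3).ne')
      (fun y => div_nonneg (by positivity) (pow_pos (smAbs_pos hε y) 3).le)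
      (hasDerivAt_smAbs hε)
    have e0 : ∫ z, ρ z * compDens φ (fun y => y / smAbs ε y) (w z a) (w z a) = 0 := by
      simp [compDens]
    have hlow : ∫ z, ρ z * (|w z b - w z a| - ε / c) ≤
        ∫ z, ρ z * compDens φ (fun y => y / smAbs ε y) (w z a) (w z b) := by
      refine integral_mono (Continuous.integrable_of_hasCompactSupport (by fun_prop) hρc.mul_right)
        (Continuous.integrable_of_hasCompactSupport ?_ hρc.mul_right) fun z =>
        mul_le_mul_of_nonneg_left (abs_sub_le_compDens hε hs.cpos hφd hs.le_deriv _ _) (hρ0 z)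
      exact hρcont.mul ((continuous_compDens hφc hcont).comp (hwa.prodMk hwb))
    have hub (t : ℝ) : ∫ z, ρ z * ((φ (w z t) - φ (w z a)) / smAbs ε (φ (w z t) - φ (w z a)) *
        deriv (w z) t) ≤ UB := by
      have hwt : Continuous fun z => w z t := (hs.space t).continuous
      have hlc := continuous_lap (hs.contDiff_comp a)
      have hsc := continuous_smAbs ε
      refine (hu t).trans (integral_mono ?_ ?_ fun z => ?_)
      · refine (Continuous.integrable_of_hasCompactSupport (by fun_prop) hlρc.mul_right).add
          (Continuous.integrable_of_hasCompactSupport ?_ hρc.mul_right)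
        exact hρcont.mul ((hcont.comp (by fun_prop : Continuous fun z => φ (w z t) - φ (w z a))).mul
          (by fun_prop))
      · exact (Continuous.integrable_of_hasCompactSupport (by fun_prop) hlρc.norm.mul_right).add
          (Continuous.integrable_of_hasCompactSupport (by fun_prop) hρc.mul_right)
      · refine add_le_add ?_ ?_
        · refine (le_abs_self _).trans ?_
          rw [abs_mul, abs_of_pos (smAbs_pos hε _)]
          refine mul_le_mul_of_nonneg_left ((smAbs_le hε.le _).trans ?_) (abs_nonneg _)
          have := abs_sub (φ (w z t)) (φ (w z a))
          linarith [hK1 _ (mw z t), hK1 _ (mw z a)]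
        · by_cases hz : r' < ‖z‖
          · simp [hρr z hz]
          refine mul_le_mul_of_nonneg_left ((le_abs_self _).trans ?_) (hρ0 z)
          rw [abs_mul]
          have h1 : lap (fun y => φ (w y a)) z = deriv (w z) a - f (w z a) := by
            rw [hs.eq]; ring
          have h2 := hn z ((not_lt.1 hz).trans hr'.le)
          have h3 : |lap (fun y => φ (w y a)) z + f (w z t)| ≤ |n| + 2 * K3 := by
            rw [h1]
            have a1 := abs_add_le (deriv (w z) a - f (w z a)) (f (w z t))
            have a2 := abs_sub (deriv (w z) a) (f (w z a))
            linarith [hK3 _ (mw z t), hK3 _ (mw z a), le_abs_self n]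
          calc _ ≤ 1 * (|n| + 2 * K3) := mul_le_mul (abs_div_smAbs_le hε _) h3 (abs_nonneg _)
                zero_le_one
            _ = _ := one_mul _
    rw [e0, sub_zero] at he
    refine hlow.trans (he.trans_le ?_)
    calc _ ≤ ∫ t in a..b, UB := intervalIntegral.integral_mono_on hab hi (by simp) fun t _ => hub t
      _ = UB * (b - a) := by simp [mul_comm]
  have hi1 : Integrable fun z => ρ z * |w z b - w z a| :=
    Continuous.integrable_of_hasCompactSupport (by fun_prop) hρc.mul_right
  have hi2 : Integrable ρ := hρcont.integrable_of_hasCompactSupport hρc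
  have lim : ∫ z, ρ z * |w z b - w z a| ≤ UB * (b - a) := by
    have : ∀ ε > 0, ε ≤ 1 → ∫ z, ρ z * |w z b - w z a| ≤ UB * (b - a) + ε / c * ∫ z, ρ z := by
      intro ε hε hε1
      have := main ε hε hε1
      have e : ∫ z, ρ z * (|w z b - w z a| - ε / c) =
          (∫ z, ρ z * |w z b - w z a|) - ε / c * ∫ z, ρ z := by
        rw [← integral_const_mul, ← integral_sub hi1 (hi2.const_mul _)]
        exact integral_congr_ae (ae_of_all _ fun z => by simp only; ring)
      linarith
    have ht : Tendsto (fun ε : ℝ => UB * (b - a) + ε / c * ∫ z, ρ z) (nhdsWithin 0 (Ioi 0))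
        (nhds (UB * (b - a) + 0 / c * ∫ z, ρ z)) := by
      refine tendsto_nhdsWithin_of_tendsto_nhds (Continuous.tendsto ?_ 0)
      fun_prop
    rw [zero_div, zero_mul, add_zero] at ht
    refine ge_of_tendsto ht ?_
    filter_upwards [Ioc_mem_nhdsGT (zero_lt_one' ℝ)] with ε hε
    exact this ε hε.1 hε.2
  refine le_trans ?_ lim
  rw [← integral_indicator measurableSet_closedBall]
  refine integral_mono ?_ hi1 fun z => ?_
  · exact (ContinuousOn.integrableOn_compact
    (isCompact_closedBall _ _) (by fun_prop)).integrable_indicator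
      measurableSet_closedBall
  · by_cases hz : z ∈ Metric.closedBall (0 : EuclideanSpace ℝ (Fin N)) r
    · rw [indicator_of_mem hz, hρ1 z (by simpa using hz), one_mul]
    · rw [indicator_of_notMem hz]
      exact mul_nonneg (hρ0 z) (abs_nonneg _)

/-- The balance law holds for bounded classical solutions on every time interval. -/
theorem IsSol.balancedOn (hs : IsSol φ f c M w) (R : ℝ) {a b : ℝ} (hab : a ≤ b) :
    BalancedOn w R a b := by
  have key := balancedOn_all (w := w) (R := max R 1)
    (fun r hr n => hs.kato (lt_max_of_lt_right one_pos) hr n)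
    (fun t => (hs.space t).continuous) hs.continuous_deriv_time hs.continuous_deriv_space hab
  exact fun r hr => key r (lt_max_of_lt_left hr)

end KatoApplied

section Trapping

/-- A bounded function on the line which satisfies a damped integral inequality stays below its
equilibrium value. -/
lemma le_of_damped {Y : ℝ → ℝ} {κ e K : ℝ} (hκ : 0 < κ) (hY : Continuous Y) (hK : ∀ t, Y t ≤ K)
    (h : ∀ a b, a ≤ b → Y b - Y a ≤ ∫ t in a..b, (e - κ * Y t)) (b : ℝ) : κ * Y b ≤ e := by
  by_contra! hlt
  have hi (x y : ℝ) : IntervalIntegrable (fun t => e - κ * Y t) volume x y :=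
    Continuous.intervalIntegrable (by fun_prop) x y
  have hc : Continuous fun t => e - κ * Y t := by fun_prop
  let Z : ℝ → ℝ := fun a => Y b + ∫ t in b..a, (e - κ * Y t)
  have hZ (a : ℝ) : HasDerivAt Z (e - κ * Y a) a :=
    (intervalIntegral.integral_hasDerivAt_right (hi _ _)
      (hc.stronglyMeasurableAtFilter _ _) hc.continuousAt).const_add _
  have hZY (a : ℝ) (ha : a ≤ b) : Z a ≤ Y a := by
    have := h a b ha
    simp only [Z]
    rw [intervalIntegral.integral_symm]
    linarith
  have hG (a : ℝ) : HasDerivAt (fun a => (κ * Z a - e) * exp (κ * a))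
      ((κ * (e - κ * Y a)) * exp (κ * a) + (κ * Z a - e) * (exp (κ * a) * (κ * 1))) a :=
    (((hZ a).const_mul κ).sub_const e).mul (((hasDerivAt_id a).const_mul κ).exp)
  have hanti : AntitoneOn (fun a => (κ * Z a - e) * exp (κ * a)) (Iic b) := by
    refine antitoneOn_of_deriv_nonpos (convex_Iic b)
      (fun a _ => (hG a).continuousAt.continuousWithinAt)
      (fun a _ => (hG a).differentiableAt.differentiableWithinAt) fun a ha => ?_
    rw [interior_Iic] at ha
    rw [(hG a).deriv]
    have h1 : κ * Z a ≤ κ * Y a := mul_le_mul_of_nonneg_left (hZY a (le_of_lt ha)) hκ.le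
    have : κ * (e - κ * Y a) * exp (κ * a) + (κ * Z a - e) * (exp (κ * a) * (κ * 1)) =
        κ * exp (κ * a) * (κ * Z a - κ * Y a) := by ring
    rw [this]
    exact mul_nonpos_of_nonneg_of_nonpos (by positivity) (by linarith)
  set δ := κ * Y b - e with hδ
  have hδ0 : 0 < δ := by linarith
  have hgrow (s : ℝ) (hs : 0 ≤ s) : δ * (κ * s) ≤ κ * K - e := by
    have h1 := hanti (show b - s ∈ Iic b by simp [hs]) (self_mem_Iic) (by linarith)
    simp only at h1
    have hZb : Z b = Y b := by simp [Z]
    rw [hZb, ← hδ] at h1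
    have h2 : δ * exp (κ * s) ≤ κ * Z (b - s) - e := by
      have e1 : exp (κ * b) = exp (κ * s) * exp (κ * (b - s)) := by rw [← exp_add]; ring_nf
      rw [e1, ← mul_assoc] at h1
      exact le_of_mul_le_mul_right h1 (exp_pos _)
    have h3 := hZY (b - s) (by linarith)
    have h4 := add_one_le_exp (κ * s)
    have h5 : κ * Z (b - s) ≤ κ * K := mul_le_mul_of_nonneg_left (h3.trans (hK _)) hκ.le
    nlinarith
  have h1 := hgrow (max 0 ((κ * K - e + 1) / (δ * κ))) (le_max_left _ _)
  have h2 : (κ * K - e + 1) / (δ * κ) ≤ max 0 ((κ * K - e + 1) / (δ * κ)) := le_max_right _ _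
  rw [div_le_iff₀ (by positivity)] at h2
  nlinarith

variable {N : ℕ}

lemma pd_comp_smul {g : EuclideanSpace ℝ (Fin N) → ℝ} (hg : Differentiable ℝ g) (c : ℝ)
    (i : Fin N) (x : EuclideanSpace ℝ (Fin N)) :
    pd i (fun z => g (c • z)) x = c * pd i g (c • x) := by
  unfold pd
  have h := ((hg (c • x)).hasFDerivAt).comp x
    ((c • ContinuousLinearMap.id ℝ (EuclideanSpace ℝ (Fin N))).hasFDerivAt)
  have h' : HasFDerivAt (fun z => g (c • z)) ((fderiv ℝ g (c • x)).comp
      (c • ContinuousLinearMap.id ℝ (EuclideanSpace ℝ (Fin N)))) x := h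
  rw [h'.fderiv]
  simp

lemma lap_comp_smul {g : EuclideanSpace ℝ (Fin N) → ℝ} (hg : ContDiff ℝ 2 g) (c : ℝ)
    (x : EuclideanSpace ℝ (Fin N)) :
    lap (fun z => g (c • z)) x = c ^ 2 * lap g (c • x) := by
  rw [lap_eq_sum_pd (g := fun z => g (c • z)) (hg.comp (contDiff_const_smul c)),
    lap_eq_sum_pd hg, Finset.mul_sum]
  refine Finset.sum_congr rfl fun i _ => ?_
  rw [funext (pd_comp_smul (hg.differentiable (by norm_num)) c i),
    pd_const_mul (g := fun z => pd i g (c • z)) c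
      (((contDiff_pd_one hg i).comp (contDiff_const_smul c)).differentiable
      (by norm_num) x), pd_comp_smul ((contDiff_pd_one hg i).differentiable (by norm_num))]
  ring

variable {φ f : ℝ → ℝ} {c M : ℝ} {w : EuclideanSpace ℝ (Fin N) → ℝ → ℝ}

lemma compDens_le {h : ℝ → ℝ} (hφ : Continuous φ) (hφm : Monotone φ) (hh : Continuous h)
    (hm : Monotone h) (v x : ℝ) : compDens φ h v x ≤ h (φ x - φ v) * (x - v) := by
  have hi (a b : ℝ) : IntervalIntegrable (fun s => h (φ s - φ v)) volume a b :=
    Continuous.intervalIntegrable (by fun_prop) a b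
  unfold compDens
  rcases le_total v x with hv | hv
  · refine (intervalIntegral.integral_mono_on hv (hi _ _) intervalIntegrable_const
      fun s hs => hm (sub_le_sub_right (hφm hs.2) _)).trans (le_of_eq ?_)
    simp [mul_comm]
  · rw [intervalIntegral.integral_symm]
    have := intervalIntegral.integral_mono_on (f := fun _ => h (φ x - φ v)) hv
      intervalIntegrable_const (hi x v) fun s hs => hm (sub_le_sub_right (hφm hs.1) _)
    simp only [intervalIntegral.integral_const, smul_eq_mul] at this
    linarith

lemma compDens_nonneg {h : ℝ → ℝ} (hφ : Continuous φ) (hφm : Monotone φ) (hh : Continuous h)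
    (hm : Monotone h) (h0 : h 0 = 0) (v x : ℝ) : 0 ≤ compDens φ h v x := by
  have hi (a b : ℝ) : IntervalIntegrable (fun s => h (φ s - φ v)) volume a b :=
    Continuous.intervalIntegrable (by fun_prop) a b
  unfold compDens
  rcases le_total v x with hv | hv
  · refine intervalIntegral.integral_nonneg hv fun s hs => ?_
    rw [← h0]; exact hm (sub_nonneg.2 (hφm hs.1))
  · rw [intervalIntegral.integral_symm, neg_nonneg]
    refine (intervalIntegral.integral_mono_on (g := fun _ => 0) hv (hi _ _)
      intervalIntegrable_const fun s hs => ?_).trans (by simp)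
    rw [← h0]; exact hm (sub_nonpos.2 (hφm hs.2))

lemma prim_le_compDens {h H : ℝ → ℝ} {Λ : ℝ} (hφ : ContDiff ℝ 1 φ) (hφm : Monotone φ)
    (hh : Continuous h) (hm : Monotone h) (h0 : h 0 = 0) (hH : ∀ y, HasDerivAt H (h y) y)
    (hH0 : H 0 = 0) (hΛ : ∀ s ∈ Icc (-M) M, deriv φ s ≤ Λ) {v x : ℝ} (hv : v ∈ Icc (-M) M)
    (hx : x ∈ Icc (-M) M) : H (φ x - φ v) ≤ Λ * compDens φ h v x := by
  have hφc := hφ.continuous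
  have hdc : Continuous (deriv φ) := hφ.continuous_deriv (by norm_num)
  have hi (a b : ℝ) : IntervalIntegrable (fun s => Λ * h (φ s - φ v)) volume a b :=
    Continuous.intervalIntegrable (by fun_prop) a b
  have hi' (a b : ℝ) : IntervalIntegrable (fun s => h (φ s - φ v) * deriv φ s) volume a b :=
    Continuous.intervalIntegrable (by fun_prop) a b
  have e : H (φ x - φ v) = ∫ s in v..x, h (φ s - φ v) * deriv φ s := by
    rw [intervalIntegral.integral_eq_sub_of_hasDerivAt (f := fun s => H (φ s - φ v))
      (fun s _ => ?_) (hi' _ _)]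
    · simp [hH0]
    · exact (hH _).comp s (((hφ.differentiable (by norm_num)) s).hasDerivAt.sub_const _)
  rw [e, compDens, ← intervalIntegral.integral_const_mul]
  rcases le_total v x with hvx | hvx
  · refine intervalIntegral.integral_mono_on hvx (hi' _ _) (hi _ _) fun s hs => ?_
    rw [mul_comm]
    refine mul_le_mul_of_nonneg_right (hΛ s ⟨hv.1.trans hs.1, hs.2.trans hx.2⟩) ?_
    rw [← h0]; exact hm (sub_nonneg.2 (hφm hs.1))
  · rw [intervalIntegral.integral_symm, intervalIntegral.integral_symm x v, neg_le_neg_iff]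
    refine intervalIntegral.integral_mono_on hvx (hi _ _) (hi' _ _) fun s hs => ?_
    rw [mul_comm (h _)]
    refine mul_le_mul_of_nonpos_right (hΛ s ⟨hx.1.trans hs.1, hs.2.trans hv.2⟩) ?_
    rw [← h0]; exact hm (sub_nonpos.2 (hφm hs.2))

/-- A one-sided comparison principle with a stationary solution `v` on the whole space-time: if the
reaction is strictly dissipative wherever `h (φ w - φ v) ≠ 0`, then `H (φ w - φ v) ≤ 0`. -/
theorem IsSol.trap (hs : IsSol φ f c M w) {v : EuclideanSpace ℝ (Fin N) → ℝ} {h h' H : ℝ → ℝ}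
    (hv : ContDiff ℝ 2 v) (hvM : ∀ z, |v z| ≤ M)
    (hveq : ∀ z, lap (fun y => φ (v y)) z + f (v z) = 0)
    (hh : ∀ y, HasDerivAt h (h' y) y) (hh' : Continuous h') (hmono : ∀ y, 0 ≤ h' y)
    (hH : ∀ y, HasDerivAt H (h y) y) (h0 : h 0 = 0) (hH0 : H 0 = 0) {κ : ℝ} (hκ : 0 < κ)
    (hdiss : ∀ z t, h (φ (w z t) - φ (v z)) * (f (w z t) - f (v z)) ≤
      -κ * (h (φ (w z t) - φ (v z)) * (w z t - v z))) (z : EuclideanSpace ℝ (Fin N)) (t : ℝ) :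
    H (φ (w z t) - φ (v z)) ≤ 0 := by
  have hφc := hs.contDiff_phi.continuous
  have hhc : Continuous h := continuous_iff_continuousAt.2 fun y => (hh y).continuousAt
  have hHc : Continuous H := continuous_iff_continuousAt.2 fun y => (hH y).continuousAt
  have hm : Monotone h := monotone_of_hasDerivAt_nonneg hh hmono
  have hφm : Monotone φ := monotone_of_deriv_nonneg (hs.contDiff_phi.differentiable (by norm_num))
    fun s => hs.cpos.le.trans (hs.le_deriv s)
  have hφ1 : ContDiff ℝ 1 φ := hs.contDiff_phi.of_le (by norm_num)
  have mv (z) : v z ∈ Icc (-M) M := abs_le.1 (hvM z)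
  have mw (z t) : w z t ∈ Icc (-M) M := abs_le.1 (hs.bdd z t)
  have hvc := hv.continuous
  have hfc := hs.contDiff_f.continuous
  obtain ⟨Λ, hΛ⟩ : ∃ K, ∀ s ∈ Icc (-M) M, |deriv φ s| ≤ K :=
    (isCompact_Icc (a := -M) (b := M)).exists_bound_of_continuousOn
      (f := deriv φ) (hφ1.continuous_deriv (by norm_num)).continuousOn
  have hΛ0 : 0 ≤ Λ := (abs_nonneg _).trans (hΛ _ (mv 0))
  have hΛ' (s : ℝ) (hs : s ∈ Icc (-M) M) : deriv φ s ≤ Λ := (le_abs_self _).trans (hΛ s hs)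
  have hcd := continuous_compDens hφc hhc
  set 𝓜 : EuclideanSpace ℝ (Fin N) → ℝ → ℝ := fun z t => compDens φ h (v z) (w z t) with h𝓜
  have h𝓜0 (z t) : 0 ≤ 𝓜 z t := compDens_nonneg hφc hφm hhc hm h0 _ _
  have h𝓜c (t : ℝ) : Continuous fun z => 𝓜 z t := hcd.comp (hvc.prodMk (hs.space t).continuous)
  have hH𝓜 (z t) : H (φ (w z t) - φ (v z)) ≤ Λ * 𝓜 z t :=
    prim_le_compDens hφ1 hφm hhc hm h0 hH hH0 hΛ' (mv z) (mw z t)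
  have hHnn (y : ℝ) : 0 ≤ H y := by
    have := compDens_nonneg continuous_id monotone_id hhc hm h0 0 y
    have e : compDens id h 0 y = H y := by
      simp only [compDens, id, sub_zero]
      rw [intervalIntegral.integral_eq_sub_of_hasDerivAt (fun s _ => hH s)
        (hhc.intervalIntegrable _ _), hH0, sub_zero]
    rwa [e] at this
  obtain ⟨K𝓜, hK𝓜⟩ : ∃ K, ∀ z t, 𝓜 z t ≤ K := by
    obtain ⟨K, hK⟩ := ((isCompact_Icc (a := -M) (b := M)).prod
      (isCompact_Icc (a := -M) (b := M))).exists_bound_of_continuousOn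
      (f := fun p => compDens φ h p.1 p.2) hcd.continuousOn
    exact ⟨K, fun z t => (le_abs_self _).trans (hK (v z, w z t) ⟨mv z, mw z t⟩)⟩
  have hK𝓜0 : 0 ≤ K𝓜 := (h𝓜0 0 0).trans (hK𝓜 0 0)
  let ϑ : ContDiffBump (0 : EuclideanSpace ℝ (Fin N)) := ⟨1, 2, one_pos, one_lt_two⟩
  have hϑ : ContDiff ℝ 2 ϑ := ϑ.contDiff
  have hϑc : HasCompactSupport ϑ := ϑ.hasCompactSupport
  obtain ⟨A, hA⟩ := (hasCompactSupport_lap hϑ hϑc).exists_bound_of_continuous (continuous_lap hϑ)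
  have hA0 : 0 ≤ A := (norm_nonneg _).trans (hA 0)
  have hϑ1 (z : EuclideanSpace ℝ (Fin N)) (hz : ‖z‖ ≤ 1) : ϑ z = 1 :=
    ϑ.one_of_mem_closedBall (by rw [mem_closedBall_zero_iff]; exact hz)
  have hϑ0 (z : EuclideanSpace ℝ (Fin N)) (hz : 2 ≤ ‖z‖) : ϑ z = 0 :=
    ϑ.zero_of_le_dist (by rw [dist_zero_right]; exact hz)
  have hlapϑ (z : EuclideanSpace ℝ (Fin N)) (hz : 2 < ‖z‖) : lap ϑ z = 0 := by
    have : z ∉ tsupport (ϑ : EuclideanSpace ℝ (Fin N) → ℝ) := by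
      rw [ϑ.tsupport_eq]
      simpa [ϑ] using hz
    rw [lap_eq_sum_pd hϑ]
    refine Finset.sum_eq_zero fun i _ => image_eq_zero_of_notMem_tsupport fun h => this ?_
    exact tsupport_pd_subset _ i (tsupport_pd_subset _ i h)
  let ρ : ℝ → EuclideanSpace ℝ (Fin N) → ℝ := fun L z => ϑ (L⁻¹ • z)
  have hρ2 (L : ℝ) : ContDiff ℝ 2 (ρ L) := hϑ.comp (contDiff_const_smul L⁻¹)
  have hρnn (L z) : 0 ≤ ρ L z := ϑ.nonneg
  have hρ0 {L : ℝ} (hL : 0 < L) (z) (hz : 2 * L < ‖z‖) : ρ L z = 0 := by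
    refine hϑ0 _ ?_
    rw [norm_smul, norm_inv, Real.norm_of_nonneg hL.le, inv_mul_eq_div, le_div_iff₀ hL]
    exact hz.le
  have hρ1 {L : ℝ} (hL : 0 < L) (z) (hz : ‖z‖ ≤ L) : ρ L z = 1 := by
    refine hϑ1 _ ?_
    rw [norm_smul, norm_inv, Real.norm_of_nonneg hL.le, inv_mul_eq_div, div_le_one hL]
    exact hz
  have hρc {L : ℝ} (hL : 0 < L) : HasCompactSupport (ρ L) :=
    HasCompactSupport.intro (isCompact_closedBall 0 (2 * L)) fun z hz =>
      hρ0 hL z (by simpa using hz)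
  have hlapρ {L : ℝ} (hL : 0 < L) (z) : lap (ρ L) z ≤ A / L ^ 2 * ρ (2 * L) z := by
    rw [show lap (ρ L) z = L⁻¹ ^ 2 * lap ϑ (L⁻¹ • z) from lap_comp_smul hϑ _ _]
    by_cases hz : 2 * L < ‖z‖
    · rw [hlapϑ, mul_zero]
      · exact mul_nonneg (by positivity) (hρnn _ _)
      · rw [norm_smul, norm_inv, Real.norm_of_nonneg hL.le, inv_mul_eq_div, lt_div_iff₀ hL]
        exact hz
    · rw [hρ1 (by positivity) z (not_lt.1 hz), mul_one, div_eq_inv_mul, inv_pow]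
      exact mul_le_mul_of_nonneg_left ((le_abs_self _).trans (hA _)) (by positivity)
  let Y : ℝ → ℝ → ℝ := fun L t => ∫ z, ρ L z * 𝓜 z t
  have hYint {L : ℝ} (hL : 0 < L) (t : ℝ) : Integrable fun z => ρ L z * 𝓜 z t :=
    ((hρ2 L).continuous.mul (h𝓜c t)).integrable_of_hasCompactSupport (hρc hL).mul_right
  have hYcrude {L : ℝ} (hL : 0 < L) (t : ℝ) : Y L t ≤ (K𝓜 * ∫ z, ϑ z) * L ^ N := by
    have e : ∫ z, ρ L z = L ^ N * ∫ z, ϑ z := by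
      have := Measure.integral_comp_inv_smul
        (volume : Measure (EuclideanSpace ℝ (Fin N))) ϑ L
      simp only [finrank_euclideanSpace, Fintype.card_fin, smul_eq_mul] at this
      rw [abs_of_pos (by positivity)] at this
      exact this
    calc Y L t ≤ ∫ z, K𝓜 * ρ L z := integral_mono (hYint hL t)
          (((hρ2 L).continuous.integrable_of_hasCompactSupport (hρc hL)).const_mul _) fun z => by
            simp only
            rw [mul_comm]
            exact mul_le_mul_of_nonneg_right (hK𝓜 z t) (hρnn _ _)
      _ = _ := by rw [integral_const_mul, e]; ring
  have hYbal {L : ℝ} (hL : 0 < L) (a b : ℝ) (hab : a ≤ b) :=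
    hs.compDens_balance (lt_add_one (2 * L)) (hs.balancedOn (2 * L + 1) hab) hv hvM (hρ2 L)
      (hρ0 hL) (hρnn L) hh hh' hmono hH
  have hYcont {L : ℝ} (hL : 0 < L) : Continuous (Y L) := by
    refine continuous_iff_continuousAt.2 fun t => ?_
    exact (hYbal hL (t - 1) (t + 1) (by linarith)).2.1.continuousAt
      (Icc_mem_nhds (by linarith) (by linarith))
  have hiter {L S : ℝ} (hL : 0 < L) (hS : ∀ t, Y (2 * L) t ≤ S) (t : ℝ) :
      κ * Y L t ≤ Λ * A / L ^ 2 * S := by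
    refine le_of_damped hκ (hYcont hL) (hYcrude hL) (fun a b hab => ?_) t
    obtain ⟨⟨hi, he⟩, -, hu⟩ := hYbal hL a b hab
    refine he.trans_le (intervalIntegral.integral_mono_on hab hi
      (Continuous.intervalIntegrable (by have := hYcont hL; fun_prop) _ _) fun t _ => ?_)
    have hwt : Continuous fun z => w z t := (hs.space t).continuous
    have hlρ := continuous_lap (hρ2 L)
    have hρLc := (hρ2 L).continuous
    have hlv : Continuous (lap fun y => φ (v y)) :=
      continuous_lap ((hs.contDiff_phi.of_le (by norm_num)).comp hv)
    have i1 := (hYint (by positivity : 0 < 2 * L) t).const_mul (Λ * A / L ^ 2)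
    have i2 := (hYint hL t).const_mul κ
    calc _ ≤ ∫ z, (Λ * A / L ^ 2 * (ρ (2 * L) z * 𝓜 z t) - κ * (ρ L z * 𝓜 z t)) := by
          refine (hu t).trans (integral_mono ?_ (i1.sub i2) fun z => ?_)
          · exact (Continuous.integrable_of_hasCompactSupport (by fun_prop)
              (hasCompactSupport_lap (hρ2 L) (hρc hL)).mul_right).add
              (Continuous.integrable_of_hasCompactSupport (by fun_prop) (hρc hL).mul_right)
          · have a1 : lap (ρ L) z * H (φ (w z t) - φ (v z)) ≤
                Λ * A / L ^ 2 * (ρ (2 * L) z * 𝓜 z t) := by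
              calc _ ≤ A / L ^ 2 * ρ (2 * L) z * (Λ * 𝓜 z t) :=
                    mul_le_mul (hlapρ hL z) (hH𝓜 z t) (hHnn _)
                      (mul_nonneg (by positivity) (hρnn _ _))
                _ = _ := by ring
            have a2 : ρ L z * (h (φ (w z t) - φ (v z)) *
                (lap (fun y => φ (v y)) z + f (w z t))) ≤ -(κ * (ρ L z * 𝓜 z t)) := by
              have e1 : lap (fun y => φ (v y)) z + f (w z t) = f (w z t) - f (v z) := by
                linarith [hveq z]
              have e2 : 𝓜 z t ≤ _ := compDens_le hφc hφm hhc hm (v z) (w z t)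
              have e3 := hdiss z t
              rw [e1]
              have e4 := mul_le_mul_of_nonneg_left e2 hκ.le
              have := mul_le_mul_of_nonneg_left (e3.trans (by linarith : _ ≤ -(κ * 𝓜 z t)))
                (hρnn L z)
              linarith
            simp only
            linarith
      _ = Λ * A / L ^ 2 * Y (2 * L) t - κ * Y L t := by
          rw [integral_sub i1 i2, integral_const_mul, integral_const_mul]
      _ ≤ _ := by
          have := mul_le_mul_of_nonneg_left (hS t) (by positivity : 0 ≤ Λ * A / L ^ 2)
          linarith
  have hdecay (j : ℕ) : ∃ K, 0 ≤ K ∧ ∀ L, 0 < L → ∀ t, Y L t * L ^ (2 * j) ≤ K * L ^ N := by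
    induction j with
    | zero => exact ⟨K𝓜 * ∫ z, ϑ z, mul_nonneg hK𝓜0 (integral_nonneg fun z => ϑ.nonneg),
        fun L hL t => by simpa using hYcrude hL t⟩
    | succ j ih =>
      obtain ⟨K, hK0, hK⟩ := ih
      refine ⟨κ⁻¹ * (Λ * A * (K * 2 ^ N)), by positivity, fun L hL t => ?_⟩
      have h1 := hiter hL (S := K * (2 * L) ^ N / (2 * L) ^ (2 * j)) (fun t => by
        rw [le_div_iff₀ (by positivity)]; exact hK _ (by positivity) t) t
      have h2 : K * (2 * L) ^ N / (2 * L) ^ (2 * j) ≤ K * (2 * L) ^ N / L ^ (2 * j) := by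
        refine div_le_div_of_nonneg_left (by positivity) (by positivity) ?_
        exact pow_le_pow_left₀ hL.le (by linarith) _
      have h3 := h1.trans (mul_le_mul_of_nonneg_left h2 (by positivity))
      rw [← le_inv_mul_iff₀ hκ] at h3
      refine (mul_le_mul_of_nonneg_right h3 (by positivity)).trans (le_of_eq ?_)
      field_simp
      ring
  obtain ⟨K, hK0, hK⟩ := hdecay (N + 1)
  have hball (r : ℝ) (hr : 0 < r) : ∫ z in Metric.closedBall 0 r, 𝓜 z t ≤ 0 := by
    have hle (L : ℝ) (hL : max 1 r ≤ L) : ∫ z in Metric.closedBall 0 r, 𝓜 z t ≤ K / L := by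
      have hL1 : 1 ≤ L := (le_max_left _ _).trans hL
      have hL0 : 0 < L := by linarith
      calc _ ≤ Y L t := by
            rw [← integral_indicator measurableSet_closedBall]
            refine integral_mono ?_ (hYint hL0 t) fun z => ?_
            · exact (ContinuousOn.integrableOn_compact (isCompact_closedBall _ _)
                (h𝓜c t).continuousOn).integrable_indicator measurableSet_closedBall
            · by_cases hz : z ∈ Metric.closedBall (0 : EuclideanSpace ℝ (Fin N)) r
              · rw [indicator_of_mem hz, hρ1 hL0 z, one_mul]
                exact (mem_closedBall_zero_iff.1 hz).trans ((le_max_right _ _).trans hL)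
              · rw [indicator_of_notMem hz]
                exact mul_nonneg (hρnn _ _) (h𝓜0 _ _)
        _ ≤ K / L := by
            rw [le_div_iff₀ hL0]
            have h1 := hK L hL0 t
            have h2 : L ^ (2 * (N + 1)) = L ^ (N + 1) * L * L ^ N := by ring
            rw [h2, ← mul_assoc] at h1
            have h3 := le_of_mul_le_mul_right h1 (by positivity)
            refine le_trans ?_ h3
            rw [← mul_assoc]
            refine mul_le_mul_of_nonneg_right ?_ hL0.le
            exact le_mul_of_one_le_right (integral_nonneg fun z => mul_nonneg (hρnn _ _) (h𝓜0 _ _))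
              (one_le_pow₀ hL1)
    have hlim : Tendsto (fun L : ℝ => K / L) atTop (nhds 0) :=
      tendsto_const_nhds.div_atTop tendsto_id
    exact ge_of_tendsto hlim ((eventually_ge_atTop (max 1 r)).mono hle)
  have hzero : 𝓜 z t = 0 := by
    by_contra hne
    have hpos : 0 < 𝓜 z t := lt_of_le_of_ne (h𝓜0 z t) (Ne.symm hne)
    have hr : 0 < ‖z‖ + 1 := by positivity
    have : 0 < ∫ z in Metric.closedBall 0 (‖z‖ + 1), 𝓜 z t := by
      rw [setIntegral_pos_iff_support_of_nonneg_ae (ae_of_all _ fun z => h𝓜0 z t)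
        (ContinuousOn.integrableOn_compact (isCompact_closedBall _ _) (h𝓜c t).continuousOn)]
      have ho : IsOpen (Function.support (fun z => 𝓜 z t) ∩
          Metric.ball (0 : EuclideanSpace ℝ (Fin N)) (‖z‖ + 1)) :=
        ((h𝓜c t).isOpen_support).inter Metric.isOpen_ball
      refine (ho.measure_pos volume ⟨z, hne, by simp⟩).trans_le (measure_mono ?_)
      exact inter_subset_inter_right _ Metric.ball_subset_closedBall
    linarith [hball _ hr]
  have := hH𝓜 z t
  rwa [hzero, mul_zero] at this

end Trapping

section WaveTrapping

lemma hasDerivAt_max_pow (n : ℕ) (y : ℝ) :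
    HasDerivAt (fun y : ℝ => max y 0 ^ (n + 2)) ((n + 2 : ℝ) * max y 0 ^ (n + 1)) y := by
  have hne (y : ℝ) (hy : y ≠ 0) :
      HasDerivAt (fun y : ℝ => max y 0 ^ (n + 2)) ((n + 2 : ℝ) * max y 0 ^ (n + 1)) y := by
    rcases lt_or_gt_of_ne hy with h | h
    · rw [max_eq_right h.le]
      refine ((hasDerivAt_const y (0 : ℝ)).congr_of_eventuallyEq ?_).congr_deriv (by simp)
      filter_upwards [Iio_mem_nhds h] with x hx
      have hx' : x < 0 := hx
      simp [max_eq_right hx'.le]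
    · rw [max_eq_left h.le]
      refine ((hasDerivAt_pow (n + 2) y).congr_of_eventuallyEq ?_).congr_deriv (by simp)
      filter_upwards [Ioi_mem_nhds h] with x hx
      have hx' : 0 < x := hx
      simp [max_eq_left hx'.le]
  by_cases hy : y = 0
  · subst hy
    exact hasDerivAt_of_hasDerivAt_of_ne (fun y hy => hne y hy)
      (by fun_prop) (by fun_prop)
  · exact hne y hy

lemma exists_dissipative {f : ℝ → ℝ} {α : ℝ} (hf : ContDiff ℝ 1 f) (hα : deriv f α < 0) :
    ∃ κ > 0, ∃ δ > 0, ∀ x y, α - δ ≤ x → x ≤ y → y ≤ α + δ → f y - f x ≤ -κ * (y - x) := by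
  have hc : ContinuousAt (deriv f) α := (hf.continuous_deriv (by norm_num)).continuousAt
  have hev : ∀ᶠ s in nhds α, deriv f s < deriv f α / 2 :=
    hc.eventually_lt continuousAt_const (by linarith)
  obtain ⟨δ, hδ, hball⟩ := Metric.eventually_nhds_iff.1 hev
  refine ⟨-deriv f α / 2, by linarith, δ / 2, by linarith, fun x y hx hxy hy => ?_⟩
  have hd (s : ℝ) : HasDerivAt f (deriv f s) s := (hf.differentiable (by norm_num) s).hasDerivAt
  have := Convex.image_sub_le_mul_sub_of_deriv_le (D := Icc (α - δ / 2) (α + δ / 2))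
    (convex_Icc _ _) hf.continuous.continuousOn (f := f)
    (fun s _ => (hd s).differentiableAt.differentiableWithinAt) (C := deriv f α / 2)
    (fun s hs => by
      rw [interior_Icc] at hs
      refine (hball ?_).le
      rw [dist_eq, abs_lt]
      constructor <;> linarith [hs.1, hs.2]) x ⟨hx, hxy.trans hy⟩ y ⟨hx.trans hxy, hy⟩ hxy
  linarith

lemma exists_dissipative_above {f : ℝ → ℝ} {α : ℝ} (hf : ContDiff ℝ 1 f) (hα : deriv f α < 0)
    (h0 : f α = 0) (hneg : ∀ s, α < s → f s < 0) (M : ℝ) :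
    ∃ κ > 0, ∃ δ > 0, ∀ x y, α - δ ≤ x → x ≤ α → x ≤ y → y ≤ M → f y - f x ≤ -κ * (y - x) := by
  obtain ⟨κ, hκ, δ, hδ, h⟩ := exists_dissipative hf hα
  obtain ⟨m, hm, hmf⟩ : ∃ m > 0, ∀ y ∈ Icc (α + δ) M, f y ≤ -m := by
    rcases (Icc (α + δ) M).eq_empty_or_nonempty with he | hne
    · exact ⟨1, one_pos, fun y hy => by simp [he] at hy⟩
    · obtain ⟨y0, hy0, hmax⟩ := isCompact_Icc.exists_isMaxOn hne hf.continuous.continuousOn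
      exact ⟨-f y0, neg_pos.2 (hneg _ (by linarith [hy0.1])), fun y hy => by
        rw [neg_neg]; exact hmax hy⟩
  refine ⟨min κ (m / (|M - α| + δ)), by positivity, δ, hδ, fun x y hx hxα hxy hyM => ?_⟩
  rcases le_total y (α + δ) with hy | hy
  · refine (h x y hx hxy hy).trans ?_
    have := mul_le_mul_of_nonneg_right (min_le_left κ (m / (|M - α| + δ))) (sub_nonneg.2 hxy)
    linarith
  · have h1 := h x α hx hxα (by linarith)
    have h2 := hmf y ⟨hy, hyM⟩
    have h3 : 0 ≤ κ * (α - x) := mul_nonneg hκ.le (by linarith)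
    have h4 : min κ (m / (|M - α| + δ)) * (y - x) ≤ m := by
      calc _ ≤ m / (|M - α| + δ) * (|M - α| + δ) :=
            mul_le_mul (min_le_right _ _) (by linarith [le_abs_self (M - α)]) (by linarith)
              (by positivity)
        _ = m := by field_simp
    linarith

/-- An increasing standing wave. -/
structure IsWave (φ f : ℝ → ℝ) (αm αp : ℝ) (U : ℝ → ℝ) : Prop where
  mono : StrictMono U
  C2 : ContDiff ℝ 2 U
  ode : ∀ z, deriv (deriv fun y => φ (U y)) z + f (U z) = 0
  lim_bot : Tendsto U atBot (nhds αm)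
  lim_top : Tendsto U atTop (nhds αp)

variable {N : ℕ} {φ f : ℝ → ℝ} {c M αm αp : ℝ} {w : EuclideanSpace ℝ (Fin N) → ℝ → ℝ} {U : ℝ → ℝ}

lemma IsWave.gt_bot (hU : IsWave φ f αm αp U) (x : ℝ) : αm < U x :=
  (hU.mono.monotone.le_of_tendsto hU.lim_bot (x - 1)).trans_lt (hU.mono (by linarith))

lemma IsWave.lt_top (hU : IsWave φ f αm αp U) (x : ℝ) : U x < αp :=
  (hU.mono (by linarith)).trans_le (hU.mono.monotone.ge_of_tendsto hU.lim_top (x + 1))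

lemma lap_comp_coord {g : ℝ → ℝ} (hg : ContDiff ℝ 2 g) (l : Fin N)
    (z : EuclideanSpace ℝ (Fin N)) : lap (fun y => g (y l)) z = deriv (deriv g) (z l) := by
  have hgd : ContDiff ℝ 1 (deriv g) :=
    ((contDiff_succ_iff_deriv (n := 1)).1 (by simpa [one_add_one_eq_two] using hg)).2.2
  have e1 (i : Fin N) : pd i (fun y : EuclideanSpace ℝ (Fin N) => g (y l)) =
      fun y => deriv g (y l) * (if i = l then 1 else 0) := by
    funext y
    rw [pd_comp ((hg.differentiable (by norm_num) _).hasDerivAt)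
      ((contDiff_coord (n := 1) l).differentiable (by norm_num) y), pd_coord]
  rw [lap_eq_sum_pd (g := fun y => g (y l)) (hg.comp (contDiff_coord l)), Finset.sum_eq_single l]
  · change pd l (pd l fun y : EuclideanSpace ℝ (Fin N) => g (y l)) z = _
    rw [e1]
    simp only [if_true, mul_one]
    rw [pd_comp ((hgd.differentiable (by norm_num) _).hasDerivAt)
      ((contDiff_coord (n := 1) l).differentiable (by norm_num) z), pd_coord]
    simp
  · intro i _ hil
    rw [e1]
    simp only [hil, if_false, mul_zero]
    exact pd_const 0
  · simp

variable {l : Fin N}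

lemma IsWave.translate (hs : IsSol φ f c M w) (hU : IsWave φ f αm αp U)
    (hMm : |αm| ≤ M) (hMp : |αp| ≤ M) (R : ℝ) :
    ContDiff ℝ 2 (fun z : EuclideanSpace ℝ (Fin N) => U (z l + R)) ∧
    (∀ z : EuclideanSpace ℝ (Fin N), |U (z l + R)| ≤ M) ∧
    ∀ z : EuclideanSpace ℝ (Fin N), lap (fun y => φ (U (y l + R))) z + f (U (z l + R)) = 0 := by
  refine ⟨hU.C2.comp ((contDiff_coord l).add contDiff_const), fun z => abs_le.2 ⟨?_, ?_⟩,
    fun z => ?_⟩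
  · linarith [hU.gt_bot (z l + R), (abs_le.1 hMm).1]
  · linarith [hU.lt_top (z l + R), (abs_le.1 hMp).2]
  · have hP : ContDiff ℝ 2 fun x => φ (U x) := (hs.contDiff_phi.of_le (by norm_num)).comp hU.C2
    rw [lap_comp_coord (g := fun x => φ (U (x + R)))
      (hP.comp (contDiff_id.add contDiff_const)) l z]
    rw [show (deriv fun x => φ (U (x + R))) = fun x => deriv (fun y => φ (U y)) (x + R) from
      funext fun x => deriv_comp_add_const (f := fun y => φ (U y)) ..]
    rw [deriv_comp_add_const]
    exact hU.ode _

lemma IsSol.le_wave (hs : IsSol φ f c M w) (hU : IsWave φ f αm αp U)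
    (hMm : |αm| ≤ M) (hMp : |αp| ≤ M) (hfm : deriv f αm < 0) (hfp : deriv f αp < 0)
    (hp0 : f αp = 0) (hfabove : ∀ s, αp < s → f s < 0)
    (hlimm : ∀ δ > 0, ∃ R, ∀ z t, z l ≤ -R → |w z t - αm| < δ) :
    ∃ R0, ∀ R ≥ R0, ∀ z t, w z t ≤ U (z l + R) := by
  have hf1 : ContDiff ℝ 1 f := hs.contDiff_f.of_le (by norm_num)
  have hφm : StrictMono φ := strictMono_of_deriv_pos fun s => hs.cpos.trans_le (hs.le_deriv s)
  obtain ⟨κ1, hκ1, δ1, hδ1, h1⟩ := exists_dissipative hf1 hfm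
  obtain ⟨κ2, hκ2, δ2, hδ2, h2⟩ := exists_dissipative_above hf1 hfp hp0 hfabove M
  obtain ⟨R1, hR1⟩ := hlimm δ1 hδ1
  obtain ⟨R3, hR3⟩ := eventually_atTop.1 (hU.lim_top.eventually (Ioi_mem_nhds
    (by linarith : αp - δ2 < αp)))
  refine ⟨R3 + R1, fun R hR z t => ?_⟩
  obtain ⟨hv, hvM, hveq⟩ := IsWave.translate (l := l) hs hU hMm hMp R
  have key := hs.trap (h := fun y => max y 0 ^ 2) (h' := fun y => 2 * max y 0)
    (H := fun y => max y 0 ^ 3 / 3) hv hvM hveq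
    (fun y => (hasDerivAt_max_pow 0 y).congr_deriv (by simp)) (by fun_prop)
    (fun y => by positivity)
    (fun y => ((hasDerivAt_max_pow 1 y).div_const 3).congr_deriv (by norm_num))
    (by simp) (by simp) (κ := min κ1 κ2) (lt_min hκ1 hκ2) (fun z t => ?_) z t
  · simp only at key
    by_contra! hlt
    have : 0 < φ (w z t) - φ (U (z l + R)) := sub_pos.2 (hφm hlt)
    rw [max_eq_left this.le] at key
    have := pow_pos this 3
    linarith
  · rcases le_total (w z t) (U (z l + R)) with hle | hle
    · have : φ (w z t) - φ (U (z l + R)) ≤ 0 := sub_nonpos.2 (hφm.monotone hle)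
      simp [max_eq_right this]
    · have hd : f (w z t) - f (U (z l + R)) ≤ -min κ1 κ2 * (w z t - U (z l + R)) := by
        have hw0 : 0 ≤ w z t - U (z l + R) := sub_nonneg.2 hle
        rcases le_total (z l) (-R1) with hz | hz
        · have h3 := (abs_lt.1 (hR1 z t hz)).2
          have h4 := h1 (U (z l + R)) (w z t) (by linarith [hU.gt_bot (z l + R)]) hle
            (by linarith)
          have := mul_le_mul_of_nonneg_right (min_le_left κ1 κ2) hw0
          linarith
        · have h3 : αp - δ2 < U (z l + R) := hR3 _ (by linarith)
          have h4 := h2 (U (z l + R)) (w z t) h3.le (hU.lt_top _).le hle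
            (abs_le.1 (hs.bdd z t)).2
          have := mul_le_mul_of_nonneg_right (min_le_right κ1 κ2) hw0
          linarith
      have := mul_le_mul_of_nonneg_left hd (sq_nonneg (max (φ (w z t) - φ (U (z l + R))) 0))
      linarith

lemma IsSol.wave_le (hs : IsSol φ f c M w) (hU : IsWave φ f αm αp U)
    (hMm : |αm| ≤ M) (hMp : |αp| ≤ M) (hfm : deriv f αm < 0) (hfp : deriv f αp < 0)
    (hm0 : f αm = 0) (hfbelow : ∀ s, s < αm → 0 < f s)
    (hlimp : ∀ δ > 0, ∃ R, ∀ z t, R ≤ z l → |w z t - αp| < δ) :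
    ∃ R0, ∀ R ≥ R0, ∀ z t, U (z l + -R) ≤ w z t := by
  have hf1 : ContDiff ℝ 1 f := hs.contDiff_f.of_le (by norm_num)
  have hφm : StrictMono φ := strictMono_of_deriv_pos fun s => hs.cpos.trans_le (hs.le_deriv s)
  obtain ⟨κ1, hκ1, δ1, hδ1, h1⟩ := exists_dissipative hf1 hfp
  have hdneg : deriv (fun s => -f (-s)) (-αm) = deriv f αm := by
    have h0 : HasDerivAt f (deriv f αm) (- -αm) := by
      rw [neg_neg]; exact (hf1.differentiable (by norm_num) αm).hasDerivAt
    have := (h0.comp (-αm) (hasDerivAt_neg (-αm))).neg.deriv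
    simpa [Function.comp_def] using this
  obtain ⟨κ2, hκ2, δ2, hδ2, h2⟩ := exists_dissipative_above (f := fun s => -f (-s)) (α := -αm)
    (hf1.comp contDiff_neg).neg (by rwa [hdneg]) (by simpa using hm0)
    (fun s hs => neg_lt_zero.2 (hfbelow _ (by linarith))) M
  obtain ⟨R1, hR1⟩ := hlimp δ1 hδ1
  obtain ⟨R3, hR3⟩ := eventually_atBot.1 (hU.lim_bot.eventually (Iio_mem_nhds
    (by linarith : αm < αm + δ2)))
  refine ⟨R1 - R3, fun R hR z t => ?_⟩
  obtain ⟨hv, hvM, hveq⟩ := IsWave.translate (l := l) hs hU hMm hMp (-R)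
  have key := hs.trap (h := fun y => -(max (-y) 0 ^ 2)) (h' := fun y => 2 * max (-y) 0)
    (H := fun y => max (-y) 0 ^ 3 / 3) hv hvM hveq
    (fun y => ((hasDerivAt_max_pow 0 (-y)).comp y (hasDerivAt_neg y)).neg.congr_deriv (by simp))
    (by fun_prop) (fun y => by positivity)
    (fun y => (((hasDerivAt_max_pow 1 (-y)).comp y (hasDerivAt_neg y)).div_const 3).congr_deriv
      (by norm_num; ring))
    (by simp) (by simp) (κ := min κ1 κ2) (lt_min hκ1 hκ2) (fun z t => ?_) z t
  · simp only at key
    by_contra! hlt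
    have : 0 < -(φ (w z t) - φ (U (z l + -R))) := by linarith [hφm hlt]
    rw [max_eq_left this.le] at key
    have := pow_pos this 3
    linarith
  · rcases le_total (U (z l + -R)) (w z t) with hle | hle
    · have : -(φ (w z t) - φ (U (z l + -R))) ≤ 0 := by linarith [hφm.monotone hle]
      simp only [max_eq_right this]
      simp
    · have hd : f (U (z l + -R)) - f (w z t) ≤ -min κ1 κ2 * (U (z l + -R) - w z t) := by
        have hw0 : 0 ≤ U (z l + -R) - w z t := sub_nonneg.2 hle
        rcases le_total R1 (z l) with hz | hz
        · have h3 := (abs_lt.1 (hR1 z t hz)).1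
          have h4 := h1 (w z t) (U (z l + -R)) (by linarith) hle
            (by linarith [hU.lt_top (z l + -R)])
          have := mul_le_mul_of_nonneg_right (min_le_left κ1 κ2) hw0
          linarith
        · have h3 : U (z l + -R) < αm + δ2 := hR3 _ (by linarith)
          have h4 := h2 (-U (z l + -R)) (-w z t) (by linarith)
            (by linarith [hU.gt_bot (z l + -R)]) (by linarith)
            (by linarith [(abs_le.1 (hs.bdd z t)).1])
          simp only [neg_neg] at h4
          have := mul_le_mul_of_nonneg_right (min_le_right κ1 κ2) hw0
          linarith
      have := mul_le_mul_of_nonneg_left hd (sq_nonneg (max (-(φ (w z t) - φ (U (z l + -R)))) 0))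
      linarith

end WaveTrapping

section WaveProfile

lemma le_mul_of_deriv2_le {p p' p'' : ℝ → ℝ} {κ : ℝ} (hκ : 0 < κ) (hp0 : ∀ x, 0 ≤ p x)
    (hp : ∀ x, HasDerivAt p (p' x) x) (hp' : ∀ x, HasDerivAt p' (p'' x) x)
    (h : ∀ x, p'' x ≤ κ ^ 2 * p x) (x : ℝ) : p' x ≤ κ * p x := by
  by_contra! hlt
  set q : ℝ → ℝ := fun y => p' y - κ * p y
  have hq (y : ℝ) : HasDerivAt (fun y => q y * exp (κ * y))
      ((p'' y - κ * p' y) * exp (κ * y) + q y * (exp (κ * y) * (κ * 1))) y :=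
    ((hp' y).sub ((hp y).const_mul κ)).mul (((hasDerivAt_id y).const_mul κ).exp)
  have hanti : Antitone fun y => q y * exp (κ * y) := by
    refine antitone_of_hasDerivAt_nonpos hq fun y => ?_
    have : (p'' y - κ * p' y) * exp (κ * y) + q y * (exp (κ * y) * (κ * 1)) =
      exp (κ * y) * (p'' y - κ ^ 2 * p y) := by simp only [q]; ring
    simp only [Pi.zero_apply]
    rw [this]
    exact mul_nonpos_of_nonneg_of_nonpos (exp_pos _).le (by linarith [h y])
  have hqx : 0 < q x := by simp only [q]; linarith
  have hlow (y : ℝ) (hy : y ≤ x) : q x ≤ p' y := by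
    have h1 := hanti hy
    simp only at h1
    have h2 : exp (κ * y) ≤ exp (κ * x) := exp_le_exp.2 (mul_le_mul_of_nonneg_left hy hκ.le)
    have h3 : q x * exp (κ * y) ≤ q y * exp (κ * y) :=
      (mul_le_mul_of_nonneg_left h2 hqx.le).trans h1
    have h4 := le_of_mul_le_mul_right h3 (exp_pos _)
    have := mul_nonneg hκ.le (hp0 y)
    simp only [q] at h4 ⊢
    linarith
  have hmono : MonotoneOn (fun y => p y - q x * y) (Iic x) := by
    refine monotoneOn_of_deriv_nonneg (convex_Iic x) ?_ ?_ ?_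
    · exact fun y _ => ((hp y).continuousAt.sub (by fun_prop)).continuousWithinAt
    · exact fun y _ => ((hp y).sub ((hasDerivAt_id y).const_mul
        (q x))).differentiableAt.differentiableWithinAt
    · intro y hy
      rw [interior_Iic] at hy
      have hd : HasDerivAt (fun y => p y - q x * y) (p' y - q x * 1) y :=
        (hp y).sub ((hasDerivAt_id y).const_mul (q x))
      rw [hd.deriv]
      linarith [hlow y (le_of_lt hy)]
  have h1 := hmono (show x - (p x / q x + 1) ∈ Iic x by
    simp only [mem_Iic]; linarith [div_nonneg (hp0 x) hqx.le]) (self_mem_Iic)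
    (by linarith [div_nonneg (hp0 x) hqx.le])
  simp only at h1
  have h2 := hp0 (x - (p x / q x + 1))
  have h3 : q x * (p x / q x) = p x := by field_simp
  nlinarith

lemma abs_le_mul_of_deriv2_le {p p' p'' : ℝ → ℝ} {κ : ℝ} (hκ : 0 < κ) (hp0 : ∀ x, 0 ≤ p x)
    (hp : ∀ x, HasDerivAt p (p' x) x) (hp' : ∀ x, HasDerivAt p' (p'' x) x)
    (h : ∀ x, p'' x ≤ κ ^ 2 * p x) (x : ℝ) : |p' x| ≤ κ * p x := by
  refine abs_le.2 ⟨?_, le_mul_of_deriv2_le hκ hp0 hp hp' h x⟩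
  have := le_mul_of_deriv2_le (p := fun x => p (-x)) (p' := fun x => -p' (-x))
    (p'' := fun x => p'' (-x)) hκ (fun x => hp0 _)
    (fun x => ((hp (-x)).comp x (hasDerivAt_neg x)).congr_deriv (by ring))
    (fun x => ((hp' (-x)).comp x (hasDerivAt_neg x)).neg.congr_deriv (by ring))
    (fun x => h _) (-x)
  simp only [neg_neg] at this
  linarith

lemma decay_of_deriv2_ge {P p p' p'' : ℝ → ℝ} {κ ν X C : ℝ} (hκ : 0 < κ) (hν : 0 < ν)
    (hP : ∀ x, HasDerivAt P (p x) x) (hPC : ∀ x, P x ≤ C)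
    (hp : ∀ x, HasDerivAt p (p' x) x) (hp' : ∀ x, HasDerivAt p' (p'' x) x)
    (hκp : ∀ x, |p' x| ≤ κ * p x) (h : ∀ x, X ≤ x → ν ^ 2 * p x ≤ p'' x) (x : ℝ) (hx : X ≤ x) :
    p' x ≤ -ν * p x := by
  by_contra! hlt
  set q : ℝ → ℝ := fun y => p' y + ν * p y
  have hq (y : ℝ) : HasDerivAt (fun y => q y * exp (-ν * y))
      ((p'' y + ν * p' y) * exp (-ν * y) + q y * (exp (-ν * y) * (-ν * 1))) y :=
    ((hp' y).add ((hp y).const_mul ν)).mul (((hasDerivAt_id y).const_mul (-ν)).exp)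
  have hmono : MonotoneOn (fun y => q y * exp (-ν * y)) (Ici X) := by
    refine monotoneOn_of_deriv_nonneg (convex_Ici X)
      (fun y _ => (hq y).continuousAt.continuousWithinAt)
      (fun y _ => (hq y).differentiableAt.differentiableWithinAt) fun y hy => ?_
    rw [interior_Ici] at hy
    rw [(hq y).deriv]
    have : (p'' y + ν * p' y) * exp (-ν * y) + q y * (exp (-ν * y) * (-ν * 1)) =
      exp (-ν * y) * (p'' y - ν ^ 2 * p y) := by simp only [q]; ring
    rw [this]
    exact mul_nonneg (exp_pos _).le (by linarith [h y (le_of_lt hy)])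
  have hqx : 0 < q x := by simp only [q]; linarith
  have hlow (y : ℝ) (hy : x ≤ y) : q x / (κ + ν) ≤ p y := by
    have h1 := hmono (show x ∈ Ici X from hx) (show y ∈ Ici X from hx.trans hy) hy
    simp only at h1
    have h2 : exp (-ν * y) ≤ exp (-ν * x) := exp_le_exp.2 (by nlinarith)
    have h3 : q x * exp (-ν * y) ≤ q y * exp (-ν * y) :=
      (mul_le_mul_of_nonneg_left h2 hqx.le).trans h1
    have h4 := le_of_mul_le_mul_right h3 (exp_pos _)
    rw [div_le_iff₀ (by positivity)]
    have := (abs_le.1 (hκp y)).2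
    simp only [q] at h4 ⊢
    linarith
  set d := q x / (κ + ν) with hd
  have hd0 : 0 < d := by positivity
  have hmono2 : MonotoneOn (fun y => P y - d * y) (Ici x) := by
    refine monotoneOn_of_deriv_nonneg (convex_Ici x) ?_ ?_ ?_
    · exact fun y _ => ((hP y).continuousAt.sub (by fun_prop)).continuousWithinAt
    · exact fun y _ => ((hP y).sub ((hasDerivAt_id y).const_mul
        d)).differentiableAt.differentiableWithinAt
    · intro y hy
      rw [interior_Ici] at hy
      have hd' : HasDerivAt (fun y => P y - d * y) (p y - d * 1) y :=
        (hP y).sub ((hasDerivAt_id y).const_mul d)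
      rw [hd'.deriv]
      linarith [hlow y (le_of_lt hy)]
  have hCx : 0 ≤ C - P x := sub_nonneg.2 (hPC x)
  have h1 := hmono2 (self_mem_Ici) (show x + ((C - P x) / d + 1) ∈ Ici x by
    simp only [mem_Ici]; linarith [div_nonneg hCx hd0.le])
    (by linarith [div_nonneg hCx hd0.le])
  simp only at h1
  have h2 := hPC (x + ((C - P x) / d + 1))
  have h3 : d * ((C - P x) / d) = C - P x := by field_simp
  nlinarith

/-- A positive weight with logarithmic derivative bounded by `2κ`, together with a comparable weight
`H` and a corrector `Γ` for the difference `ω - θ H`. -/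
structure IsWeight (ω ω' H Γ : ℝ → ℝ) (κ h0 h1 θ CΓ : ℝ) : Prop where
  pos : ∀ x, 0 < ω x
  deriv : ∀ x, HasDerivAt ω (ω' x) x
  cont' : Continuous ω'
  contH : Continuous H
  κ_pos : 0 < κ
  le : ∀ x, |ω' x| ≤ 2 * κ * ω x
  h0_pos : 0 < h0
  h0_le : ∀ x, h0 * ω x ≤ H x
  le_h1 : ∀ x, H x ≤ h1 * ω x
  integrable : Integrable ω
  θ_pos : 0 < θ
  CΓ_nonneg : 0 ≤ CΓ
  corr : ∀ x, HasDerivAt Γ (ω x - θ * H x) x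
  corr_le : ∀ x, |Γ x| ≤ CΓ * ω x

lemma exp_decay {ω ω' : ℝ → ℝ} {μ X : ℝ} (hω : ∀ x, HasDerivAt ω (ω' x) x)
    (h : ∀ x, X ≤ x → ω' x ≤ -μ * ω x) {x y : ℝ} (hx : X ≤ x) (hxy : x ≤ y) :
    ω y ≤ ω x * exp (-μ * (y - x)) := by
  have hd (s : ℝ) : HasDerivAt (fun s => ω s * exp (μ * s))
      (ω' s * exp (μ * s) + ω s * (exp (μ * s) * (μ * 1))) s :=
    (hω s).mul (((hasDerivAt_id s).const_mul μ).exp)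
  have hanti : AntitoneOn (fun s => ω s * exp (μ * s)) (Ici X) := by
    refine antitoneOn_of_deriv_nonpos (convex_Ici X)
      (fun y _ => (hd y).continuousAt.continuousWithinAt)
      (fun y _ => (hd y).differentiableAt.differentiableWithinAt) fun y hy => ?_
    rw [interior_Ici] at hy
    rw [(hd y).deriv]
    nlinarith [h y (le_of_lt hy), exp_pos (μ * y)]
  have h1 := hanti (show x ∈ Ici X from hx) (show y ∈ Ici X from hx.trans hxy) hxy
  simp only at h1
  rw [show -μ * (y - x) = μ * x - μ * y by ring, exp_sub, ← mul_div_assoc, le_div_iff₀ (exp_pos _)]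
  exact h1

lemma tail_le {ω ω' : ℝ → ℝ} {μ X : ℝ} (hμ : 0 < μ) (hpos : ∀ x, 0 < ω x)
    (hω : ∀ x, HasDerivAt ω (ω' x) x) (h : ∀ x, X ≤ x → ω' x ≤ -μ * ω x) {x : ℝ} (hx : X ≤ x) :
    IntegrableOn ω (Ioi x) ∧ ∫ y in Ioi x, ω y ≤ ω x / μ := by
  have hc : Continuous ω := continuous_iff_continuousAt.2 fun x => (hω x).continuousAt
  have he (y : ℝ) : ω x * exp (-μ * (y - x)) = ω x * exp (μ * x) * exp (-μ * y) := by
    rw [mul_assoc, ← exp_add]; ring_nf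
  have hi : IntegrableOn (fun y => ω x * exp (-μ * (y - x))) (Ioi x) := by
    simp_rw [he]
    exact (integrableOn_exp_mul_Ioi (by linarith) x).const_mul _
  have hio : IntegrableOn ω (Ioi x) := by
    refine hi.mono' hc.aestronglyMeasurable ?_
    refine (ae_restrict_iff' measurableSet_Ioi).2 (ae_of_all _ fun y hy => ?_)
    rw [Real.norm_of_nonneg (hpos y).le]
    exact exp_decay hω h hx (le_of_lt hy)
  refine ⟨hio, (setIntegral_mono_on hio hi measurableSet_Ioi fun y hy =>
    exp_decay hω h hx (le_of_lt hy)).trans (le_of_eq ?_)⟩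
  simp_rw [he]
  rw [integral_const_mul, integral_exp_mul_Ioi (by linarith)]
  have := exp_pos (μ * x)
  have e : exp (μ * x) * exp (-(μ * x)) = 1 := by rw [← exp_add]; simp
  field_simp
  rw [mul_assoc, e, mul_one]

/-- Exponentially decaying weights have a corrector. -/
lemma exists_isWeight {ω ω' H : ℝ → ℝ} {κ h0 h1 μ X : ℝ} (hμ : 0 < μ)
    (hpos : ∀ x, 0 < ω x) (hω : ∀ x, HasDerivAt ω (ω' x) x) (hω' : Continuous ω')
    (hH : Continuous H) (hκ : 0 < κ) (hle : ∀ x, |ω' x| ≤ 2 * κ * ω x) (hh0 : 0 < h0)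
    (hh0' : ∀ x, h0 * ω x ≤ H x) (hh1 : ∀ x, H x ≤ h1 * ω x)
    (htop : ∀ x, X ≤ x → ω' x ≤ -μ * ω x) (hbot : ∀ x, x ≤ -X → μ * ω x ≤ ω' x) :
    ∃ Γ θ CΓ, IsWeight ω ω' H Γ κ h0 h1 θ CΓ := by
  have hc : Continuous ω := continuous_iff_continuousAt.2 fun x => (hω x).continuousAt
  have hneg (x : ℝ) : HasDerivAt (fun x => ω (-x)) (-ω' (-x)) x :=
    ((hω (-x)).comp x (hasDerivAt_neg x)).congr_deriv (by ring)
  have tR {x : ℝ} (hx : X ≤ x) := tail_le hμ hpos hω htop hx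
  have tL {x : ℝ} (hx : x ≤ -X) : IntegrableOn ω (Iic x) ∧ ∫ y in Iic x, ω y ≤ ω x / μ := by
    have := tail_le hμ (fun x => hpos (-x)) hneg (X := X)
      (fun x hx => by linarith [hbot (-x) (by linarith)]) (x := -x) (by linarith)
    rw [neg_neg] at this
    refine ⟨?_, ?_⟩
    · have h2 := (integrableOn_Ici_iff_integrableOn_Ioi).2 this.1
      have h3 := h2.comp_neg
      simpa using h3
    · have h2 := integral_comp_neg_Ioi (-x) ω
      rw [neg_neg] at h2
      rw [← h2]
      exact this.2
  have h_int : Integrable ω := by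
    set Z := max X 0
    have i1 : IntegrableOn ω (Iic (-Z)) := (tL (by simp [Z])).1
    have i2 : IntegrableOn ω (Ioi Z) := (tR (by simp [Z])).1
    have i3 : IntegrableOn ω (Icc (-Z) Z) := hc.continuousOn.integrableOn_Icc
    rw [← integrableOn_univ]
    refine ((i1.union i3).union i2).mono_set fun x _ => ?_
    simp only [mem_union, mem_Iic, mem_Icc, mem_Ioi]
    by_cases h1 : x ≤ -Z
    · exact Or.inl (Or.inl h1)
    · by_cases h2 : x ≤ Z
      · exact Or.inl (Or.inr ⟨by linarith, h2⟩)
      · exact Or.inr (by linarith)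
  have hHpos (x) : 0 < H x := (mul_pos hh0 (hpos x)).trans_le (hh0' x)
  have hh1p : 0 < h1 := by
    by_contra! hcon
    exact absurd (hHpos 0)
      (not_lt.2 ((hh1 0).trans (mul_nonpos_of_nonpos_of_nonneg hcon (hpos 0).le)))
  have hHint : Integrable H := (h_int.const_mul h1).mono' hH.aestronglyMeasurable
    (ae_of_all _ fun x => by rw [Real.norm_of_nonneg (hHpos x).le]; exact hh1 x)
  have hIpos {g : ℝ → ℝ} (hg : Continuous g) (hgi : Integrable g) (hg0 : ∀ x, 0 < g x) :
      0 < ∫ x, g x := by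
    rw [integral_pos_iff_support_of_nonneg (fun x => (hg0 x).le) hgi,
      show Function.support g = univ from eq_univ_of_forall fun x => (hg0 x).ne']
    simp
  have hIω := hIpos hc h_int hpos
  have hIH := hIpos hH hHint hHpos
  set θ := (∫ x, ω x) / ∫ x, H x with hθ
  have hθ0 : 0 < θ := div_pos hIω hIH
  set r : ℝ → ℝ := fun x => ω x - θ * H x
  have hrc : Continuous r := by fun_prop
  have hri : Integrable r := h_int.sub (hHint.const_mul θ)
  have hr0 : ∫ x, r x = 0 := by
    rw [integral_sub h_int (hHint.const_mul θ), integral_const_mul, hθ]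
    field_simp
    ring
  have hrle (x) : |r x| ≤ (1 + θ * h1) * ω x := by
    have := mul_le_mul_of_nonneg_left (hh1 x) hθ0.le
    have := mul_pos hθ0 (hHpos x)
    have := hpos x
    have h3 : 0 < θ * h1 * ω x := by positivity
    rw [abs_le]
    constructor <;> simp only [r] <;> linarith
  let Γ : ℝ → ℝ := fun x => ∫ y in Iic x, r y
  have hΓ (x : ℝ) : HasDerivAt Γ (r x) x := by
    have e (y : ℝ) : Γ y = Γ 0 + ∫ s in (0 : ℝ)..y, r s := by
      rw [← intervalIntegral.integral_Iic_sub_Iic hri.integrableOn hri.integrableOn]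
      simp only [Γ]; ring
    rw [funext e]
    exact (intervalIntegral.integral_hasDerivAt_right (hrc.intervalIntegrable _ _)
      (hrc.stronglyMeasurableAtFilter _ _) hrc.continuousAt).const_add _
  have hΓc : Continuous Γ := continuous_iff_continuousAt.2 fun x => (hΓ x).continuousAt
  have hbL (x : ℝ) (hx : x ≤ -X) : |Γ x| ≤ (1 + θ * h1) / μ * ω x := by
    refine (norm_integral_le_integral_norm (μ := volume.restrict (Iic x)) r).trans ?_
    refine (setIntegral_mono_on hri.norm.integrableOn
      ((h_int.const_mul (1 + θ * h1)).integrableOn) measurableSet_Iic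
      fun y _ => hrle y).trans ?_
    rw [integral_const_mul]
    have := mul_le_mul_of_nonneg_left (tL hx).2 (by positivity : 0 ≤ 1 + θ * h1)
    refine this.trans (le_of_eq (by ring))
  have hbR (x : ℝ) (hx : X ≤ x) : |Γ x| ≤ (1 + θ * h1) / μ * ω x := by
    have e : Γ x = -∫ y in Ioi x, r y := by
      have := intervalIntegral.integral_Iic_add_Ioi (b := x) hri.integrableOn hri.integrableOn
      rw [hr0] at this
      simp only [Γ]; linarith
    rw [e, abs_neg]
    refine (norm_integral_le_integral_norm (μ := volume.restrict (Ioi x)) r).trans ?_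
    refine (setIntegral_mono_on hri.norm.integrableOn
      ((h_int.const_mul (1 + θ * h1)).integrableOn) measurableSet_Ioi
      fun y _ => hrle y).trans ?_
    rw [integral_const_mul]
    have := mul_le_mul_of_nonneg_left (tR hx).2 (by positivity : 0 ≤ 1 + θ * h1)
    refine this.trans (le_of_eq (by ring))
  obtain ⟨C, hC⟩ := (isCompact_Icc (a := -X) (b := X)).exists_bound_of_continuousOn
    (f := fun x => Γ x / ω x) ((hΓc.div hc fun x => (hpos x).ne').continuousOn)
  refine ⟨Γ, θ, max ((1 + θ * h1) / μ) C, hpos, hω, hω', hH, hκ, hle, hh0, hh0', hh1, h_int, hθ0,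
    le_trans (by positivity) (le_max_left _ _), hΓ, fun x => ?_⟩
  by_cases h1 : x ≤ -X
  · exact (hbL x h1).trans (mul_le_mul_of_nonneg_right (le_max_left _ _) (hpos x).le)
  by_cases h2 : X ≤ x
  · exact (hbR x h2).trans (mul_le_mul_of_nonneg_right (le_max_left _ _) (hpos x).le)
  · have := hC x ⟨by linarith, by linarith⟩
    rw [norm_div, Real.norm_eq_abs, Real.norm_of_nonneg (hpos x).le, div_le_iff₀ (hpos x)] at this
    exact this.trans (mul_le_mul_of_nonneg_right (le_max_right _ _) (hpos x).le)

end WaveProfile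

section WavePhase

variable {φ f : ℝ → ℝ} {c αm αp : ℝ} {U : ℝ → ℝ}

lemma exists_le_sq {F : ℝ → ℝ} (hF : Continuous F) (a b : ℝ) :
    ∃ κ > 0, ∀ x ∈ Icc a b, F x ≤ κ ^ 2 := by
  obtain ⟨C, hC⟩ := (isCompact_Icc (a := a) (b := b)).exists_bound_of_continuousOn hF.continuousOn
  refine ⟨|C| + 1, by positivity, fun x hx => ?_⟩
  have := (le_abs_self (F x)).trans (hC x hx)
  nlinarith [le_abs_self C, abs_nonneg C]

lemma pos_of_abs_deriv_le {P p p' : ℝ → ℝ} {κ : ℝ} (hP : StrictMono P)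
    (hPd : ∀ x, HasDerivAt P (p x) x) (hp : ∀ x, HasDerivAt p (p' x) x) (hp0 : ∀ x, 0 ≤ p x)
    (hκp : ∀ x, |p' x| ≤ κ * p x) (x : ℝ) : 0 < p x := by
  by_contra! hcon
  have hd (s : ℝ) : HasDerivAt (fun s => p s * exp (-κ * s))
      (p' s * exp (-κ * s) + p s * (exp (-κ * s) * (-κ * 1))) s :=
    (hp s).mul (((hasDerivAt_id s).const_mul (-κ)).exp)
  have hanti : Antitone fun s => p s * exp (-κ * s) := by
    refine antitone_of_hasDerivAt_nonpos hd fun y => ?_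
    have := (abs_le.1 (hκp y)).2
    simp only [Pi.zero_apply]
    nlinarith [exp_pos (-κ * y)]
  have hz (y : ℝ) (hy : x ≤ y) : p y = 0 := by
    have h1 := hanti hy
    simp only at h1
    have h2 : p y * exp (-κ * y) ≤ 0 :=
      h1.trans (mul_nonpos_of_nonpos_of_nonneg hcon (exp_pos _).le)
    have := hp0 y
    by_contra hne
    have := mul_pos (lt_of_le_of_ne this (Ne.symm hne)) (exp_pos (-κ * y))
    linarith
  have hle : P (x + 1) ≤ P x := by
    refine (antitoneOn_of_deriv_nonpos (convex_Icc x (x + 1))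
      (fun y _ => (hPd y).continuousAt.continuousWithinAt)
      (fun y _ => (hPd y).differentiableAt.differentiableWithinAt) fun y hy => ?_)
      (left_mem_Icc.2 (by linarith)) (right_mem_Icc.2 (by linarith)) (by linarith)
    rw [(hPd y).deriv, hz y (interior_subset hy).1]
  exact absurd (hP (by linarith : x < x + 1)) (not_lt.2 hle)

/-- The momentum of a standing wave. -/
noncomputable def IsWave.mom (φ U : ℝ → ℝ) (x : ℝ) : ℝ := deriv φ (U x) * deriv U x

lemma IsWave.hasDerivAt (hU : IsWave φ f αm αp U) (x : ℝ) : HasDerivAt U (deriv U x) x :=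
  (hU.C2.differentiable (by norm_num) x).hasDerivAt

lemma IsWave.hasDerivAt_flux (hφ : ContDiff ℝ 4 φ) (hU : IsWave φ f αm αp U) (x : ℝ) :
    HasDerivAt (fun x => φ (U x)) (mom φ U x) x :=
  ((hφ.differentiable (by norm_num) (U x)).hasDerivAt).comp x (hU.hasDerivAt x)

lemma IsWave.hasDerivAt_mom (hφ : ContDiff ℝ 4 φ) (hU : IsWave φ f αm αp U) (x : ℝ) :
    HasDerivAt (mom φ U) (-f (U x)) x := by
  have hφd : ContDiff ℝ 1 (_root_.deriv φ) :=
    ((contDiff_succ_iff_deriv (n := 1)).1 (hφ.of_le (by norm_num))).2.2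
  have hUd : ContDiff ℝ 1 (_root_.deriv U) :=
    ((contDiff_succ_iff_deriv (n := 1)).1 (hU.C2.of_le (by norm_num))).2.2
  have hd : Differentiable ℝ (mom φ U) :=
    ((hφd.comp (hU.C2.of_le (by norm_num))).mul hUd).differentiable one_ne_zero
  have h := hU.ode x
  rw [show (_root_.deriv fun y => φ (U y)) = mom φ U from
    funext fun y => (hU.hasDerivAt_flux hφ y).deriv] at h
  exact (hd x).hasDerivAt.congr_deriv (by linarith)

/-- The squared momentum of a standing wave is a weight. -/
theorem IsWave.exists_isWeight (hc : 0 < c) (hφ : ContDiff ℝ 4 φ) (hφ' : ∀ s, c ≤ deriv φ s)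
    (hf : ContDiff ℝ 2 f) (hfm : deriv f αm < 0) (hfp : deriv f αp < 0)
    (hU : IsWave φ f αm αp U) :
    (∀ x, 0 < deriv U x) ∧ ∃ Γ κ h0 h1 θ CΓ,
      IsWeight (fun x => mom φ U x ^ 2) (fun x => -2 * mom φ U x * f (U x))
        (fun x => mom φ U x * deriv U x) Γ κ h0 h1 θ CΓ := by
  have hφd : Continuous (_root_.deriv φ) := hφ.continuous_deriv (by norm_num)
  have hfd : Continuous (_root_.deriv f) := hf.continuous_deriv (by norm_num)
  have hUd : Continuous (_root_.deriv U) := hU.C2.continuous_deriv (by norm_num)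
  have hφm : StrictMono φ := strictMono_of_deriv_pos fun s => hc.trans_le (hφ' s)
  have hφp (s : ℝ) : 0 < _root_.deriv φ s := hc.trans_le (hφ' s)
  have hmem (x : ℝ) : U x ∈ Icc αm αp := ⟨(hU.gt_bot x).le, (hU.lt_top x).le⟩
  have hP := hU.hasDerivAt_flux hφ
  have hp := hU.hasDerivAt_mom hφ
  have hU0 (x : ℝ) : 0 ≤ _root_.deriv U x := hU.mono.monotone.deriv_nonneg
  have hp0 (x : ℝ) : 0 ≤ mom φ U x := mul_nonneg (hφp _).le (hU0 x)
  set p2 : ℝ → ℝ := fun x => -(_root_.deriv f (U x) * _root_.deriv U x)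
  have hp' (x : ℝ) : HasDerivAt (fun x => -f (U x)) (p2 x) x :=
    (((hf.differentiable (by norm_num) (U x)).hasDerivAt).comp x (hU.hasDerivAt x)).neg
  have hdU (x : ℝ) : _root_.deriv U x = mom φ U x / _root_.deriv φ (U x) := by
    rw [mom, mul_div_cancel_left₀ _ (hφp _).ne']
  have hp2 (x : ℝ) : p2 x = -_root_.deriv f (U x) / _root_.deriv φ (U x) * mom φ U x := by
    simp only [p2]; rw [hdU]; ring
  obtain ⟨κ, hκ, hκ2⟩ := exists_le_sq (F := fun s => -_root_.deriv f s / _root_.deriv φ s)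
    (hfd.neg.div hφd fun s => (hφp s).ne') αm αp
  have hκp := abs_le_mul_of_deriv2_le hκ hp0 hp hp' fun x => by
    rw [hp2]; exact mul_le_mul_of_nonneg_right (hκ2 _ (hmem x)) (hp0 x)
  have hpos := pos_of_abs_deriv_le (hφm.comp hU.mono) hP hp hp0 hκp
  obtain ⟨Λ, hΛ, hΛ2⟩ := exists_le_sq (F := _root_.deriv φ) hφd αm αp
  have near {α : ℝ} (hα : _root_.deriv f α < 0) : ∃ ν > 0, ∀ᶠ s in nhds α, ∀ x, s = U x →
      ν ^ 2 * mom φ U x ≤ p2 x := by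
    have hcont : ContinuousAt (fun s => -_root_.deriv f s / _root_.deriv φ s) α :=
      (hfd.neg.div hφd fun s => (hφp s).ne').continuousAt
    have hv : 0 < -_root_.deriv f α / _root_.deriv φ α := div_pos (by linarith) (hφp _)
    refine ⟨sqrt (-_root_.deriv f α / _root_.deriv φ α / 2), sqrt_pos.2 (by linarith), ?_⟩
    filter_upwards [hcont.eventually (Ioi_mem_nhds (half_lt_self hv))] with s hs x hx
    rw [hp2, sq_sqrt (by linarith)]
    subst hx
    exact mul_le_mul_of_nonneg_right (le_of_lt hs) (hp0 x)
  obtain ⟨ν1, hν1, h1⟩ := near hfp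
  obtain ⟨ν2, hν2, h2⟩ := near hfm
  obtain ⟨X1, hX1⟩ := eventually_atTop.1 (hU.lim_top.eventually h1)
  obtain ⟨X2, hX2⟩ := eventually_atBot.1 (hU.lim_bot.eventually h2)
  have d1 := decay_of_deriv2_ge (P := fun x => φ (U x)) (C := φ αp) hκ hν1 hP
    (fun x => hφm.monotone (hU.lt_top x).le) hp hp' hκp (X := X1) fun x hx => hX1 x hx x rfl
  have d2 := decay_of_deriv2_ge (P := fun x => -φ (U (-x))) (p := fun x => mom φ U (-x))
    (p' := fun x => f (U (-x))) (p'' := fun x => p2 (-x)) (X := -X2) (C := -φ αm) hκ hν2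
    (fun x => ((hP (-x)).comp x (hasDerivAt_neg x)).neg.congr_deriv (by simp))
    (fun x => neg_le_neg (hφm.monotone (hU.gt_bot _).le))
    (fun x => ((hp (-x)).comp x (hasDerivAt_neg x)).congr_deriv (by ring))
    (fun x => by
      have := ((hp' (-x)).comp x (hasDerivAt_neg x)).neg
      simp only [Function.comp_def, Pi.neg_def, mul_neg_one, neg_neg] at this
      exact this)
    (fun x => by simpa using hκp (-x)) fun x hx => hX2 (-x) (by linarith) (-x) rfl
  have hdpos (x : ℝ) : 0 < _root_.deriv U x := by rw [hdU]; exact div_pos (hpos x) (hφp _)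
  refine ⟨hdpos, ?_⟩
  have hmc : Continuous (mom φ U) := continuous_iff_continuousAt.2 fun x => (hp x).continuousAt
  obtain ⟨Γ, θ, CΓ, h⟩ := _root_.exists_isWeight (ω := fun x => mom φ U x ^ 2)
    (ω' := fun x => -2 * mom φ U x * f (U x))
    (H := fun x => mom φ U x * _root_.deriv U x) (κ := κ) (h0 := 1 / Λ ^ 2) (h1 := 1 / c)
    (μ := 2 * min ν1 ν2) (X := max X1 (-X2)) (by positivity) (fun x => pow_pos (hpos x) 2)
    (fun x => ((hp x).pow 2).congr_deriv (by simp))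
    ((continuous_const.mul hmc).mul (hf.continuous.comp hU.C2.continuous)) (hmc.mul hUd) hκ
    (fun x => by
      have h1 := hκp x
      rw [abs_neg] at h1
      rw [abs_mul, abs_mul, abs_of_nonneg (hp0 x)]
      norm_num
      nlinarith [hp0 x])
    (by positivity)
    (fun x => by
      rw [hdU x]
      have := hΛ2 _ (hmem x)
      have h3 : 1 / Λ ^ 2 ≤ 1 / _root_.deriv φ (U x) := one_div_le_one_div_of_le (hφp _) this
      calc _ ≤ 1 / _root_.deriv φ (U x) * mom φ U x ^ 2 :=
            mul_le_mul_of_nonneg_right h3 (sq_nonneg _)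
        _ = _ := by ring)
    (fun x => by
      rw [hdU x]
      have h3 : 1 / _root_.deriv φ (U x) ≤ 1 / c := one_div_le_one_div_of_le hc (hφ' _)
      calc _ = 1 / _root_.deriv φ (U x) * mom φ U x ^ 2 := by ring
        _ ≤ _ := mul_le_mul_of_nonneg_right h3 (sq_nonneg _))
    (fun x hx => by
      have h1 := d1 x ((le_max_left _ _).trans hx)
      have h4 := mul_le_mul_of_nonneg_right (min_le_left ν1 ν2) (hp0 x)
      nlinarith [hp0 x])
    (fun x hx => by
      have h1 := d2 (-x) (by linarith [(le_max_right X1 (-X2))])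
      simp only [neg_neg] at h1
      have h4 := mul_le_mul_of_nonneg_right (min_le_right ν1 ν2) (hp0 x)
      nlinarith [hp0 x])
  exact ⟨Γ, κ, _, _, θ, CΓ, h⟩

lemma IsWave.contDiffAt_invFun (hU : IsWave φ f αm αp U) {x : ℝ} (hx : 0 < deriv U x) :
    ContDiffAt ℝ 2 (Function.invFun U) (U x) := by
  have h0 : ContDiffAt ℝ 2 U x := hU.C2.contDiffAt
  have hf' : HasFDerivAt U ((ContinuousLinearEquiv.unitsEquivAut ℝ (Units.mk0 _ hx.ne') :
      ℝ ≃L[ℝ] ℝ) : ℝ →L[ℝ] ℝ) x := by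
    have := (hU.hasDerivAt x).hasFDerivAt
    refine this.congr_fderiv ?_
    apply ContinuousLinearMap.ext_ring
    simp [ContinuousLinearEquiv.unitsEquivAut_apply]
  have h1 := h0.to_localInverse hf' two_ne_zero
  refine h1.congr_of_eventuallyEq ?_
  filter_upwards [(h0.hasStrictFDerivAt' hf' two_ne_zero).eventually_right_inverse] with y hy
  have := Function.leftInverse_invFun hU.mono.injective
  conv_lhs => rw [← hy]
  exact this _

end WavePhase

section Phase

variable {N : ℕ} {φ f : ℝ → ℝ} {c M αm αp : ℝ} {w : EuclideanSpace ℝ (Fin N) → ℝ → ℝ} {U : ℝ → ℝ}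
  {l : Fin N}

/-- A bounded solution of the phase equation of a front. -/
structure IsPhase (ω ω' H : ℝ → ℝ) (R : ℝ) (l : Fin N)
    (ξ : EuclideanSpace ℝ (Fin N) → ℝ → ℝ) : Prop where
  bdd : ∀ z t, |ξ z t| ≤ R
  space : ∀ t, ContDiff ℝ 2 fun z => ξ z t
  time : ∀ z, ContDiff ℝ 1 (ξ z)
  eq : ∀ z t, H (z l - ξ z t) * deriv (ξ z) t = ω (z l - ξ z t) * lap (fun y => ξ y t) z +
    ω' (z l - ξ z t) * (pd l (fun y => ξ y t) z - 1 / 2 * ∑ i, pd i (fun y => ξ y t) z ^ 2)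
  balanced : ∀ r a b, a ≤ b → BalancedOn ξ r a b

lemma IsAdm.transfer {ξ : EuclideanSpace ℝ (Fin N) → ℝ → ℝ} {r a b C L : ℝ}
    {B β : EuclideanSpace ℝ (Fin N) → ℝ → ℝ} (hab : a ≤ b) (h : IsAdm ξ r a b B β C) (hL : 0 ≤ L)
    (hlip : ∀ z, ‖z‖ ≤ r → ∀ s t, |ξ z t - ξ z s| ≤ L * |w z t - w z s|)
    (hd : ∀ z, ‖z‖ ≤ r → ∀ t, |_root_.deriv (ξ z) t| ≤ L * |_root_.deriv (w z) t|) :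
    IsAdm w r a b B β (C * (1 + L)) := by
  have hC : 0 ≤ C := (abs_nonneg _).trans (h.bdd 0 a (left_mem_Icc.2 hab))
  have hC1 : C ≤ C * (1 + L) := by nlinarith
  refine ⟨h.cont, h.cont', h.deriv, h.contTime, h.supp, h.supp',
    fun z t ht => (h.bdd z t ht).trans hC1, fun z s hs t ht => ?_, fun z t ht => ?_,
    fun t ht => (h.upper t ht).trans hC1⟩
  · by_cases hz : ‖z‖ ≤ r
    · refine (h.lip z s hs t ht).trans ?_
      have h1 := mul_le_mul_of_nonneg_left (hlip z hz s t) hC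
      have h2 : 0 ≤ C * |w z t - w z s| := mul_nonneg hC (abs_nonneg _)
      have h3 : 0 ≤ C * L * |t - s| := by positivity
      nlinarith
    · rw [h.supp z (not_le.1 hz) t ht, h.supp z (not_le.1 hz) s hs]
      simp only [sub_self, abs_zero]
      positivity
  · by_cases hz : ‖z‖ ≤ r
    · refine (h.dbdd z t ht).trans ?_
      have h1 := mul_le_mul_of_nonneg_left (hd z hz t) hC
      have h2 : 0 ≤ C * |_root_.deriv (w z) t| := mul_nonneg hC (abs_nonneg _)
      have h3 : 0 ≤ C * L := by positivity
      nlinarith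
    · rw [h.supp' z (not_le.1 hz) t ht]
      simp only [abs_zero]
      positivity

lemma abs_coord_le (z : EuclideanSpace ℝ (Fin N)) (i : Fin N) : |z i| ≤ ‖z‖ :=
  PiLp.norm_apply_le z i

theorem IsSol.exists_phase (hs : IsSol φ f c M w) (hU : IsWave φ f αm αp U)
    (hpos : ∀ x, 0 < deriv U x) {R : ℝ}
    (hlow : ∀ z t, U (z l + -R) ≤ w z t) (hup : ∀ z t, w z t ≤ U (z l + R)) :
    ∃ ξ, IsPhase (fun x => IsWave.mom φ U x ^ 2) (fun x => -2 * IsWave.mom φ U x * f (U x))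
      (fun x => IsWave.mom φ U x * deriv U x) R l ξ ∧ ∀ z t, w z t = U (z l - ξ z t) := by
  have hUc := hU.C2.continuous
  have hφ := hs.contDiff_phi
  set Y : EuclideanSpace ℝ (Fin N) → ℝ → ℝ := fun z t => Function.invFun U (w z t) with hYdef
  have hUY (z t) : U (Y z t) = w z t := by
    obtain ⟨x, hx⟩ := mem_range_of_exists_le_of_exists_ge hUc ⟨_, hlow z t⟩ ⟨_, hup z t⟩
    exact Function.invFun_eq ⟨x, hx⟩
  have hYm (z t) : Y z t ∈ Icc (z l - R) (z l + R) := by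
    constructor
    · exact hU.mono.le_iff_le.1 (by rw [hUY, sub_eq_add_neg]; exact hlow z t)
    · exact hU.mono.le_iff_le.1 (by rw [hUY]; exact hup z t)
  have hR : 0 ≤ R := by have := hYm 0 0; linarith [this.1.trans this.2]
  have hYs (t) : ContDiff ℝ 2 fun z => Y z t := contDiff_iff_contDiffAt.2 fun z => by
    have := hU.contDiffAt_invFun (hpos (Y z t))
    rw [hUY] at this
    exact this.comp z (hs.space t).contDiffAt
  have hYt (z) : ContDiff ℝ 1 (Y z) := contDiff_iff_contDiffAt.2 fun t => by
    have := hU.contDiffAt_invFun (hpos (Y z t))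
    rw [hUY] at this
    exact (this.of_le (by norm_num)).comp t (hs.time z).contDiffAt
  have hwt (z t) : deriv (w z) t = deriv U (Y z t) * deriv (Y z) t := by
    have h1 : HasDerivAt (fun t => U (Y z t)) (deriv U (Y z t) * deriv (Y z) t) t :=
      (hU.hasDerivAt (Y z t)).comp t ((hYt z).differentiable one_ne_zero t).hasDerivAt
    rw [funext (hUY z)] at h1
    exact h1.deriv
  have hpdY (t) (z) (i) : pd i (fun y => φ (w y t)) z =
      IsWave.mom φ U (Y z t) * pd i (fun y => Y y t) z := by
    rw [← pd_comp (hU.hasDerivAt_flux hφ (Y z t)) ((hYs t).differentiable (by norm_num) z)]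
    simp only [hUY]
  have hlap (t) (z) : lap (fun y => φ (w y t)) z = ∑ i, (-f (U (Y z t)) *
      pd i (fun y => Y y t) z ^ 2 + IsWave.mom φ U (Y z t) *
        pd i (pd i (fun y => Y y t)) z) := by
    rw [lap_eq_sum_pd (hs.contDiff_comp t)]
    refine Finset.sum_congr rfl fun i _ => ?_
    rw [show pd i (fun y => φ (w y t)) = fun z =>
      IsWave.mom φ U (Y z t) * pd i (fun y => Y y t) z from funext fun z => hpdY t z i]
    have h1 : HasPd i (fun z => IsWave.mom φ U (Y z t)) _ z :=
      HasPd.comp (hU.hasDerivAt_mom hφ (Y z t)) ((hYs t).hasPd (by norm_num) i z)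
    have h2 : HasPd i (fun z => IsWave.mom φ U (Y z t) * pd i (fun y => Y y t) z) _ z :=
      h1.mul ((contDiff_pd_one (hYs t) i).hasPd one_ne_zero i z)
    rw [h2.2]
    ring
  have hξs (t) : ContDiff ℝ 2 fun z : EuclideanSpace ℝ (Fin N) => z l - Y z t :=
    (contDiff_coord l).sub (hYs t)
  have hξp (t z i) : pd i (fun z : EuclideanSpace ℝ (Fin N) => z l - Y z t) z =
      (if i = l then 1 else 0) - pd i (fun y => Y y t) z := by
    rw [pd_sub ((contDiff_coord (n := 1) l).differentiable one_ne_zero z)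
      ((hYs t).differentiable (by norm_num) z), pd_coord]
  have hloc (r : ℝ) : ∃ L ≥ 0, (∀ z : EuclideanSpace ℝ (Fin N), ‖z‖ ≤ r → ∀ s t,
      |(z l - Y z t) - (z l - Y z s)| ≤ L * |w z t - w z s|) ∧
      ∀ z : EuclideanSpace ℝ (Fin N), ‖z‖ ≤ r → ∀ t,
        |deriv (fun t => z l - Y z t) t| ≤ L * |deriv (w z) t| := by
    by_cases hr : 0 ≤ r
    swap
    · exact ⟨0, le_rfl, fun z hz => absurd ((norm_nonneg z).trans hz) hr,
        fun z hz => absurd ((norm_nonneg z).trans hz) hr⟩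
    obtain ⟨x0, -, hx0⟩ := (isCompact_Icc (a := -(r + R)) (b := r + R)).exists_isMinOn
      (nonempty_Icc.2 (by linarith)) (hU.C2.continuous_deriv (by norm_num)).continuousOn
    set m := deriv U x0 with hm
    have hm0 : 0 < m := hpos x0
    have hmem (z : EuclideanSpace ℝ (Fin N)) (hz : ‖z‖ ≤ r) (t) :
        Y z t ∈ Icc (-(r + R)) (r + R) := by
      have h1 := abs_le.1 ((abs_coord_le z l).trans hz)
      have h2 := hYm z t
      exact ⟨by linarith [h2.1], by linarith [h2.2]⟩
    have hmv (x y) (hx : x ∈ Icc (-(r + R)) (r + R)) (hy : y ∈ Icc (-(r + R)) (r + R))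
        (hxy : x ≤ y) : m * (y - x) ≤ U y - U x :=
      (convex_Icc _ _).mul_sub_le_image_sub_of_le_deriv hUc.continuousOn
        (hU.C2.differentiable (by norm_num)).differentiableOn
        (fun u hu => hx0 (interior_subset hu)) x hx y hy hxy
    refine ⟨1 / m, by positivity, fun z hz s t => ?_, fun z hz t => ?_⟩
    · rw [div_mul_eq_mul_div, one_mul, le_div_iff₀ hm0, ← hUY z t, ← hUY z s,
        show z l - Y z t - (z l - Y z s) = Y z s - Y z t by ring]
      rcases le_total (Y z s) (Y z t) with h | h
      · rw [abs_of_nonpos (by linarith), abs_of_nonneg (by linarith [hU.mono.monotone h])]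
        linarith [hmv _ _ (hmem z hz s) (hmem z hz t) h]
      · rw [abs_of_nonneg (by linarith), abs_of_nonpos (by linarith [hU.mono.monotone h])]
        linarith [hmv _ _ (hmem z hz t) (hmem z hz s) h]
    · rw [deriv_const_sub, abs_neg, hwt, abs_mul, abs_of_pos (hpos _), ← mul_assoc]
      have h1 : 1 ≤ 1 / m * deriv U (Y z t) := by
        rw [div_mul_eq_mul_div, one_mul, le_div_iff₀ hm0, one_mul]
        exact hx0 (hmem z hz t)
      nlinarith [abs_nonneg (deriv (Y z) t)]
  refine ⟨fun z t => z l - Y z t, ⟨fun z t => ?_, hξs, fun z => contDiff_const.sub (hYt z),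
    fun z t => ?_, fun r a b hab => ?_⟩, fun z t => ?_⟩
  · have := hYm z t
    exact abs_le.2 ⟨by linarith [this.2], by linarith [this.1]⟩
  · have h1 := hs.eq z t
    rw [hlap, hwt] at h1
    rw [lap_eq_sum_pd (hξs t), deriv_const_sub, sub_sub_cancel]
    have e (i) : pd i (fun z : EuclideanSpace ℝ (Fin N) => z l - Y z t) = fun z =>
        (if i = l then 1 else 0) - pd i (fun y => Y y t) z := funext fun z => hξp t z i
    have e2 (i) : pd i (pd i (fun z : EuclideanSpace ℝ (Fin N) => z l - Y z t)) z =
        -pd i (pd i (fun y => Y y t)) z := by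
      rw [e, pd_sub (differentiableAt_const _)
        ((contDiff_pd_one (hYs t) i).differentiable one_ne_zero z), pd_const, zero_sub]
    simp only [e2, hξp, if_true]
    have e3 : ∑ i, ((if i = l then (1 : ℝ) else 0) - pd i (fun y => Y y t) z) ^ 2 =
        1 - 2 * pd l (fun y => Y y t) z + ∑ i, pd i (fun y => Y y t) z ^ 2 := by
      simp only [sub_sq, Finset.sum_add_distrib, Finset.sum_sub_distrib]
      congr 2
      · simp
      · simp
    rw [e3, Finset.sum_neg_distrib]
    rw [Finset.sum_add_distrib, ← Finset.mul_sum, ← Finset.mul_sum] at h1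
    rw [← hUY] at h1
    linear_combination -(IsWave.mom φ U (Y z t)) * h1
  · intro r' hr' B β C h
    obtain ⟨L, hL, h1, h2⟩ := hloc r'
    exact hs.balancedOn r hab r' hr' B β _ (h.transfer hab hL h1 h2)
  · simp only [sub_sub_cancel, hUY]

end Phase

section HeatKernel

variable {N : ℕ} {l : Fin N}

/-- Squared tangential distance. -/
def tsq (l : Fin N) (p z : EuclideanSpace ℝ (Fin N)) : ℝ :=
  ∑ i ∈ Finset.univ.erase l, (z i - p i) ^ 2

/-- Number of tangential directions. -/
def tdim (l : Fin N) : ℝ := ((Finset.univ.erase l).card : ℝ)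

/-- The heat kernel in the tangential variables (up to normalization). -/
noncomputable def hk (l : Fin N) (p : EuclideanSpace ℝ (Fin N)) (s : ℝ)
    (z : EuclideanSpace ℝ (Fin N)) : ℝ :=
  exp (-tsq l p z / (4 * s) - tdim l / 2 * log s)

/-- The logarithmic time derivative of the tangential heat kernel. -/
noncomputable def dk (l : Fin N) (p : EuclideanSpace ℝ (Fin N)) (s : ℝ)
    (z : EuclideanSpace ℝ (Fin N)) : ℝ :=
  tsq l p z / (4 * s ^ 2) - tdim l / (2 * s)

/-- Total mass of the tangential heat kernel. -/
noncomputable def tmass (l : Fin N) : ℝ := sqrt (4 * π) ^ (Finset.univ.erase l).card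

lemma tsq_nonneg (p z : EuclideanSpace ℝ (Fin N)) : 0 ≤ tsq l p z :=
  Finset.sum_nonneg fun _ _ => sq_nonneg _

lemma tdim_nonneg : 0 ≤ tdim l := Nat.cast_nonneg _

lemma tmass_pos : 0 < tmass l := pow_pos (sqrt_pos.2 (by positivity)) _

lemma sq_le_tsq (p z : EuclideanSpace ℝ (Fin N)) {i : Fin N} (hi : i ≠ l) :
    (z i - p i) ^ 2 ≤ tsq l p z :=
  Finset.single_le_sum (f := fun i => (z i - p i) ^ 2) (fun _ _ => sq_nonneg _) (by simpa using hi)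

lemma hk_pos (p : EuclideanSpace ℝ (Fin N)) (s : ℝ) (z) : 0 < hk l p s z := exp_pos _

lemma contDiff_tsq {n : WithTop ℕ∞} (p : EuclideanSpace ℝ (Fin N)) : ContDiff ℝ n (tsq l p) :=
  ContDiff.sum fun i _ => ((contDiff_coord i).sub contDiff_const).pow 2

lemma contDiff_hk {n : WithTop ℕ∞} (p : EuclideanSpace ℝ (Fin N)) (s : ℝ) :
    ContDiff ℝ n (hk l p s) :=
  (((contDiff_tsq p).neg.div_const _).sub contDiff_const).exp

lemma contDiff_dk {n : WithTop ℕ∞} (p : EuclideanSpace ℝ (Fin N)) (s : ℝ) :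
    ContDiff ℝ n (dk l p s) :=
  ((contDiff_tsq p).div_const _).sub contDiff_const

lemma hasDerivAt_hk (p z : EuclideanSpace ℝ (Fin N)) {s : ℝ} (hs : 0 < s) :
    HasDerivAt (fun s => hk l p s z) (dk l p s z * hk l p s z) s := by
  have h1 : HasDerivAt (fun s : ℝ => -tsq l p z / (4 * s) - tdim l / 2 * log s)
      ((0 * (4 * s) - -tsq l p z * (4 * 1)) / (4 * s) ^ 2 - tdim l / 2 * s⁻¹) s :=
    ((hasDerivAt_const s (-tsq l p z)).div ((hasDerivAt_id s).const_mul 4) (by positivity)).sub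
      ((hasDerivAt_log hs.ne').const_mul _)
  refine h1.exp.congr_deriv ?_
  rw [hk, dk, mul_comm]
  congr 1
  field_simp
  ring

lemma hasPd_tsq (p z : EuclideanSpace ℝ (Fin N)) (i : Fin N) :
    HasPd i (tsq l p) (if i = l then 0 else 2 * (z i - p i)) z := by
  have h0 := (contDiff_tsq (l := l) (n := 1) p).hasPd one_ne_zero i z
  refine h0.congr ?_
  unfold pd tsq
  rw [fderiv_fun_sum fun j _ => by
    exact (((contDiff_coord (n := 1) j).sub contDiff_const).pow 2).differentiable one_ne_zero z]
  rw [sum_apply]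
  have e (j : Fin N) : fderiv ℝ (fun y : EuclideanSpace ℝ (Fin N) => (y j - p j) ^ 2) z
      (EuclideanSpace.single i 1) = 2 * (z j - p j) * (if i = j then 1 else 0) := by
    have h1 : HasPd i (fun y : EuclideanSpace ℝ (Fin N) => y j - p j) _ z :=
      ((contDiff_coord (n := 1) j).sub contDiff_const).hasPd one_ne_zero i z
    have h2 := (HasPd.comp (G := fun u => u ^ 2) (hasDerivAt_pow 2 _) h1).2
    simp only [pd] at h2
    rw [h2]
    have h3 := pd_sub (i := i) ((contDiff_coord (n := 1) j).differentiable one_ne_zero z)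
      (differentiableAt_const (p j))
    rw [pd_coord, pd_const] at h3
    simp only [pd] at h3
    rw [h3]
    simp
  simp_rw [e]
  by_cases hi : i = l
  · rw [if_pos hi]
    refine Finset.sum_eq_zero fun j hj => ?_
    rw [if_neg, mul_zero]
    rintro rfl
    simp [hi] at hj
  · rw [if_neg hi, Finset.sum_eq_single i]
    · simp
    · intro j _ hj
      rw [if_neg (Ne.symm hj), mul_zero]
    · simp [hi]

lemma hasPd_hk (p z : EuclideanSpace ℝ (Fin N)) (s : ℝ) (i : Fin N) :
    HasPd i (hk l p s) (if i = l then 0 else -(z i - p i) / (2 * s) * hk l p s z) z := by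
  have h1 := HasPd.comp (G := fun u => exp (-u / (4 * s) - tdim l / 2 * log s))
    (((((hasDerivAt_id (tsq l p z)).neg).div_const (4 * s)).sub_const
      (tdim l / 2 * log s)).exp) (hasPd_tsq (l := l) p z i)
  refine HasPd.congr h1 ?_
  by_cases hi : i = l
  · simp [hi]
  · simp only [hi, if_false, hk, id, Pi.neg_apply]
    ring

lemma hasPd_dk (p z : EuclideanSpace ℝ (Fin N)) (s : ℝ) : HasPd l (dk l p s) 0 z := by
  have h1 := HasPd.comp (G := fun u => u / (4 * s ^ 2) - tdim l / (2 * s))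
    (((hasDerivAt_id (tsq l p z)).div_const (4 * s ^ 2)).sub_const (tdim l / (2 * s)))
      (hasPd_tsq (l := l) p z l)
  exact HasPd.congr h1 (by simp)

lemma hasPd_grad_hk (p z : EuclideanSpace ℝ (Fin N)) (s : ℝ) {i : Fin N} (hi : i ≠ l) :
    HasPd i (fun z => -(z i - p i) / (2 * s) * hk l p s z)
      (((z i - p i) ^ 2 / (4 * s ^ 2) - 1 / (2 * s)) * hk l p s z) z := by
  have h1 := HasPd.comp (G := fun u => -(u - p i) / (2 * s))
    ((((hasDerivAt_id (z i)).sub_const (p i)).neg).div_const (2 * s))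
    (i := i) (g := fun z => z i) (x := z) (g' := 1)
    (((contDiff_coord (n := 1) i).hasPd one_ne_zero i z).congr (by rw [pd_coord]; simp))
  have h2 := HasPd.mul h1 (hasPd_hk (l := l) p z s i)
  refine HasPd.congr h2 ?_
  simp only [hi, if_false]
  ring

lemma sum_grad_hk (p z : EuclideanSpace ℝ (Fin N)) (s : ℝ) :
    ∑ i ∈ Finset.univ.erase l, ((z i - p i) ^ 2 / (4 * s ^ 2) - 1 / (2 * s)) * hk l p s z =
      dk l p s z * hk l p s z := by
  rw [← Finset.sum_mul, Finset.sum_sub_distrib, ← Finset.sum_div, Finset.sum_const, nsmul_eq_mul,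
    dk, tsq, tdim]
  ring

lemma integral_sub_gaussian {s : ℝ} (hs : 0 < s) (q : ℝ) :
    Integrable (fun x => exp (-(x - q) ^ 2 / (4 * s) - 1 / 2 * log s)) ∧
      ∫ x, exp (-(x - q) ^ 2 / (4 * s) - 1 / 2 * log s) = sqrt (4 * π) := by
  have e (x : ℝ) : exp (-(x - q) ^ 2 / (4 * s) - 1 / 2 * log s) =
      exp (-(1 / (4 * s)) * (x - q) ^ 2) * exp (-(1 / 2 * log s)) := by
    rw [← exp_add]; ring_nf
  simp_rw [e]
  have hi := (integrable_exp_neg_mul_sq (b := 1 / (4 * s)) (by positivity)).comp_sub_right q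
  refine ⟨hi.mul_const _, ?_⟩
  rw [integral_mul_const, integral_sub_right_eq_self (fun x => exp (-(1 / (4 * s)) * x ^ 2)) q,
    integral_gaussian]
  have h1 : exp (-(1 / 2 * log s)) = (sqrt s)⁻¹ := by
    rw [exp_neg, sqrt_eq_rpow, rpow_def_of_pos hs]; ring_nf
  rw [h1, show π / (1 / (4 * s)) = 4 * π * s by field_simp, sqrt_mul (by positivity)]
  have := (sqrt_pos.2 hs).ne'
  field_simp

lemma hk_mul_eq_prod (p : EuclideanSpace ℝ (Fin N)) (s : ℝ) (h : ℝ → ℝ)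
    (z : EuclideanSpace ℝ (Fin N)) :
    hk l p s z * h (z l) = ∏ i, (fun i x => if i = l then h x else
      exp (-(x - p i) ^ 2 / (4 * s) - 1 / 2 * log s)) i (z i) := by
  rw [← Finset.mul_prod_erase _ _ (Finset.mem_univ l), mul_comm]
  congr 1
  · simp
  · rw [Finset.prod_congr rfl (g := fun i => exp (-(z i - p i) ^ 2 / (4 * s) - 1 / 2 * log s))
      fun i hi => by simp [Finset.ne_of_mem_erase hi], ← exp_sum, Finset.sum_sub_distrib,
      ← Finset.sum_div, Finset.sum_neg_distrib, Finset.sum_const, nsmul_eq_mul, hk, tsq, tdim]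
    ring_nf

lemma hk_mul_integrable (p : EuclideanSpace ℝ (Fin N)) {s : ℝ} (hs : 0 < s) {h : ℝ → ℝ}
    (hh : Integrable h) :
    Integrable (fun z => hk l p s z * h (z l)) ∧
      ∫ z, hk l p s z * h (z l) = tmass l * ∫ x, h x := by
  set F : Fin N → ℝ → ℝ := fun i x => if i = l then h x else
      exp (-(x - p i) ^ 2 / (4 * s) - 1 / 2 * log s) with hF
  have hFi (i) : Integrable (F i) := by
    by_cases hi : i = l
    · simpa [hF, hi] using hh
    · simpa [hF, hi] using (integral_sub_gaussian hs (p i)).1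
  have e : (fun z => hk l p s z * h (z l)) =
      (fun y : Fin N → ℝ => ∏ i, F i (y i)) ∘ (@WithLp.ofLp 2 (Fin N → ℝ)) :=
    funext fun z => hk_mul_eq_prod p s h z
  have hmp := PiLp.volume_preserving_ofLp (Fin N)
  have hme : MeasurableEmbedding (@WithLp.ofLp 2 (Fin N → ℝ)) :=
    (MeasurableEquiv.toLp 2 (Fin N → ℝ)).symm.measurableEmbedding
  constructor
  · rw [e, hmp.integrable_comp_emb hme]
    exact Integrable.fintype_prod hFi
  · rw [e]
    rw [show (∫ z, ((fun y : Fin N → ℝ => ∏ i, F i (y i)) ∘ (@WithLp.ofLp 2 (Fin N → ℝ))) z) =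
      ∫ y : Fin N → ℝ, ∏ i, F i (y i) from
      hmp.integral_comp hme (fun y : Fin N → ℝ => ∏ i, F i (y i))]
    rw [integral_fintype_prod_volume_eq_prod, ← Finset.mul_prod_erase _ _ (Finset.mem_univ l),
      mul_comm]
    congr 1
    · rw [Finset.prod_congr rfl (g := fun _ => sqrt (4 * π)) fun i hi => by
        simp only [hF, Finset.ne_of_mem_erase hi, if_false]
        exact (integral_sub_gaussian hs (p i)).2, Finset.prod_const, tmass]
    · simp [hF]

/-- Doubling the time of the kernel absorbs Gaussian factors. -/
lemma hk_eq_double (p z : EuclideanSpace ℝ (Fin N)) {s : ℝ} (hs : 0 < s) :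
    hk l p s z = exp (tdim l / 2 * log 2) * exp (-(tsq l p z / (8 * s))) * hk l p (2 * s) z := by
  rw [hk, hk, ← exp_add, ← exp_add, log_mul two_ne_zero hs.ne']
  congr 1
  field_simp
  ring

lemma exists_hk_bounds (l : Fin N) : ∃ C ≥ 1, ∀ p z : EuclideanSpace ℝ (Fin N), ∀ s : ℝ, 1 ≤ s →
    hk l p s z ≤ C * hk l p (2 * s) z ∧
    dk l p s z ^ 2 * hk l p s z ≤ C / s ^ 2 * hk l p (2 * s) z ∧
    |dk l p s z| * hk l p s z ≤ C * hk l p (2 * s) z ∧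
    ∀ i, i ≠ l → |-(z i - p i) / (2 * s) * hk l p s z| ≤ C * hk l p (2 * s) z := by
  set A := exp (tdim l / 2 * log 2)
  set n := tdim l
  have hn : 0 ≤ n := tdim_nonneg
  have hA : 1 ≤ A := one_le_exp (by have := log_pos one_lt_two; positivity)
  refine ⟨A * (17 + n ^ 2), by nlinarith [sq_nonneg n], fun p z s hs => ?_⟩
  have hs0 : 0 < s := by linarith
  set e := tsq l p z / (8 * s) with he
  have he0 : 0 ≤ e := div_nonneg (tsq_nonneg p z) (by positivity)
  have hE : tsq l p z = 8 * s * e := by rw [he]; field_simp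
  set K := hk l p (2 * s) z with hK
  have hK0 : 0 < K := hk_pos _ _ _
  have hk1 : hk l p s z = A * exp (-e) * K := hk_eq_double p z hs0
  have q1 : 1 ≤ exp e := one_le_exp he0
  have q2 : e ^ 2 / 2 ≤ exp e := by have := quadratic_le_exp_of_nonneg he0; nlinarith
  have q3 : e ≤ exp e := by linarith [add_one_le_exp e]
  have key {X B : ℝ} (hX : X ≤ B * exp e) : X * hk l p s z ≤ A * B * K := by
    rw [hk1]
    have : X * exp (-e) ≤ B := by
      rw [exp_neg, ← div_eq_mul_inv, div_le_iff₀ (exp_pos _)]; exact hX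
    calc _ = (X * exp (-e)) * (A * K) := by ring
      _ ≤ B * (A * K) := mul_le_mul_of_nonneg_right this (by positivity)
      _ = _ := by ring
  have hdk : dk l p s z = (2 * e - n / 2) / s := by
    rw [dk, hE]; field_simp; ring
  have hdk2 : dk l p s z ^ 2 ≤ (16 + n ^ 2) / s ^ 2 * exp e := by
    rw [hdk, div_pow, div_mul_eq_mul_div]
    refine div_le_div_of_nonneg_right ?_ (by positivity)
    nlinarith [mul_nonneg he0 hn, mul_nonneg (sq_nonneg n) (sub_nonneg.2 q1)]
  have hs2 : (16 + n ^ 2) / s ^ 2 ≤ 16 + n ^ 2 := div_le_self (by positivity) (by nlinarith)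
  have hdk3 : dk l p s z ^ 2 ≤ (16 + n ^ 2) * exp e :=
    hdk2.trans (mul_le_mul_of_nonneg_right hs2 (exp_pos _).le)
  refine ⟨?_, ?_, ?_, fun i hi => ?_⟩
  · have := key (X := 1) (B := 17 + n ^ 2) (by nlinarith [sq_nonneg n])
    linarith
  · refine (key hdk2).trans (mul_le_mul_of_nonneg_right ?_ hK0.le)
    rw [← mul_div_assoc]
    refine div_le_div_of_nonneg_right ?_ (by positivity)
    nlinarith
  · refine (key (B := 17 + n ^ 2) ?_).trans le_rfl
    have : |dk l p s z| ≤ 1 + dk l p s z ^ 2 := by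
      rw [← sq_abs]; nlinarith [sq_nonneg (|dk l p s z| - 1), sq_nonneg (|dk l p s z|)]
    linarith
  · rw [abs_mul, abs_of_pos (hk_pos p s z)]
    refine key (B := 17 + n ^ 2) ?_
    have h1 := sq_le_tsq p z hi
    have h2 : |-(z i - p i) / (2 * s)| ≤ 1 + (-(z i - p i) / (2 * s)) ^ 2 := by
      rw [← sq_abs (-(z i - p i) / (2 * s))]
      nlinarith [sq_nonneg (|-(z i - p i) / (2 * s)| - 1), sq_nonneg (|-(z i - p i) / (2 * s)|)]
    have h3 : (-(z i - p i) / (2 * s)) ^ 2 ≤ 2 * e := by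
      rw [div_pow, neg_sq, div_le_iff₀ (by positivity)]
      nlinarith [mul_nonneg he0 (by linarith : 0 ≤ s - 1), mul_nonneg he0 hs0.le,
        mul_nonneg (mul_nonneg he0 hs0.le) (by linarith : 0 ≤ s - 1)]
    nlinarith [mul_nonneg (sq_nonneg n) (exp_pos e).le]

end HeatKernel

section StaticInequality

variable {N : ℕ} {l : Fin N}

lemma flux_young {c T Ti k o o' G G' vi vii δ : ℝ} (hc : 0 < c) (ho : 0 < o) (hk : 0 < k)
    (h : c * o ≤ G' * o - 1 / 2 * o' * G) :
    k * T ^ 2 * (G * (o * vii + o' * (δ * vi - 1 / 2 * vi ^ 2))) +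
    c / 2 * (T ^ 2 * k * o * vi ^ 2) -
      (T ^ 2 * k * (o' * (δ - vi) * G * vi + o * G' * vi ^ 2 + o * G * vii) +
        2 * T * Ti * k * (o * G * vi)) ≤
      -(c / 4) * (T ^ 2 * k * o * vi ^ 2) + 4 / c * (Ti ^ 2 * k * o * G ^ 2) := by
  have h1 : 0 ≤ T ^ 2 * k * vi ^ 2 * (G' * o - 1 / 2 * o' * G - c * o) :=
    mul_nonneg (by positivity) (by linarith)
  have h2 : 0 ≤ k * o / c * (c / 2 * T * vi + 2 * Ti * G) ^ 2 := by positivity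
  have e : k * o / c * (c / 2 * T * vi + 2 * Ti * G) ^ 2 = c / 4 * (T ^ 2 * k * o * vi ^ 2) +
      2 * T * Ti * k * (o * G * vi) + 4 / c * (Ti ^ 2 * k * o * G ^ 2) := by
    field_simp; ring
  linarith

lemma corrector_young {c T d k o G γ C v : ℝ} (hc : 0 < c) (ho : 0 < o) (hk : 0 < k)
    (hγ : |γ| ≤ C * o) :
    -(T ^ 2 * d * k * γ * G * v) ≤ c / 4 * (T ^ 2 * k * o * v ^ 2) +
      C ^ 2 / c * (T ^ 2 * (d ^ 2 * k) * (o * G ^ 2)) := by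
  have h1 : γ ^ 2 ≤ (C * o) ^ 2 := sq_le_sq' (by linarith [(abs_le.1 hγ).1]) (abs_le.1 hγ).2
  have h2 : 0 ≤ T ^ 2 * k / (c * o) * (c / 2 * o * v + d * γ * G) ^ 2 := by positivity
  have e : T ^ 2 * k / (c * o) * (c / 2 * o * v + d * γ * G) ^ 2 = c / 4 * (T ^ 2 * k * o * v ^ 2) +
      T ^ 2 * d * k * γ * G * v + T ^ 2 * k * d ^ 2 * G ^ 2 / (c * o) * γ ^ 2 := by
    field_simp; ring
  have h3 : T ^ 2 * k * d ^ 2 * G ^ 2 / (c * o) * γ ^ 2 ≤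
      T ^ 2 * k * d ^ 2 * G ^ 2 / (c * o) * (C * o) ^ 2 :=
        mul_le_mul_of_nonneg_left h1 (by positivity)
  have e2 : T ^ 2 * k * d ^ 2 * G ^ 2 / (c * o) * (C * o) ^ 2 =
      C ^ 2 / c * (T ^ 2 * (d ^ 2 * k) * (o * G ^ 2)) := by field_simp
  linarith

lemma IsWeight.continuous {ω ω' H Γ : ℝ → ℝ} {κ h0 h1 θ CΓ : ℝ}
    (hw : IsWeight ω ω' H Γ κ h0 h1 θ CΓ) : Continuous ω ∧ Continuous Γ :=
  ⟨continuous_iff_continuousAt.2 fun x => (hw.deriv x).continuousAt,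
    continuous_iff_continuousAt.2 fun x => (hw.corr x).continuousAt⟩

lemma IsWeight.contDiff {ω ω' H Γ : ℝ → ℝ} {κ h0 h1 θ CΓ : ℝ}
    (hw : IsWeight ω ω' H Γ κ h0 h1 θ CΓ) : ContDiff ℝ 1 ω :=
  contDiff_one_iff_deriv.2 ⟨fun x => (hw.deriv x).differentiableAt, by
    rw [funext fun x => (hw.deriv x).deriv]; exact hw.cont'⟩

/-- The integrand of the localized, weighted energy balance at a fixed time. -/
noncomputable def balRate (ω ω' : ℝ → ℝ) (θ : ℝ) (l : Fin N) (p : EuclideanSpace ℝ (Fin N)) (s : ℝ)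
    (T v m : EuclideanSpace ℝ (Fin N) → ℝ) (g : ℝ → ℝ) (z : EuclideanSpace ℝ (Fin N)) : ℝ :=
  -θ * (T z ^ 2 * (dk l p s z * hk l p s z) * m z) + hk l p s z * T z ^ 2 *
    (g (v z) * (ω (z l - v z) * lap v z + ω' (z l - v z) *
      (pd l v z - 1 / 2 * ∑ i, pd i v z ^ 2)))

lemma continuous_balRate {ω ω' : ℝ → ℝ} {T v m : EuclideanSpace ℝ (Fin N) → ℝ} {g : ℝ → ℝ}
    (hω : Continuous ω) (hω' : Continuous ω') (hT : Continuous T) (hv : ContDiff ℝ 2 v)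
    (hm : Continuous m) (hg : Continuous g) (θ : ℝ) (p : EuclideanSpace ℝ (Fin N)) (s : ℝ) :
    Continuous (balRate ω ω' θ l p s T v m g) := by
  have hv1 : ContDiff ℝ 1 v := hv.of_le (by norm_num)
  have hY : Continuous fun z : EuclideanSpace ℝ (Fin N) => z l - v z :=
    (contDiff_coord (n := 1) l).continuous.sub hv.continuous
  have hkc := (contDiff_hk (n := 1) (l := l) p s).continuous
  have hdc := (contDiff_dk (n := 1) (l := l) p s).continuous
  exact (continuous_const.mul (((hT.pow 2).mul (hdc.mul hkc)).mul hm)).add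
    ((hkc.mul (hT.pow 2)).mul ((hg.comp hv.continuous).mul (((hω.comp hY).mul
      (continuous_lap hv)).add ((hω'.comp hY).mul ((continuous_pd hv1 l).sub (continuous_const.mul
        (continuous_finsetSum _ fun i _ => (continuous_pd hv1 i).pow 2)))))))

theorem IsWeight.static_le {ω ω' H Γ : ℝ → ℝ} {κ h0 h1 θ CΓ : ℝ}
    (hw : IsWeight ω ω' H Γ κ h0 h1 θ CΓ) {v T J Λ m : EuclideanSpace ℝ (Fin N) → ℝ}
    {g g' : ℝ → ℝ} {c D CJ Cg Ck s : ℝ} {p : EuclideanSpace ℝ (Fin N)} (hv : ContDiff ℝ 2 v)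
    (hT : ContDiff ℝ 1 T) (hTc : HasCompactSupport T) (hT0 : ∀ z, 0 ≤ T z) (hT1 : ∀ z, T z ≤ 1)
    (hD1 : D ≤ 1) (hTD : ∀ i z, |pd i T z| ≤ D) (hg : ∀ x, HasDerivAt g (g' x) x)
    (hg' : Continuous g') (hc : 0 < c)
    (hdiss : ∀ z, c * ω (z l - v z) ≤
      g' (v z) * ω (z l - v z) - 1 / 2 * ω' (z l - v z) * g (v z))
    (hJ : ContDiff ℝ 1 J) (hΛ : ContDiff ℝ 1 Λ) (hm : Continuous m)
    (hJd : ∀ i, i ≠ l → ∀ z, pd i J z = ω (z l - v z) * g (v z) * pd i v z)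
    (hΛd : ∀ z, pd l Λ z = J z - θ * m z + Γ (z l - v z) * g (v z) * pd l v z)
    (hJb : ∀ z, |J z| ≤ CJ * ω (z l)) (hΛb : ∀ z, |Λ z| ≤ CJ * ω (z l))
    (hgb : ∀ z, ω (z l - v z) * g (v z) ^ 2 ≤ Cg * ω (z l)) (hCk : 0 ≤ Ck)
    (h1k : ∀ z, hk l p s z ≤ Ck * hk l p (2 * s) z)
    (h2k : ∀ z, dk l p s z ^ 2 * hk l p s z ≤ Ck / s ^ 2 * hk l p (2 * s) z)
    (h3k : ∀ z, |dk l p s z| * hk l p s z ≤ Ck * hk l p (2 * s) z)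
    (h4k : ∀ z i, i ≠ l → |-(z i - p i) / (2 * s) * hk l p s z| ≤ Ck * hk l p (2 * s) z)
    (hs : 0 < s) :
    ∫ z, balRate ω ω' θ l p s T v m g z ≤
      -(c / 2) * (∫ z, T z ^ 2 * hk l p s z * ω (z l - v z) * ∑ i, pd i v z ^ 2) +
      CΓ ^ 2 / c * (Ck / s ^ 2) * (∫ z, hk l p (2 * s) z * (ω (z l - v z) * g (v z) ^ 2)) +
      D * (Ck * (N * (4 / c * Cg + 2 * CJ) + 2 * CJ)) * (tmass l * ∫ x, ω x) := by
  obtain ⟨hωc, hΓc⟩ := hw.continuous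
  have hv1 : ContDiff ℝ 1 v := hv.of_le (by norm_num)
  have hgc : ContDiff ℝ 1 g := contDiff_one_iff_deriv.2 ⟨fun x => (hg x).differentiableAt, by
    rw [funext fun x => (hg x).deriv]; exact hg'⟩
  have hY : ContDiff ℝ 1 fun z : EuclideanSpace ℝ (Fin N) => z l - v z :=
    (contDiff_coord l).sub hv1
  have hCJ : 0 ≤ CJ := nonneg_of_mul_nonneg_left ((abs_nonneg _).trans (hJb 0)) (hw.pos _)
  have hCg : 0 ≤ Cg := nonneg_of_mul_nonneg_left
    ((mul_nonneg (hw.pos _).le (sq_nonneg _)).trans (hgb 0)) (hw.pos _)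
  have hD : 0 ≤ D := (abs_nonneg _).trans (hTD l 0)
  set V : Fin N → EuclideanSpace ℝ (Fin N) → ℝ := fun i z => ω (z l - v z) * g (v z) * pd i v z
  have hV (i) : ContDiff ℝ 1 (V i) :=
    ((hw.contDiff.comp hY).mul (hgc.comp hv1)).mul (contDiff_pd_one hv i)
  have hT2 : ContDiff ℝ 1 fun z => T z ^ 2 := hT.pow 2
  set F : Fin N → EuclideanSpace ℝ (Fin N) → ℝ := fun i z => if i = l then
      T z ^ 2 * (hk l p s z * V i z + dk l p s z * hk l p s z * Λ z) else
      T z ^ 2 * (hk l p s z * V i z - -(z i - p i) / (2 * s) * hk l p s z * J z) with hF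
  have hlin (i : Fin N) : ContDiff ℝ 1 fun z : EuclideanSpace ℝ (Fin N) =>
      -(z i - p i) / (2 * s) * hk l p s z :=
    (((contDiff_coord i).sub contDiff_const).neg.div_const _).mul (contDiff_hk p s)
  have hFd (i) : ContDiff ℝ 1 (F i) := by
    by_cases hi : i = l
    · simp only [hF, hi, if_true]
      exact hT2.mul (((contDiff_hk p s).mul (hV l)).add
        (((contDiff_dk p s).mul (contDiff_hk p s)).mul hΛ))
    · simp only [hF, hi, if_false]
      exact hT2.mul (((contDiff_hk p s).mul (hV i)).sub ((hlin i).mul hJ))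
  have hFc (i) : HasCompactSupport (F i) := by
    refine hTc.mono fun z hz => ?_
    rw [Function.mem_support] at hz ⊢
    contrapose! hz
    simp [hF, hz]
  have hT2p (i z) : HasPd i (fun z => T z ^ 2) (2 * T z * pd i T z) z :=
    (HasPd.comp (G := fun u => u ^ 2) (hasDerivAt_pow 2 (T z)) (hT.hasPd one_ne_zero i z)).congr
      (by simp)
  have hYp (i z) : HasPd i (fun z : EuclideanSpace ℝ (Fin N) => z l - v z)
      ((if i = l then 1 else 0) - pd i v z) z :=
    HasPd.sub (((contDiff_coord (n := 1) l).hasPd one_ne_zero i z).congr (pd_coord l))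
      (hv1.hasPd one_ne_zero i z)
  have hVp (i z) : HasPd i (V i) (ω' (z l - v z) * ((if i = l then 1 else 0) - pd i v z) *
      g (v z) * pd i v z + ω (z l - v z) * g' (v z) * pd i v z ^ 2 +
      ω (z l - v z) * g (v z) * pd i (pd i v) z) z := by
    have := ((HasPd.comp (hw.deriv (z l - v z)) (hYp i z)).mul
      (HasPd.comp (hg (v z)) (hv1.hasPd one_ne_zero i z))).mul
        ((contDiff_pd_one hv i).hasPd one_ne_zero i z)
    exact HasPd.congr this (by ring)
  have hFl (z) : pd l (F l) z = 2 * T z * pd l T z * hk l p s z * (ω (z l - v z) * g (v z) *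
        pd l v z) + T z ^ 2 * hk l p s z * (ω' (z l - v z) * (1 - pd l v z) *
      g (v z) * pd l v z + ω (z l - v z) * g' (v z) * pd l v z ^ 2 +
      ω (z l - v z) * g (v z) * pd l (pd l v) z) +
      2 * T z * pd l T z * (dk l p s z * hk l p s z * Λ z) +
      T z ^ 2 * (dk l p s z * hk l p s z * (J z - θ * m z +
        Γ (z l - v z) * g (v z) * pd l v z)) := by
    have h1 := (hT2p l z).mul (((hasPd_hk (l := l) p z s l).mul (hVp l z)).add
      (((hasPd_dk (l := l) p z s).mul (hasPd_hk (l := l) p z s l)).mul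
        ((hΛ.hasPd one_ne_zero l z).congr (hΛd z))))
    have e : F l = fun z => T z ^ 2 * (hk l p s z * V l z + dk l p s z * hk l p s z * Λ z) := by
      funext z; simp [hF]
    rw [e, h1.2]
    simp only [if_true, V]
    ring
  have hFi (i) (hi : i ≠ l) (z) : pd i (F i) z = 2 * T z * pd i T z * hk l p s z *
      (ω (z l - v z) * g (v z) * pd i v z) + T z ^ 2 * hk l p s z * (ω' (z l - v z) *
      (0 - pd i v z) * g (v z) * pd i v z + ω (z l - v z) * g' (v z) * pd i v z ^ 2 +
      ω (z l - v z) * g (v z) * pd i (pd i v) z) -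
      2 * T z * pd i T z * (-(z i - p i) / (2 * s) * hk l p s z * J z) - T z ^ 2 * J z *
        (((z i - p i) ^ 2 / (4 * s ^ 2) - 1 / (2 * s)) * hk l p s z) := by
    have h1 := (hT2p i z).mul (((hasPd_hk (l := l) p z s i).mul (hVp i z)).sub
      ((hasPd_grad_hk (l := l) p z s hi).mul ((hJ.hasPd one_ne_zero i z).congr (hJd i hi z))))
    have e : F i = fun z => T z ^ 2 * (hk l p s z * V i z -
        -(z i - p i) / (2 * s) * hk l p s z * J z) := by
      funext z; simp [hF, hi]
    rw [e, h1.2]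
    simp only [hi, if_false, V]
    ring
  have hpt (z) : balRate ω ω' θ l p s T v m g z +
      c / 2 * (T z ^ 2 * hk l p s z * ω (z l - v z) * ∑ i, pd i v z ^ 2) - ∑ i, pd i (F i) z ≤
      CΓ ^ 2 / c * (Ck / s ^ 2) * (hk l p (2 * s) z * (ω (z l - v z) * g (v z) ^ 2)) +
      D * (Ck * (N * (4 / c * Cg + 2 * CJ) + 2 * CJ)) * (hk l p (2 * s) z * ω (z l)) := by
    set K := hk l p (2 * s) z with hK
    have hK0 : 0 < K := hk_pos _ _ _
    have hk0 : 0 < hk l p s z := hk_pos _ _ _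
    set o := ω (z l - v z) with ho
    have ho0 : 0 < o := hw.pos _
    have hz0 : 0 < ω (z l) := hw.pos _
    have hT2le : T z ^ 2 ≤ 1 := by nlinarith [hT0 z, hT1 z]
    have hcut (i) : 4 / c * (pd i T z ^ 2 * hk l p s z * o * g (v z) ^ 2) ≤
        D * Ck * (4 / c * Cg) * (K * ω (z l)) := by
      have a1 : pd i T z ^ 2 ≤ D := by
        have := hTD i z
        rw [← sq_abs]; nlinarith [abs_nonneg (pd i T z)]
      have a2 : hk l p s z * (o * g (v z) ^ 2) ≤ (Ck * K) * (Cg * ω (z l)) :=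
        mul_le_mul (h1k z) (hgb z) (by positivity) (by positivity)
      have a3 := mul_le_mul a1 a2 (by positivity) hD
      calc _ = 4 / c * (pd i T z ^ 2 * (hk l p s z * (o * g (v z) ^ 2))) := by ring
        _ ≤ 4 / c * (D * ((Ck * K) * (Cg * ω (z l)))) :=
          mul_le_mul_of_nonneg_left a3 (by positivity)
        _ = _ := by ring
    have hcross (i) (X j : ℝ) (hX : |X| ≤ Ck * K) (hj : |j| ≤ CJ * ω (z l)) :
        2 * T z * pd i T z * (X * j) ≤ D * Ck * (2 * CJ) * (K * ω (z l)) := by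
      have a1 : |X * j| ≤ (Ck * K) * (CJ * ω (z l)) := by
        rw [abs_mul]; exact mul_le_mul hX hj (abs_nonneg _) (by positivity)
      have a2 : |2 * T z * pd i T z| ≤ 2 * D := by
        rw [abs_mul, abs_of_nonneg (by linarith [hT0 z])]
        have := hTD i z
        nlinarith [hT0 z, hT1 z, abs_nonneg (pd i T z)]
      have a3 := mul_le_mul a2 a1 (abs_nonneg _) (by positivity)
      rw [← abs_mul] at a3
      refine (le_abs_self _).trans (a3.trans (le_of_eq (by ring)))
    have hl : -θ * (T z ^ 2 * (dk l p s z * hk l p s z) * m z) +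
        (hk l p s z * T z ^ 2 * (g (v z) * (o * pd l (pd l v) z + ω' (z l - v z) *
          (1 * pd l v z - 1 / 2 * pd l v z ^ 2))) +
          c / 2 * (T z ^ 2 * hk l p s z * o * pd l v z ^ 2)) - pd l (F l) z ≤
        CΓ ^ 2 / c * (Ck / s ^ 2) * (K * (o * g (v z) ^ 2)) +
        D * Ck * (4 / c * Cg + 2 * CJ) * (K * ω (z l)) -
          T z ^ 2 * J z * (dk l p s z * hk l p s z) := by
      rw [hFl]
      have y1 := flux_young (T := T z) (Ti := pd l T z) (vi := pd l v z) (vii := pd l (pd l v) z)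
        (δ := 1) hc ho0 hk0 (hdiss z)
      have y2 := corrector_young (T := T z) (d := dk l p s z) (G := g (v z)) (v := pd l v z)
        hc ho0 hk0 (hw.corr_le (z l - v z))
      have y3 : CΓ ^ 2 / c * (T z ^ 2 * (dk l p s z ^ 2 * hk l p s z) * (o * g (v z) ^ 2)) ≤
          CΓ ^ 2 / c * (Ck / s ^ 2) * (K * (o * g (v z) ^ 2)) := by
        have b1 : T z ^ 2 * (dk l p s z ^ 2 * hk l p s z) ≤ Ck / s ^ 2 * K :=
          (mul_le_of_le_one_left (by positivity) hT2le).trans (h2k z)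
        calc _ ≤ CΓ ^ 2 / c * ((Ck / s ^ 2 * K) * (o * g (v z) ^ 2)) :=
              mul_le_mul_of_nonneg_left (mul_le_mul_of_nonneg_right b1 (by positivity))
                (by positivity)
          _ = _ := by ring
      have y4 := hcross l (-(dk l p s z * hk l p s z)) (Λ z)
        (by rw [abs_neg, abs_mul, abs_of_pos hk0]; exact h3k z) (hΛb z)
      have y5 := hcut l
      linarith
    have hi (i) (hil : i ≠ l) : hk l p s z * T z ^ 2 * (g (v z) * (o * pd i (pd i v) z +
          ω' (z l - v z) * (0 * pd i v z - 1 / 2 * pd i v z ^ 2))) +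
          c / 2 * (T z ^ 2 * hk l p s z * o * pd i v z ^ 2) - pd i (F i) z ≤
        D * Ck * (4 / c * Cg + 2 * CJ) * (K * ω (z l)) + T z ^ 2 * J z *
        (((z i - p i) ^ 2 / (4 * s ^ 2) - 1 / (2 * s)) * hk l p s z) := by
      rw [hFi i hil]
      have y1 := flux_young (T := T z) (Ti := pd i T z) (vi := pd i v z) (vii := pd i (pd i v) z)
        (δ := 0) hc ho0 hk0 (hdiss z)
      have y4 := hcross i _ (J z) (h4k z i hil) (hJb z)
      have y5 := hcut i
      have y6 : 0 ≤ c / 4 * (T z ^ 2 * hk l p s z * o * pd i v z ^ 2) := by positivity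
      linarith
    have hsum := add_le_add hl (Finset.sum_le_sum fun i hmem =>
      hi i (Finset.ne_of_mem_erase (a := l) (s := Finset.univ) hmem))
    rw [Finset.sum_add_distrib, Finset.sum_const, nsmul_eq_mul, ← Finset.mul_sum,
      sum_grad_hk] at hsum
    have hcard : ((Finset.univ.erase l).card : ℝ) + 1 = N := by
      have := Finset.card_erase_add_one (Finset.mem_univ l)
      rw [Finset.card_univ, Fintype.card_fin] at this
      exact_mod_cast this
    have hsplit (a : Fin N → ℝ) : ∑ i, a i = a l + ∑ i ∈ Finset.univ.erase l, a i :=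
      (Finset.add_sum_erase _ _ (Finset.mem_univ l)).symm
    rw [balRate, lap_eq_sum_pd hv, hsplit fun i => pd i (pd i v) z, hsplit fun i => pd i v z ^ 2,
      hsplit fun i => pd i (F i) z, ← hcard]
    simp only [Finset.sum_sub_distrib, Finset.sum_add_distrib, ← Finset.mul_sum, zero_mul,
      zero_sub, Finset.sum_neg_distrib, mul_neg] at hsum
    have : 0 ≤ D * Ck * (2 * CJ) * (K * ω (z l)) := by positivity
    linarith
  have hωY : Continuous fun z : EuclideanSpace ℝ (Fin N) => ω (z l - v z) := hωc.comp hY.continuous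
  have hgv : Continuous fun z => g (v z) := hgc.continuous.comp hv.continuous
  have hkc := (contDiff_hk (n := 1) (l := l) p s).continuous
  have hgrad : Continuous fun z => ∑ i, pd i v z ^ 2 :=
    continuous_finsetSum _ fun i _ => (continuous_pd hv1 i).pow 2
  have i1 : Integrable (balRate ω ω' θ l p s T v m g) := by
    refine Continuous.integrable_of_hasCompactSupport ?_ (hTc.mono fun z hz => ?_)
    · exact continuous_balRate hωc hw.cont' hT.continuous hv hm hgc.continuous θ p s
    · rw [Function.mem_support] at hz ⊢
      contrapose! hz
      simp [balRate, hz]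
  have i2 : Integrable fun z => T z ^ 2 * hk l p s z * ω (z l - v z) * ∑ i, pd i v z ^ 2 := by
    refine Continuous.integrable_of_hasCompactSupport ?_ (hTc.mono fun z hz => ?_)
    · exact ((hT2.continuous.mul hkc).mul hωY).mul hgrad
    · rw [Function.mem_support] at hz ⊢
      contrapose! hz
      simp [hz]
  have i3 (i) : Integrable (pd i (F i)) :=
    (continuous_pd (hFd i) i).integrable_of_hasCompactSupport (hasCompactSupport_pd (hFc i) i)
  obtain ⟨i4, e4⟩ := hk_mul_integrable (l := l) p (by positivity : 0 < 2 * s) hw.integrable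
  have i5 : Integrable fun z => hk l p (2 * s) z * (ω (z l - v z) * g (v z) ^ 2) := by
    refine (i4.const_mul Cg).mono' (((contDiff_hk (n := 1) p _).continuous.mul
      (hωY.mul (hgv.pow 2))).aestronglyMeasurable) (ae_of_all _ fun z => ?_)
    have hp0 := hw.pos (z l - v z)
    rw [Real.norm_of_nonneg (mul_nonneg (hk_pos _ _ _).le (by positivity))]
    have := mul_le_mul_of_nonneg_left (hgb z) (hk_pos p (2 * s) z (l := l)).le
    linarith
  have hI := integral_mono ((i1.add (i2.const_mul (c / 2))).sub
    (integrable_finsetSum _ fun i _ => i3 i)) ((i5.const_mul _).add (i4.const_mul _)) hpt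
  have e1 : ∫ z, (balRate ω ω' θ l p s T v m g z +
      c / 2 * (T z ^ 2 * hk l p s z * ω (z l - v z) * ∑ i, pd i v z ^ 2) - ∑ i, pd i (F i) z) =
      (∫ z, balRate ω ω' θ l p s T v m g z) +
      c / 2 * ∫ z, T z ^ 2 * hk l p s z * ω (z l - v z) * ∑ i, pd i v z ^ 2 := by
    have a1 := integral_sub (i1.add (i2.const_mul (c / 2)))
      (integrable_finsetSum Finset.univ fun i _ => i3 i)
    have a2 := integral_add i1 (i2.const_mul (c / 2))
    rw [integral_finsetSum _ fun i _ => i3 i, Finset.sum_congr rfl fun i _ =>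
      integral_pd_eq_zero (hFd i) (hFc i) i, Finset.sum_const_zero, sub_zero] at a1
    rw [integral_const_mul] at a2
    exact a1.trans a2
  have e3 : ∫ z, (CΓ ^ 2 / c * (Ck / s ^ 2) * (hk l p (2 * s) z * (ω (z l - v z) * g (v z) ^ 2)) +
      D * (Ck * (N * (4 / c * Cg + 2 * CJ) + 2 * CJ)) * (hk l p (2 * s) z * ω (z l))) =
      CΓ ^ 2 / c * (Ck / s ^ 2) * (∫ z, hk l p (2 * s) z * (ω (z l - v z) * g (v z) ^ 2)) +
      D * (Ck * (N * (4 / c * Cg + 2 * CJ) + 2 * CJ)) * (tmass l * ∫ x, ω x) := by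
    rw [integral_add (i5.const_mul _) (i4.const_mul _), integral_const_mul, integral_const_mul, e4]
  have hI' := (e1.symm.trans_le hI).trans_eq e3
  linarith

end StaticInequality

section Kernels

/-- The primitive of `u ↦ W u * exp (-k u)` vanishing at the origin. -/
noncomputable def expPrim (W : ℝ → ℝ) (k y : ℝ) : ℝ := ∫ u in (0 : ℝ)..y, W u * exp (-k * u)

/-- The integral of `s ↦ W (x - s) * exp (k s)` over `[c, ξ]`, written with a fixed primitive. -/
noncomputable def expKern (W : ℝ → ℝ) (k c x ξ : ℝ) : ℝ :=
  exp (k * x) * (expPrim W k (x - c) - expPrim W k (x - ξ))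

noncomputable def expComb (k a b x : ℝ) : ℝ := a * exp (k * x) + b * exp (-k * x)

/-- The integral of `s ↦ W (x - s) * expComb k a b s` over `[c, ξ]`. -/
noncomputable def combKern (W : ℝ → ℝ) (k a b c x ξ : ℝ) : ℝ :=
  a * expKern W k c x ξ + b * expKern W (-k) c x ξ

variable {W : ℝ → ℝ}

lemma hasDerivAt_expPrim (hW : Continuous W) (k y : ℝ) :
    HasDerivAt (expPrim W k) (W y * exp (-k * y)) y := by
  have hc : Continuous fun u => W u * exp (-k * u) := by fun_prop
  exact intervalIntegral.integral_hasDerivAt_right (hc.intervalIntegrable _ _)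
    (Continuous.stronglyMeasurableAtFilter hc _ _) hc.continuousAt

lemma contDiff_expPrim (hW : Continuous W) (k : ℝ) : ContDiff ℝ 1 (expPrim W k) :=
  contDiff_one_iff_deriv.2 ⟨fun y => (hasDerivAt_expPrim hW k y).differentiableAt, by
    rw [funext fun y => (hasDerivAt_expPrim hW k y).deriv]; fun_prop⟩

lemma expKern_eq (hW : Continuous W) (k c x ξ : ℝ) :
    expKern W k c x ξ = ∫ s in c..ξ, W (x - s) * exp (k * s) := by
  have hc : Continuous fun u => W u * exp (-k * u) := by fun_prop
  rw [expKern, expPrim, expPrim, intervalIntegral.integral_interval_sub_left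
    (hc.intervalIntegrable _ _) (hc.intervalIntegrable _ _),
    ← intervalIntegral.integral_comp_sub_left (fun u => W u * exp (-k * u)) x,
    ← intervalIntegral.integral_const_mul]
  refine intervalIntegral.integral_congr fun s _ => ?_
  have : exp (k * s) = exp (k * x) * exp (-k * (x - s)) := by rw [← exp_add]; congr 1; ring
  simp only [this]; ring

lemma continuous_expComb (k a b : ℝ) : Continuous (expComb k a b) := by
  unfold expComb; fun_prop

lemma hasDerivAt_expComb (k a b x : ℝ) :
    HasDerivAt (expComb k a b) (expComb k (k * a) (-(k * b)) x) x := by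
  have h (k : ℝ) : HasDerivAt (fun x => exp (k * x)) (exp (k * x) * (k * 1)) x :=
    ((hasDerivAt_id x).const_mul k).exp
  refine (((h k).const_mul a).add ((h (-k)).const_mul b)).congr_deriv ?_
  rw [expComb]; ring

lemma combKern_eq (hW : Continuous W) (k a b c x ξ : ℝ) :
    combKern W k a b c x ξ = ∫ s in c..ξ, W (x - s) * expComb k a b s := by
  rw [combKern, expKern_eq hW, expKern_eq hW, ← intervalIntegral.integral_const_mul,
    ← intervalIntegral.integral_const_mul, ← intervalIntegral.integral_add
      (Continuous.intervalIntegrable (by fun_prop) _ _)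
      (Continuous.intervalIntegrable (by fun_prop) _ _)]
  refine intervalIntegral.integral_congr fun s _ => ?_
  simp only [expComb]; ring

lemma hasDerivAt_combKern (hW : Continuous W) (k a b c x ξ : ℝ) :
    HasDerivAt (combKern W k a b c x) (W (x - ξ) * expComb k a b ξ) ξ := by
  have hc : Continuous fun s => W (x - s) * expComb k a b s :=
    (hW.comp (continuous_const.sub continuous_id)).mul (continuous_expComb k a b)
  rw [funext fun ξ => combKern_eq hW k a b c x ξ]
  exact intervalIntegral.integral_hasDerivAt_right (hc.intervalIntegrable _ _)
    (Continuous.stronglyMeasurableAtFilter hc _ _) hc.continuousAt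

lemma continuous_combKern (hW : Continuous W) (k a b c : ℝ) :
    Continuous fun q : ℝ × ℝ => combKern W k a b c q.1 q.2 := by
  have h (k) := (contDiff_expPrim hW k).continuous
  unfold combKern expKern
  exact (continuous_const.mul ((by fun_prop : Continuous fun q : ℝ × ℝ => exp (k * q.1)).mul
      (((h k).comp (by fun_prop : Continuous fun q : ℝ × ℝ => q.1 - c)).sub
        ((h k).comp (by fun_prop : Continuous fun q : ℝ × ℝ => q.1 - q.2))))).add
    (continuous_const.mul ((by fun_prop : Continuous fun q : ℝ × ℝ => exp (-k * q.1)).mul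
      (((h (-k)).comp (by fun_prop : Continuous fun q : ℝ × ℝ => q.1 - c)).sub
        ((h (-k)).comp (by fun_prop : Continuous fun q : ℝ × ℝ => q.1 - q.2)))))

lemma HasPd.const_mul {N : ℕ} {i : Fin N} {g : EuclideanSpace ℝ (Fin N) → ℝ} {g' : ℝ}
    {x : EuclideanSpace ℝ (Fin N)} (hg : HasPd i g g' x) (c : ℝ) :
    HasPd i (fun y => c * g y) (c * g') x :=
  HasPd.comp (G := fun u => c * u) (by simpa using (hasDerivAt_id (g x)).const_mul c) hg

section Space

variable {N : ℕ} {l : Fin N} {v : EuclideanSpace ℝ (Fin N) → ℝ}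

lemma contDiff_expKern (hW : Continuous W) (k c : ℝ) (hv : ContDiff ℝ 1 v) :
    ContDiff ℝ 1 fun z => expKern W k c (z l) (v z) := by
  unfold expKern
  exact (contDiff_exp.comp (contDiff_const.mul (contDiff_coord l))).mul
    (((contDiff_expPrim hW k).comp ((contDiff_coord l).sub contDiff_const)).sub
      ((contDiff_expPrim hW k).comp ((contDiff_coord l).sub hv)))

lemma contDiff_combKern (hW : Continuous W) (k a b c : ℝ) (hv : ContDiff ℝ 1 v) :
    ContDiff ℝ 1 fun z => combKern W k a b c (z l) (v z) :=
  (contDiff_const.mul (contDiff_expKern hW k c hv)).add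
    (contDiff_const.mul (contDiff_expKern hW (-k) c hv))

lemma hasPd_expKern (hW : Continuous W) (k c : ℝ) (hv : ContDiff ℝ 1 v) (i : Fin N)
    (z : EuclideanSpace ℝ (Fin N)) :
    HasPd i (fun z => expKern W k c (z l) (v z)) ((if i = l then 1 else 0) *
      (k * expKern W k c (z l) (v z) + W (z l - c) * exp (k * c) -
        W (z l - v z) * exp (k * v z)) + W (z l - v z) * exp (k * v z) * pd i v z) z := by
  have hz : HasPd i (fun z : EuclideanSpace ℝ (Fin N) => z l) (if i = l then 1 else 0) z :=
    ((contDiff_coord (n := 1) l).hasPd one_ne_zero i z).congr (pd_coord l)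
  have hvp := hv.hasPd one_ne_zero i z
  have hconst : HasPd i (fun _ : EuclideanSpace ℝ (Fin N) => c) 0 z :=
    ((contDiff_const (n := 1) (c := c)).hasPd one_ne_zero i z).congr (pd_const ..)
  have he : HasPd i (fun z : EuclideanSpace ℝ (Fin N) => exp (k * z l)) _ z :=
    HasPd.comp (G := fun x => exp (k * x)) ((hasDerivAt_id (z l)).const_mul k).exp hz
  have := he.mul ((HasPd.comp (hasDerivAt_expPrim hW k (z l - c)) (hz.sub hconst)).sub
    (HasPd.comp (hasDerivAt_expPrim hW k (z l - v z)) (hz.sub hvp)))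
  refine HasPd.congr this ?_
  have h (y : ℝ) : exp (k * y) = exp (k * z l) * exp (-k * (z l - y)) := by
    rw [← exp_add]; congr 1; ring
  rw [h c, h (v z), expKern]
  simp only [id]
  ring

lemma hasPd_combKern (hW : Continuous W) (k a b c : ℝ) (hv : ContDiff ℝ 1 v) {i : Fin N}
    (hi : i ≠ l) (z : EuclideanSpace ℝ (Fin N)) :
    pd i (fun z => combKern W k a b c (z l) (v z)) z =
      W (z l - v z) * expComb k a b (v z) * pd i v z := by
  have h1 := (hasPd_expKern (l := l) hW k c hv i z).const_mul a
  have h2 := (hasPd_expKern (l := l) hW (-k) c hv i z).const_mul b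
  refine (h1.add h2).2.trans ?_
  simp only [hi, if_false, expComb]; ring

end Space

namespace IsWeight

variable {ω ω' H Γ : ℝ → ℝ} {κ h0 h1 θ CΓ : ℝ}

lemma expKern_corr (hw : IsWeight ω ω' H Γ κ h0 h1 θ CΓ) (k c x ξ : ℝ) :
    k * expKern Γ k c x ξ + Γ (x - c) * exp (k * c) - Γ (x - ξ) * exp (k * ξ) =
      expKern ω k c x ξ - θ * expKern H k c x ξ := by
  obtain ⟨hω, hΓ⟩ := hw.continuous
  have hH := hw.contH
  have hd (s) : HasDerivAt (fun s => -(Γ (x - s) * exp (k * s)))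
      ((ω (x - s) - θ * H (x - s)) * exp (k * s) - k * (Γ (x - s) * exp (k * s))) s := by
    have h1 : HasDerivAt (fun s => x - s) (-1) s := by
      simpa using (hasDerivAt_id s).const_sub x
    have h2 : HasDerivAt (fun s => exp (k * s)) (exp (k * s) * (k * 1)) s :=
      ((hasDerivAt_id s).const_mul k).exp
    have h3 : HasDerivAt (fun s => Γ (x - s)) ((ω (x - s) - θ * H (x - s)) * -1) s :=
      (hw.corr (x - s)).comp s h1
    exact (h3.mul h2).neg.congr_deriv (by ring)
  have i1 := intervalIntegral.integral_eq_sub_of_hasDerivAt (a := c) (b := ξ) (fun s _ => hd s)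
    (Continuous.intervalIntegrable (by fun_prop) _ _)
  have e (s) : (ω (x - s) - θ * H (x - s)) * exp (k * s) - k * (Γ (x - s) * exp (k * s)) =
      (ω (x - s) * exp (k * s) - θ * (H (x - s) * exp (k * s))) -
        k * (Γ (x - s) * exp (k * s)) := by ring
  simp only [e] at i1
  rw [intervalIntegral.integral_sub (Continuous.intervalIntegrable (by fun_prop) _ _)
      (Continuous.intervalIntegrable (by fun_prop) _ _),
    intervalIntegral.integral_sub (Continuous.intervalIntegrable (by fun_prop) _ _)
      (Continuous.intervalIntegrable (by fun_prop) _ _),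
    intervalIntegral.integral_const_mul, intervalIntegral.integral_const_mul, ← expKern_eq hω,
    ← expKern_eq hH, ← expKern_eq hΓ] at i1
  linarith

lemma pd_combKern {N : ℕ} {l : Fin N} {v : EuclideanSpace ℝ (Fin N) → ℝ}
    (hw : IsWeight ω ω' H Γ κ h0 h1 θ CΓ) (k a b c : ℝ) (hv : ContDiff ℝ 1 v)
    (z : EuclideanSpace ℝ (Fin N)) :
    pd l (fun z => combKern Γ k a b c (z l) (v z)) z = combKern ω k a b c (z l) (v z) -
      θ * combKern H k a b c (z l) (v z) + Γ (z l - v z) * expComb k a b (v z) * pd l v z := by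
  have h1 := (hasPd_expKern (l := l) hw.continuous.2 k c hv l z).const_mul a
  have h2 := (hasPd_expKern (l := l) hw.continuous.2 (-k) c hv l z).const_mul b
  refine (h1.add h2).2.trans ?_
  rw [hw.expKern_corr, hw.expKern_corr]
  simp only [if_true, expComb, combKern]; ring

lemma le_shift (hw : IsWeight ω ω' H Γ κ h0 h1 θ CΓ) (x s : ℝ) :
    ω (x - s) ≤ exp (2 * κ * |s|) * ω x := by
  have he (q y : ℝ) : HasDerivAt (fun y => exp (q * y) * ω y)
      (exp (q * y) * (q * 1) * ω y + exp (q * y) * ω' y) y :=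
    (((hasDerivAt_id y).const_mul q).exp).mul (hw.deriv y)
  have hmono : Monotone fun y => exp (2 * κ * y) * ω y :=
    monotone_of_hasDerivAt_nonneg (he _) fun y => by
      have : 0 ≤ exp (2 * κ * y) * (2 * κ * ω y + ω' y) :=
        mul_nonneg (exp_pos _).le (by linarith [(abs_le.1 (hw.le y)).1])
      simp only [Pi.zero_apply]; linarith
  have hanti : Antitone fun y => exp (-(2 * κ) * y) * ω y :=
    antitone_of_hasDerivAt_nonpos (he _) fun y => by
      have : 0 ≤ exp (-(2 * κ) * y) * (2 * κ * ω y - ω' y) :=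
        mul_nonneg (exp_pos _).le (by linarith [(abs_le.1 (hw.le y)).2])
      simp only [Pi.zero_apply]; linarith
  have key (q : ℝ) (h : exp (q * (x - s)) * ω (x - s) ≤ exp (q * x) * ω x) :
      ω (x - s) ≤ exp (q * s) * ω x := by
    have h1 : exp (q * x) = exp (q * (x - s)) * exp (q * s) := by rw [← exp_add]; congr 1; ring
    rw [h1, mul_assoc] at h
    exact le_of_mul_le_mul_left h (exp_pos _)
  rcases le_total 0 s with h | h
  · rw [abs_of_nonneg h]
    exact key _ (hmono (by linarith))
  · rw [abs_of_nonpos h]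
    have := key (-(2 * κ)) (hanti (by linarith))
    rwa [show -(2 * κ) * s = 2 * κ * -s by ring] at this

end IsWeight

/-- Admissible coefficients for the multipliers `expComb k a b` and base points `c`. -/
structure IsCoeff (k R a b c : ℝ) : Prop where
  nonneg : 0 ≤ a
  nonpos : b ≤ 0
  one_le : 1 ≤ a - b
  le : a ≤ exp (k * R)
  neg_le : -b ≤ exp (k * R)
  base : |c| ≤ R

lemma exp_mul_le_of_abs_le {k R x : ℝ} (hk : 0 ≤ k) (hx : |x| ≤ R) :
    exp (k * x) ≤ exp (k * R) ∧ exp (-k * x) ≤ exp (k * R) ∧ exp (-(k * R)) ≤ exp (k * x) ∧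
      exp (-(k * R)) ≤ exp (-k * x) := by
  obtain ⟨h1, h2⟩ := abs_le.1 hx
  refine ⟨?_, ?_, ?_, ?_⟩ <;> apply exp_le_exp.2 <;> nlinarith

namespace IsCoeff

variable {k R a b c : ℝ}

lemma abs_expComb_le (h : IsCoeff k R a b c) (hk : 0 ≤ k) {x : ℝ} (hx : |x| ≤ R) :
    |expComb k a b x| ≤ 2 * exp (k * R) ^ 2 := by
  obtain ⟨h1, h2, -, -⟩ := exp_mul_le_of_abs_le hk hx
  have a1 := mul_le_mul h.le h1 (exp_pos _).le (exp_pos _).le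
  have a2 := mul_le_mul h.neg_le h2 (exp_pos _).le (exp_pos _).le
  have a3 := mul_nonneg h.nonneg (exp_pos (k * x)).le
  have a4 := mul_nonneg (neg_nonneg.2 h.nonpos) (exp_pos (-k * x)).le
  rw [expComb, abs_le]
  constructor <;> nlinarith

lemma dissipation {ω ω' H Γ : ℝ → ℝ} {κ h0 h1 θ CΓ : ℝ} (h : IsCoeff (κ + 1) R a b c)
    (hw : IsWeight ω ω' H Γ κ h0 h1 θ CΓ) {x : ℝ} (hx : |x| ≤ R) (y : ℝ) :
    exp (-((κ + 1) * R)) * ω y ≤ expComb (κ + 1) ((κ + 1) * a) (-((κ + 1) * b)) x * ω y -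
      1 / 2 * ω' y * expComb (κ + 1) a b x := by
  have hκ := hw.κ_pos
  obtain ⟨-, -, h3, h4⟩ := exp_mul_le_of_abs_le (by linarith : 0 ≤ κ + 1) hx
  set E := exp ((κ + 1) * x)
  set E' := exp (-(κ + 1) * x)
  have hE : 0 < E := exp_pos _
  have hE' : 0 < E' := exp_pos _
  have ho := hw.pos y
  obtain ⟨o1, o2⟩ := abs_le.1 (hw.le y)
  have a1 : 0 ≤ a * E * (2 * κ * ω y - ω' y) :=
    mul_nonneg (mul_nonneg h.nonneg hE.le) (by linarith)
  have a2 : 0 ≤ -b * E' * (2 * κ * ω y + ω' y) :=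
    mul_nonneg (mul_nonneg (by linarith [h.nonpos]) hE'.le) (by linarith)
  have a3 : exp (-((κ + 1) * R)) ≤ a * E + -b * E' := by
    have b1 := mul_le_mul_of_nonneg_left h3 h.nonneg
    have b2 := mul_le_mul_of_nonneg_left h4 (by linarith [h.nonpos] : 0 ≤ -b)
    have b3 := mul_le_mul_of_nonneg_right h.one_le (exp_pos (-((κ + 1) * R))).le
    linarith
  have a4 := mul_le_mul_of_nonneg_right a3 ho.le
  simp only [expComb]
  change _ ≤ ((κ + 1) * a * E + -((κ + 1) * b) * E') * ω y - 1 / 2 * ω' y * (a * E + b * E')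
  nlinarith

lemma abs_combKern_le {ω ω' H Γ W : ℝ → ℝ} {κ h0 h1 θ CΓ CW ξ : ℝ} (h : IsCoeff k R a b c)
    (hk : 0 ≤ k) (hw : IsWeight ω ω' H Γ κ h0 h1 θ CΓ) (hW : Continuous W) (hCW : 0 ≤ CW)
    (hWω : ∀ x, |W x| ≤ CW * ω x) (hξ : |ξ| ≤ R) (x : ℝ) :
    |combKern W k a b c x ξ| ≤
      CW * (4 * R * exp (2 * κ * R) * exp (k * R) ^ 2) * ω x := by
  have hR : 0 ≤ R := (abs_nonneg _).trans hξ
  have hκ := hw.κ_pos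
  obtain ⟨x1, x2⟩ := abs_le.1 hξ
  obtain ⟨c1, c2⟩ := abs_le.1 h.base
  rw [combKern_eq hW, ← Real.norm_eq_abs]
  have hb : ∀ s ∈ uIoc c ξ, ‖W (x - s) * expComb k a b s‖ ≤
      CW * (exp (2 * κ * R) * ω x) * (2 * exp (k * R) ^ 2) := by
    intro s hs
    have hs' : |s| ≤ R := by
      have := uIoc_subset_uIcc hs
      rw [abs_le]
      rcases mem_uIcc.1 this with ⟨u1, u2⟩ | ⟨u1, u2⟩ <;> constructor <;> linarith
    rw [norm_mul]
    refine mul_le_mul ((hWω _).trans (mul_le_mul_of_nonneg_left ((hw.le_shift x s).trans ?_) hCW))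
      (h.abs_expComb_le hk hs') (abs_nonneg _) (by have := hw.pos x; positivity)
    refine mul_le_mul_of_nonneg_right (exp_le_exp.2 ?_) (hw.pos x).le
    exact mul_le_mul_of_nonneg_left hs' (by linarith)
  refine (intervalIntegral.norm_integral_le_of_norm_le_const hb).trans ?_
  have hlen : |ξ - c| ≤ 2 * R := by rw [abs_le]; constructor <;> linarith
  have := hw.pos x
  refine (mul_le_mul_of_nonneg_left hlen (by positivity)).trans (le_of_eq (by ring))

end IsCoeff

end Kernels

section Localization

variable {N : ℕ} {l : Fin N}

lemma exists_scaled_cutoff (N : ℕ) : ∃ C, 0 ≤ C ∧ ∀ L : ℝ, 1 ≤ L →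
    ∃ T : EuclideanSpace ℝ (Fin N) → ℝ, ContDiff ℝ 1 T ∧ (∀ z, 0 ≤ T z) ∧ (∀ z, T z ≤ 1) ∧
      (∀ z, ‖z‖ ≤ L → T z = 1) ∧ (∀ z, 2 * L < ‖z‖ → T z = 0) ∧ ∀ i z, |pd i T z| ≤ C / L := by
  let ϑ : ContDiffBump (0 : EuclideanSpace ℝ (Fin N)) := ⟨1, 2, one_pos, one_lt_two⟩
  have hϑ : ContDiff ℝ 1 ϑ := ϑ.contDiff
  have hb (i) := (hasCompactSupport_pd ϑ.hasCompactSupport i).exists_bound_of_continuous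
    (continuous_pd hϑ i)
  choose A hA using hb
  have hA0 (i) : 0 ≤ A i := (norm_nonneg _).trans (hA i 0)
  refine ⟨∑ i, A i, Finset.sum_nonneg fun i _ => hA0 i, fun L hL => ⟨fun z => ϑ (L⁻¹ • z),
    hϑ.comp (contDiff_const_smul L⁻¹), fun z => ϑ.nonneg, fun z => ϑ.le_one, fun z hz => ?_,
    fun z hz => ?_, fun i z => ?_⟩⟩
  · refine ϑ.one_of_mem_closedBall ?_
    rw [mem_closedBall_zero_iff, norm_smul, norm_inv, Real.norm_of_nonneg (by linarith),
      inv_mul_eq_div]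
    exact (div_le_one (by linarith)).2 hz
  · refine ϑ.zero_of_le_dist ?_
    rw [dist_zero_right, norm_smul, norm_inv, Real.norm_of_nonneg (by linarith), inv_mul_eq_div,
      le_div_iff₀ (by linarith)]
    exact hz.le
  · rw [pd_comp_smul (hϑ.differentiable one_ne_zero), abs_mul, abs_of_pos (by positivity),
      inv_mul_eq_div]
    exact div_le_div_of_nonneg_right ((hA i _).trans
      (Finset.single_le_sum (fun i _ => hA0 i) (Finset.mem_univ i))) (by linarith)

lemma hk_le_one (p z : EuclideanSpace ℝ (Fin N)) {s : ℝ} (hs : 1 ≤ s) : hk l p s z ≤ 1 := by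
  refine exp_le_one_iff.2 ?_
  have h1 : 0 ≤ tsq l p z / (4 * s) := div_nonneg (tsq_nonneg p z) (by positivity)
  have h2 := mul_nonneg (div_nonneg (tdim_nonneg (l := l)) zero_le_two) (log_nonneg hs)
  rw [neg_div]; linarith

lemma IsWeight.exists_combKern_le {ω ω' H Γ : ℝ → ℝ} {κ h0 h1 θ CΓ : ℝ}
    (hw : IsWeight ω ω' H Γ κ h0 h1 θ CΓ) (R : ℝ) : ∃ C, 0 ≤ C ∧ ∀ a b c, IsCoeff (κ + 1) R a b c →
    ∀ x ξ, |ξ| ≤ R → |combKern H (κ + 1) a b c x ξ| ≤ C * ω x ∧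
      |combKern ω (κ + 1) a b c x ξ| ≤ C * ω x ∧ |combKern Γ (κ + 1) a b c x ξ| ≤ C * ω x ∧
      ω (x - ξ) * expComb (κ + 1) a b ξ ^ 2 ≤ C * ω x ∧
      |H (x - ξ) * expComb (κ + 1) a b ξ| ≤ C * ω x := by
  have hκ := hw.κ_pos
  have hh1 : 0 ≤ h1 := by
    have := (mul_pos hw.h0_pos (hw.pos 0)).trans_le ((hw.h0_le 0).trans (hw.le_h1 0))
    exact (pos_of_mul_pos_left this (hw.pos 0).le).le
  have hCΓ := hw.CΓ_nonneg
  by_cases hR : 0 ≤ R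
  swap
  · exact ⟨0, le_rfl, fun a b c _ x ξ hξ => absurd ((abs_nonneg _).trans hξ) hR⟩
  have hH (x) : |H x| ≤ h1 * ω x := by
    rw [abs_of_nonneg ((mul_pos hw.h0_pos (hw.pos x)).le.trans (hw.h0_le x))]
    exact hw.le_h1 x
  obtain ⟨hωc, hΓc⟩ := hw.continuous
  set E := exp (2 * κ * R) with hE
  set F := exp ((κ + 1) * R) ^ 2 with hF
  have hE0 : 0 < E := exp_pos _
  have hF0 : 0 < F := by positivity
  set A := 4 * R * E * F with hA
  have hA0 : 0 ≤ A := by positivity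
  refine ⟨h1 * A + A + CΓ * A + E * (2 * F) ^ 2 + h1 * E * (2 * F), by positivity,
    fun a b c h x ξ hξ => ?_⟩
  have ho := hw.pos x
  have hshift : ω (x - ξ) ≤ E * ω x := (hw.le_shift x ξ).trans
    (mul_le_mul_of_nonneg_right (exp_le_exp.2 (mul_le_mul_of_nonneg_left hξ (by linarith))) ho.le)
  have hg := h.abs_expComb_le (by linarith) hξ
  have p1 : 0 ≤ h1 * A * ω x := by positivity
  have p2 : 0 ≤ A * ω x := by positivity
  have p3 : 0 ≤ CΓ * A * ω x := by positivity
  have p4 : 0 ≤ E * (2 * F) ^ 2 * ω x := by positivity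
  have p5 : 0 ≤ h1 * E * (2 * F) * ω x := by positivity
  refine ⟨?_, ?_, ?_, ?_, ?_⟩
  · have := h.abs_combKern_le (by linarith) hw hw.contH hh1 hH hξ x
    linarith
  · have := h.abs_combKern_le (by linarith) hw hωc zero_le_one
      (fun x => by rw [abs_of_pos (hw.pos x), one_mul]) hξ x
    linarith
  · have := h.abs_combKern_le (by linarith) hw hΓc hCΓ hw.corr_le hξ x
    linarith
  · have h2 : expComb (κ + 1) a b ξ ^ 2 ≤ (2 * F) ^ 2 := sq_le_sq' (abs_le.1 hg).1 (abs_le.1 hg).2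
    have := mul_le_mul hshift h2 (sq_nonneg _) (by positivity)
    linarith
  · rw [abs_mul]
    have := mul_le_mul ((hH (x - ξ)).trans (mul_le_mul_of_nonneg_left hshift hh1)) hg
      (abs_nonneg _) (by positivity)
    linarith

namespace IsPhase

variable {ω ω' H Γ : ℝ → ℝ} {κ h0 h1 θ CΓ R : ℝ} {ξ : EuclideanSpace ℝ (Fin N) → ℝ → ℝ}

/-- The spatial balance of the multiplier at one time, with constants independent of the cutoff, the
center, the scale and the coefficients. -/
lemma exists_balRate_le (hp : IsPhase ω ω' H R l ξ) (hw : IsWeight ω ω' H Γ κ h0 h1 θ CΓ) :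
    ∃ C, 0 ≤ C ∧ ∀ a b c, IsCoeff (κ + 1) R a b c → ∀ (T : EuclideanSpace ℝ (Fin N) → ℝ) (D : ℝ),
      ContDiff ℝ 1 T → HasCompactSupport T → (∀ z, 0 ≤ T z) → (∀ z, T z ≤ 1) → D ≤ 1 →
      (∀ i z, |pd i T z| ≤ D) → ∀ p s t, 1 ≤ s →
      (∫ z, balRate ω ω' θ l p s T (fun y => ξ y t)
        (fun y => combKern H (κ + 1) a b c (y l) (ξ y t)) (expComb (κ + 1) a b) z) ≤
        -(exp (-((κ + 1) * R)) / 2) * (∫ z, T z ^ 2 * hk l p s z * ω (z l - ξ z t) *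
          ∑ i, pd i (fun y => ξ y t) z ^ 2) + C / s ^ 2 * (∫ z, hk l p (2 * s) z *
          (ω (z l - ξ z t) * expComb (κ + 1) a b (ξ z t) ^ 2)) + D * C ∧
      (∫ z, hk l p (2 * s) z * (ω (z l - ξ z t) * expComb (κ + 1) a b (ξ z t) ^ 2)) ≤ C := by
  obtain ⟨C0, hC0, hC⟩ := hw.exists_combKern_le R
  obtain ⟨Ck, hCk1, hCk⟩ := exists_hk_bounds l
  obtain ⟨hωc, hΓc⟩ := hw.continuous
  have hm := tmass_pos (l := l)
  have hI : 0 ≤ ∫ x, ω x := integral_nonneg fun x => (hw.pos x).le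
  set d := exp (-((κ + 1) * R)) with hd
  have hd0 : 0 < d := exp_pos _
  set C1 := CΓ ^ 2 / d * Ck with hC1
  set C2 := Ck * (N * (4 / d * C0 + 2 * C0) + 2 * C0) * (tmass l * ∫ x, ω x) with hC2
  set C3 := C0 * (tmass l * ∫ x, ω x) with hC3
  have p1 : 0 ≤ C1 := by positivity
  have p2 : 0 ≤ C2 := by positivity
  have p3 : 0 ≤ C3 := by positivity
  refine ⟨C1 + C2 + C3, by positivity,
    fun a b c h T D hT hTc hT0 hT1 hD1 hTD p s t hs => ?_⟩
  have hs0 : 0 < s := by linarith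
  have hv := hp.space t
  have hv1 : ContDiff ℝ 1 fun z => ξ z t := hv.of_le (by norm_num)
  have hstat := hw.static_le (T := T) (J := fun y => combKern ω (κ + 1) a b c (y l) (ξ y t))
    (Λ := fun y => combKern Γ (κ + 1) a b c (y l) (ξ y t))
    (m := fun y => combKern H (κ + 1) a b c (y l) (ξ y t)) (D := D) (CJ := C0) (Cg := C0)
    (Ck := Ck) (s := s) (p := p) hv hT hTc hT0 hT1 hD1 hTD (hasDerivAt_expComb (κ + 1) a b)
    (continuous_expComb _ _ _) hd0 (fun z => h.dissipation hw (hp.bdd z t) _)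
    (contDiff_combKern hωc _ a b c hv1) (contDiff_combKern hΓc _ a b c hv1)
    (contDiff_combKern hw.contH _ a b c hv1).continuous
    (fun i hi z => hasPd_combKern hωc _ a b c hv1 hi z)
    (fun z => hw.pd_combKern _ a b c hv1 z) (fun z => (hC a b c h _ _ (hp.bdd z t)).2.1)
    (fun z => (hC a b c h _ _ (hp.bdd z t)).2.2.1)
    (fun z => (hC a b c h _ _ (hp.bdd z t)).2.2.2.1) (by linarith) (fun z => (hCk p z s hs).1)
    (fun z => (hCk p z s hs).2.1) (fun z => (hCk p z s hs).2.2.1)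
    (fun z i hi => (hCk p z s hs).2.2.2 i hi) hs0
  have hD : 0 ≤ D := (abs_nonneg _).trans (hTD l 0)
  obtain ⟨i4, e4⟩ := hk_mul_integrable (l := l) p (by positivity : 0 < 2 * s) hw.integrable
  set Q := ∫ z, hk l p (2 * s) z * (ω (z l - ξ z t) * expComb (κ + 1) a b (ξ z t) ^ 2) with hQ
  have hnn (z : EuclideanSpace ℝ (Fin N)) : 0 ≤
      hk l p (2 * s) z * (ω (z l - ξ z t) * expComb (κ + 1) a b (ξ z t) ^ 2) :=
    mul_nonneg (hk_pos _ _ _).le (mul_nonneg (hw.pos _).le (sq_nonneg _))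
  have hQ0 : 0 ≤ Q := integral_nonneg hnn
  have hQ3 : Q ≤ C3 := by
    rw [hC3, ← e4, ← integral_const_mul]
    refine integral_mono_of_nonneg (ae_of_all _ hnn) (i4.const_mul _) (ae_of_all _ fun z => ?_)
    have := mul_le_mul_of_nonneg_left (hC a b c h (z l) _ (hp.bdd z t)).2.2.2.1
      (hk_pos (l := l) p (2 * s) z).le
    simp only
    linarith
  refine ⟨hstat.trans ?_, by linarith⟩
  have a1 : CΓ ^ 2 / d * (Ck / s ^ 2) * Q ≤ (C1 + C2 + C3) / s ^ 2 * Q := by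
    refine mul_le_mul_of_nonneg_right ?_ hQ0
    rw [← mul_div_assoc]
    exact div_le_div_of_nonneg_right (by linarith) (by positivity)
  have a2 : D * (Ck * (N * (4 / d * C0 + 2 * C0) + 2 * C0)) * (tmass l * ∫ x, ω x) ≤
      D * (C1 + C2 + C3) := by
    rw [mul_assoc]; exact mul_le_mul_of_nonneg_left (by linarith) hD
  linarith

end IsPhase

end Localization

namespace IsPhase

variable {N : ℕ} {l : Fin N} {ω ω' H Γ : ℝ → ℝ} {κ h0 h1 θ CΓ R : ℝ}
  {ξ : EuclideanSpace ℝ (Fin N) → ℝ → ℝ}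

lemma balRate_eq (hp : IsPhase ω ω' H R l ξ) (θ : ℝ) (p : EuclideanSpace ℝ (Fin N)) (s : ℝ)
    (T m : EuclideanSpace ℝ (Fin N) → ℝ) (g : ℝ → ℝ) (z : EuclideanSpace ℝ (Fin N)) (t : ℝ) :
    balRate ω ω' θ l p s T (fun y => ξ y t) m g z = -θ * (T z ^ 2 * (dk l p s z * hk l p s z) *
      m z) + hk l p s z * T z ^ 2 * (H (z l - ξ z t) * g (ξ z t) * deriv (ξ z) t) := by
  rw [balRate, ← hp.eq z t]
  ring

lemma exists_isAdm (hp : IsPhase ω ω' H R l ξ) (hw : IsWeight ω ω' H Γ κ h0 h1 θ CΓ)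
    {a b c : ℝ} (h : IsCoeff (κ + 1) R a b c) {T : EuclideanSpace ℝ (Fin N) → ℝ} {D L : ℝ}
    (hT : ContDiff ℝ 1 T) (hT0 : ∀ z, 0 ≤ T z) (hT1 : ∀ z, T z ≤ 1) (hD1 : D ≤ 1)
    (hTD : ∀ i z, |pd i T z| ≤ D) (hTL : ∀ z, 2 * L < ‖z‖ → T z = 0)
    (p : EuclideanSpace ℝ (Fin N)) {s0 : ℝ} (hs0 : 1 ≤ s0) (t1 t2 : ℝ) :
    ∃ C, IsAdm ξ (2 * L) t1 t2
      (fun z t => hk l p (s0 + θ * (t2 - t)) z * T z ^ 2 *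
        combKern H (κ + 1) a b c (z l) (ξ z t))
      (fun z t => balRate ω ω' θ l p (s0 + θ * (t2 - t)) T (fun y => ξ y t)
        (fun y => combKern H (κ + 1) a b c (y l) (ξ y t)) (expComb (κ + 1) a b) z) C := by
  obtain ⟨C0, hC0, hC⟩ := hw.exists_combKern_le R
  obtain ⟨Ck, hCk1, hCk⟩ := exists_hk_bounds l
  obtain ⟨C4, hC4, hrate⟩ := hp.exists_balRate_le hw
  have hθ := hw.θ_pos
  have hκ := hw.κ_pos
  have hTc : HasCompactSupport T := HasCompactSupport.intro (isCompact_closedBall 0 (2 * L))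
    fun z hz => hTL z (by simpa using hz)
  have hs (t) (ht : t ∈ Icc t1 t2) : 1 ≤ s0 + θ * (t2 - t) := by
    have := mul_nonneg hθ.le (sub_nonneg.2 ht.2); linarith
  have hgc := continuous_expComb (κ + 1) a b
  have hv1 (t) : ContDiff ℝ 1 fun z => ξ z t := (hp.space t).of_le (by norm_num)
  have hsd (t) : HasDerivAt (fun t => s0 + θ * (t2 - t)) (-θ) t := by
    simpa using (((hasDerivAt_id t).const_sub t2).const_mul θ).const_add s0
  have hKd (z) (t) (ht : t ∈ Icc t1 t2) : HasDerivAt (fun t => hk l p (s0 + θ * (t2 - t)) z)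
      (dk l p (s0 + θ * (t2 - t)) z * hk l p (s0 + θ * (t2 - t)) z * -θ) t :=
    (hasDerivAt_hk p z (by linarith [hs t ht])).comp t (hsd t)
  have hξd (z t) : HasDerivAt (ξ z) (deriv (ξ z) t) t :=
    ((hp.time z).differentiable one_ne_zero t).hasDerivAt
  have hmd (z t) : HasDerivAt (fun t => combKern H (κ + 1) a b c (z l) (ξ z t))
      (H (z l - ξ z t) * expComb (κ + 1) a b (ξ z t) * deriv (ξ z) t) t :=
    (hasDerivAt_combKern hw.contH (κ + 1) a b c (z l) (ξ z t)).comp t (hξd z t)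
  set M := C0 * (exp (2 * κ * (2 * L)) * ω 0) with hM
  have hM0 : 0 ≤ M := by have := hw.pos 0; positivity
  have hωM (z : EuclideanSpace ℝ (Fin N)) (hz : ‖z‖ ≤ 2 * L) : C0 * ω (z l) ≤ M := by
    refine mul_le_mul_of_nonneg_left ?_ hC0
    have := hw.le_shift 0 (-z l)
    rw [zero_sub, neg_neg, abs_neg] at this
    refine this.trans (mul_le_mul_of_nonneg_right (exp_le_exp.2 ?_) (hw.pos 0).le)
    exact mul_le_mul_of_nonneg_left ((abs_coord_le z l).trans hz) (by linarith)
  have hT2 (z) : T z ^ 2 ≤ 1 := by nlinarith [hT0 z, hT1 z]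
  have hdh (z s) (h1s : 1 ≤ s) : |dk l p s z * hk l p s z| ≤ Ck := by
    rw [abs_mul, abs_of_pos (hk_pos p s z)]
    have := mul_le_mul_of_nonneg_left (hk_le_one (l := l) p z (by linarith : 1 ≤ 2 * s))
      (by linarith : 0 ≤ Ck)
    linarith [(hCk p z s h1s).2.2.1]
  have hhk (z s) (h1s : 1 ≤ s) : |hk l p s z| ≤ 1 := by
    rw [abs_of_pos (hk_pos p s z)]; exact hk_le_one p z h1s
  have hout (z) (hz : 2 * L < ‖z‖) (t : ℝ) (m g) : balRate ω ω' θ l p (s0 + θ * (t2 - t)) T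
      (fun y => ξ y t) m g z = 0 := by
    rw [balRate, hTL z hz]; ring
  refine ⟨θ * Ck * M + M + C4 * C4 + C4, ?_, ?_, ?_, ?_, ?_, ?_, ?_, ?_, ?_, ?_⟩
  · intro t ht
    exact ((contDiff_hk (n := 1) (l := l) p _).continuous.mul (hT.continuous.pow 2)).mul
      (contDiff_combKern hw.contH _ a b c (hv1 t)).continuous
  · intro t ht
    exact continuous_balRate hw.continuous.1 hw.cont' hT.continuous (hp.space t)
      (contDiff_combKern hw.contH _ a b c (hv1 t)).continuous hgc θ p _
  · intro z t ht
    refine (((hKd z t ht).mul_const (T z ^ 2)).mul (hmd z t)).congr_deriv ?_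
    rw [hp.balRate_eq]; ring
  · intro z
    simp only [hp.balRate_eq]
    have c0 : ContinuousOn (fun t => s0 + θ * (t2 - t)) (Icc t1 t2) := by fun_prop
    have c1 : ContinuousOn (fun t => hk l p (s0 + θ * (t2 - t)) z) (Icc t1 t2) :=
      fun t ht => (hKd z t ht).continuousAt.continuousWithinAt
    have c2 : ContinuousOn (fun t => dk l p (s0 + θ * (t2 - t)) z) (Icc t1 t2) := by
      refine (continuousOn_const.div (continuousOn_const.mul (c0.pow 2)) fun t ht => ?_).sub
        (continuousOn_const.div (continuousOn_const.mul c0) fun t ht => ?_)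
      · have := zero_lt_one.trans_le (hs t ht)
        exact (mul_pos four_pos (pow_pos this 2)).ne'
      · have := zero_lt_one.trans_le (hs t ht)
        exact (mul_pos two_pos this).ne'
    have c3 : Continuous fun t => combKern H (κ + 1) a b c (z l) (ξ z t) :=
      continuous_iff_continuousAt.2 fun t => (hmd z t).continuousAt
    have c4 : Continuous (ξ z) := (hp.time z).continuous
    have c5 : Continuous (deriv (ξ z)) := (hp.time z).continuous_deriv le_rfl
    have c6 : Continuous fun t => H (z l - ξ z t) * expComb (κ + 1) a b (ξ z t) *
        deriv (ξ z) t :=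
      ((hw.contH.comp (continuous_const.sub c4)).mul (hgc.comp c4)).mul c5
    exact (continuousOn_const.mul ((continuousOn_const.mul (c2.mul c1)).mul c3.continuousOn)).add
      ((c1.mul continuousOn_const).mul c6.continuousOn)
  · intro z hz t ht
    simp only [hTL z hz]; ring
  · intro z hz t ht
    exact hout z hz t _ _
  · intro z t ht
    by_cases hz : ‖z‖ ≤ 2 * L
    · have b1 := ((hC a b c h (z l) _ (hp.bdd z t)).1).trans (hωM z hz)
      rw [abs_mul, abs_mul, abs_of_nonneg (sq_nonneg (T z))]
      have b2 := mul_le_mul (mul_le_mul (hhk z _ (hs t ht)) (hT2 z) (sq_nonneg _) zero_le_one) b1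
        (abs_nonneg _) (by norm_num)
      have : 0 ≤ θ * Ck * M := by positivity
      nlinarith
    · rw [hTL z (not_le.1 hz)]
      simp only [ne_eq, OfNat.ofNat_ne_zero, not_false_eq_true, zero_pow, mul_zero, zero_mul,
        abs_zero]
      positivity
  · intro z s hs' t ht
    by_cases hz : ‖z‖ ≤ 2 * L
    · have b1 := ((hC a b c h (z l) _ (hp.bdd z t)).1).trans (hωM z hz)
      have b2 : |hk l p (s0 + θ * (t2 - t)) z - hk l p (s0 + θ * (t2 - s)) z| ≤
          θ * Ck * |t - s| := by
        have := (convex_Icc t1 t2).norm_image_sub_le_of_norm_hasDerivWithin_le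
          (f := fun t => hk l p (s0 + θ * (t2 - t)) z) (C := θ * Ck)
          (fun u hu => (hKd z u hu).hasDerivWithinAt) (fun u hu => by
            rw [Real.norm_eq_abs, abs_mul, abs_neg, abs_of_pos hθ, mul_comm]
            exact mul_le_mul_of_nonneg_left (hdh z _ (hs u hu)) hθ.le) hs' ht
        simpa using this
      have b3 : |combKern H (κ + 1) a b c (z l) (ξ z t) -
          combKern H (κ + 1) a b c (z l) (ξ z s)| ≤ M * |ξ z t - ξ z s| := by
        have := (convex_Icc (-R) R).norm_image_sub_le_of_norm_hasDerivWithin_le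
          (f := combKern H (κ + 1) a b c (z l)) (C := M)
          (fun u _ => (hasDerivAt_combKern hw.contH (κ + 1) a b c (z l) u).hasDerivWithinAt)
          (fun u hu => ((hC a b c h (z l) u (abs_le.2 hu)).2.2.2.2).trans (hωM z hz))
          (abs_le.1 (hp.bdd z s)) (abs_le.1 (hp.bdd z t))
        simpa using this
      have e : hk l p (s0 + θ * (t2 - t)) z * T z ^ 2 * combKern H (κ + 1) a b c (z l) (ξ z t) -
          hk l p (s0 + θ * (t2 - s)) z * T z ^ 2 * combKern H (κ + 1) a b c (z l) (ξ z s) =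
          T z ^ 2 * ((hk l p (s0 + θ * (t2 - t)) z - hk l p (s0 + θ * (t2 - s)) z) *
            combKern H (κ + 1) a b c (z l) (ξ z t) + hk l p (s0 + θ * (t2 - s)) z *
            (combKern H (κ + 1) a b c (z l) (ξ z t) - combKern H (κ + 1) a b c (z l) (ξ z s))) := by
        ring
      rw [e, abs_mul, abs_of_nonneg (sq_nonneg (T z))]
      refine (mul_le_of_le_one_left (abs_nonneg _) (hT2 z)).trans ((abs_add_le _ _).trans ?_)
      rw [abs_mul, abs_mul]
      have b4 := mul_le_mul b2 b1 (abs_nonneg _) (by positivity)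
      have b5 := mul_le_mul (hhk z _ (hs s hs')) b3 (abs_nonneg _) zero_le_one
      have q1 : 0 ≤ (M + C4 * C4 + C4) * |t - s| := by positivity
      have q2 : 0 ≤ (θ * Ck * M + C4 * C4 + C4) * |ξ z t - ξ z s| := by positivity
      linarith
    · rw [hTL z (not_le.1 hz)]
      simp only [ne_eq, OfNat.ofNat_ne_zero, not_false_eq_true, zero_pow, mul_zero, zero_mul,
        sub_zero, abs_zero]
      positivity
  · intro z t ht
    by_cases hz : ‖z‖ ≤ 2 * L
    · obtain ⟨b1, -, -, -, b2⟩ := hC a b c h (z l) _ (hp.bdd z t)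
      replace b1 := b1.trans (hωM z hz)
      replace b2 := b2.trans (hωM z hz)
      have b3 := hdh z _ (hs t ht)
      have b4 := hhk z _ (hs t ht)
      have e : balRate ω ω' θ l p (s0 + θ * (t2 - t)) T (fun y => ξ y t)
          (fun y => combKern H (κ + 1) a b c (y l) (ξ y t)) (expComb (κ + 1) a b) z =
          T z ^ 2 * (-θ * ((dk l p (s0 + θ * (t2 - t)) z * hk l p (s0 + θ * (t2 - t)) z) *
            combKern H (κ + 1) a b c (z l) (ξ z t)) + hk l p (s0 + θ * (t2 - t)) z *
            ((H (z l - ξ z t) * expComb (κ + 1) a b (ξ z t)) * deriv (ξ z) t)) := by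
        rw [hp.balRate_eq]; ring
      rw [e, abs_mul, abs_of_nonneg (sq_nonneg (T z))]
      refine (mul_le_of_le_one_left (abs_nonneg _) (hT2 z)).trans ((abs_add_le _ _).trans ?_)
      rw [abs_mul, abs_mul (dk l p (s0 + θ * (t2 - t)) z * _), abs_neg, abs_of_pos hθ,
        abs_mul (hk l p _ z), abs_mul (_ * _) (deriv (ξ z) t)]
      have b5 := mul_le_mul_of_nonneg_left (mul_le_mul b3 b1 (abs_nonneg _) (by linarith)) hθ.le
      have b6 := mul_le_mul b4 (mul_le_mul_of_nonneg_right b2 (abs_nonneg (deriv (ξ z) t)))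
        (by positivity) zero_le_one
      have q1 : 0 ≤ (θ * Ck * M + C4 * C4 + C4) * |deriv (ξ z) t| := by positivity
      have q2 : 0 ≤ M + C4 * C4 + C4 := by positivity
      linarith
    · rw [hout z (not_le.1 hz) t, abs_zero]
      positivity
  · intro t ht
    have h1s := hs t ht
    obtain ⟨r1, r2⟩ := hrate a b c h T D hT hTc hT0 hT1 hD1 hTD p _ t h1s
    refine r1.trans ?_
    have a1 : 0 ≤ ∫ z, T z ^ 2 * hk l p (s0 + θ * (t2 - t)) z * ω (z l - ξ z t) *
        ∑ i, pd i (fun y => ξ y t) z ^ 2 := integral_nonneg fun z =>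
      mul_nonneg (mul_nonneg (mul_nonneg (sq_nonneg _) (hk_pos _ _ _).le) (hw.pos _).le)
        (Finset.sum_nonneg fun i _ => sq_nonneg _)
    have a2 : C4 / (s0 + θ * (t2 - t)) ^ 2 ≤ C4 := div_le_self hC4 (one_le_pow₀ h1s)
    have a3 := mul_le_mul a2 r2 (integral_nonneg fun z =>
      mul_nonneg (hk_pos _ _ _).le (mul_nonneg (hw.pos _).le (sq_nonneg _))) hC4
    have a4 := mul_le_mul_of_nonneg_right hD1 hC4
    have a5 := mul_nonneg (exp_pos (-((κ + 1) * R))).le a1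
    have q1 : 0 ≤ θ * Ck * M := by positivity
    linarith

end IsPhase

section Monotonicity

variable {N : ℕ} {l : Fin N}

/-- The heat average of the potential of the phase. -/
noncomputable def potAvg (H : ℝ → ℝ) (k a b c : ℝ) (l : Fin N)
    (ξ : EuclideanSpace ℝ (Fin N) → ℝ → ℝ) (p : EuclideanSpace ℝ (Fin N)) (s t : ℝ) : ℝ :=
  ∫ z, hk l p s z * combKern H k a b c (z l) (ξ z t)

/-- The heat average of the squared multiplier. -/
noncomputable def sqAvg (ω : ℝ → ℝ) (k a b : ℝ) (l : Fin N)
    (ξ : EuclideanSpace ℝ (Fin N) → ℝ → ℝ) (p : EuclideanSpace ℝ (Fin N)) (s t : ℝ) : ℝ :=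
  ∫ z, hk l p s z * (ω (z l - ξ z t) * expComb k a b (ξ z t) ^ 2)

/-- The weighted Dirichlet energy of the phase over a set. -/
noncomputable def dirEnergy (ω : ℝ → ℝ) (l : Fin N) (ξ : EuclideanSpace ℝ (Fin N) → ℝ → ℝ)
    (S : Set (EuclideanSpace ℝ (Fin N))) (p : EuclideanSpace ℝ (Fin N)) (s t : ℝ) : ℝ :=
  ∫ z in S, hk l p s z * ω (z l - ξ z t) * ∑ i, pd i (fun y => ξ y t) z ^ 2

namespace IsPhase

variable {ω ω' H Γ : ℝ → ℝ} {κ h0 h1 θ CΓ R : ℝ} {ξ : EuclideanSpace ℝ (Fin N) → ℝ → ℝ}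

lemma exists_localized_le (hp : IsPhase ω ω' H R l ξ) (hw : IsWeight ω ω' H Γ κ h0 h1 θ CΓ) :
    ∃ C, 0 ≤ C ∧ ∀ a b c, IsCoeff (κ + 1) R a b c → ∀ (T : EuclideanSpace ℝ (Fin N) → ℝ) (D L : ℝ),
      ContDiff ℝ 1 T → (∀ z, 0 ≤ T z) → (∀ z, T z ≤ 1) → D ≤ 1 → (∀ i z, |pd i T z| ≤ D) →
      (∀ z, 2 * L < ‖z‖ → T z = 0) → ∀ p s0 t1 t2, 1 ≤ s0 → t1 ≤ t2 → ∀ S d Q, MeasurableSet S →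
      (∀ z ∈ S, T z = 1) →
      (∀ t ∈ Icc t1 t2, d ≤ dirEnergy ω l ξ S p (s0 + θ * (t2 - t)) t) →
      (∀ s t, s0 ≤ s → sqAvg ω (κ + 1) a b l ξ p (2 * s) t ≤ Q) →
      (∫ z, hk l p s0 z * T z ^ 2 * combKern H (κ + 1) a b c (z l) (ξ z t2)) +
        exp (-((κ + 1) * R)) / 2 * d * (t2 - t1) ≤
      (∫ z, hk l p (s0 + θ * (t2 - t1)) z * T z ^ 2 * combKern H (κ + 1) a b c (z l) (ξ z t1)) +
        C * Q / s0 + D * C * (t2 - t1) := by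
  obtain ⟨C, hC, hrate⟩ := hp.exists_balRate_le hw
  have hθ := hw.θ_pos
  refine ⟨C + C / θ, by positivity, fun a b c h T D L hT hT0 hT1 hD1 hTD hTL p s0 t1 t2 hs0 ht S d
    Q hS hST hd hQ => ?_⟩
  have hTc : HasCompactSupport T := HasCompactSupport.intro (isCompact_closedBall 0 (2 * L))
    fun z hz => hTL z (by simpa using hz)
  obtain ⟨CA, hadm⟩ := hp.exists_isAdm hw h hT hT0 hT1 hD1 hTD hTL p hs0 t1 t2
  obtain ⟨h_int, hbal⟩ := hp.balanced (2 * L + 1) t1 t2 ht (2 * L) (by linarith) _ _ _ hadm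
  have hs (t) (ht : t ∈ Icc t1 t2) : s0 ≤ s0 + θ * (t2 - t) := by
    have := mul_nonneg hθ.le (sub_nonneg.2 ht.2); linarith
  have hD : 0 ≤ D := (abs_nonneg _).trans (hTD l 0)
  have hQ0 : 0 ≤ Q := (integral_nonneg fun z => mul_nonneg (hk_pos _ _ _).le
    (mul_nonneg (hw.pos _).le (sq_nonneg _))).trans (hQ s0 t1 le_rfl)
  set e := exp (-((κ + 1) * R)) with he
  have he0 : 0 < e := exp_pos _
  have hsd (t) : HasDerivAt (fun t => s0 + θ * (t2 - t)) (-θ) t := by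
    simpa using (((hasDerivAt_id t).const_sub t2).const_mul θ).const_add s0
  have hF (t) (ht : t ∈ uIcc t1 t2) :
      HasDerivAt (fun t => (-(e / 2) * d + D * C) * t + C * Q / θ * (s0 + θ * (t2 - t))⁻¹)
        (-(e / 2) * d + D * C + C / (s0 + θ * (t2 - t)) ^ 2 * Q) t := by
    rw [uIcc_of_le ‹_›] at ht
    have hpos : 0 < s0 + θ * (t2 - t) := by linarith [hs t ht]
    refine (((hasDerivAt_id t).const_mul _).add (((hsd t).inv hpos.ne').const_mul _)).congr_deriv ?_
    field_simp
  have hcont : ContinuousOn (fun t => -(e / 2) * d + D * C + C / (s0 + θ * (t2 - t)) ^ 2 * Q)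
      (uIcc t1 t2) := by
    rw [uIcc_of_le ht]
    refine continuousOn_const.add ((continuousOn_const.div (by fun_prop) fun t ht => ?_).mul
      continuousOn_const)
    exact (pow_pos (by linarith [hs t ht] : 0 < s0 + θ * (t2 - t)) 2).ne'
  have hint2 := hcont.intervalIntegrable (μ := volume)
  have hI := intervalIntegral.integral_eq_sub_of_hasDerivAt hF hint2
  have hmono := intervalIntegral.integral_mono_on ht h_int hint2 fun t htt => by
    obtain ⟨r1, -⟩ := hrate a b c h T D hT hTc hT0 hT1 hD1 hTD p _ t (hs0.trans (hs t htt))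
    refine r1.trans ?_
    have hnn (z : EuclideanSpace ℝ (Fin N)) : 0 ≤ T z ^ 2 * hk l p (s0 + θ * (t2 - t)) z *
        ω (z l - ξ z t) * ∑ i, pd i (fun y => ξ y t) z ^ 2 :=
      mul_nonneg (mul_nonneg (mul_nonneg (sq_nonneg _) (hk_pos _ _ _).le) (hw.pos _).le)
        (Finset.sum_nonneg fun i _ => sq_nonneg _)
    have hv1 : ContDiff ℝ 1 fun z => ξ z t := (hp.space t).of_le (by norm_num)
    have hic : Integrable fun z => T z ^ 2 * hk l p (s0 + θ * (t2 - t)) z * ω (z l - ξ z t) *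
        ∑ i, pd i (fun y => ξ y t) z ^ 2 := by
      refine Continuous.integrable_of_hasCompactSupport ?_ (hTc.mono fun z hz => ?_)
      · exact (((hT.continuous.pow 2).mul (contDiff_hk (n := 1) (l := l) p _).continuous).mul
          (hw.continuous.1.comp ((contDiff_coord (n := 1) l).continuous.sub hv1.continuous))).mul
          (continuous_finsetSum _ fun i _ => (continuous_pd hv1 i).pow 2)
      · rw [Function.mem_support] at hz ⊢
        contrapose! hz
        simp [hz]
    have hd2 : d ≤ ∫ z, T z ^ 2 * hk l p (s0 + θ * (t2 - t)) z * ω (z l - ξ z t) *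
        ∑ i, pd i (fun y => ξ y t) z ^ 2 := by
      refine (hd t htt).trans (le_trans (le_of_eq ?_)
        (setIntegral_le_integral hic (ae_of_all _ hnn) (s := S)))
      exact setIntegral_congr_fun hS fun z hz => by simp [hST z hz]
    have q1 := mul_le_mul_of_nonneg_left hd2 he0.le
    have q2 := mul_le_mul_of_nonneg_left (hQ _ t (hs t htt))
      (by positivity : 0 ≤ C / (s0 + θ * (t2 - t)) ^ 2)
    unfold sqAvg at q2
    linarith
  rw [hI] at hmono
  have hs1 : 0 < s0 + θ * (t2 - t1) := by linarith [hs t1 (left_mem_Icc.2 ht)]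
  simp only [sub_self, mul_zero, add_zero] at hbal hmono
  have q1 : 0 ≤ C * Q / θ * (s0 + θ * (t2 - t1))⁻¹ := by positivity
  have q2 : C * Q / θ * s0⁻¹ = C / θ * Q / s0 := by field_simp
  have q3 : (C + C / θ) * Q / s0 = C * Q / s0 + C / θ * Q / s0 := by ring
  have q4 : 0 ≤ C * Q / s0 := by positivity
  have q5 : 0 ≤ D * (C / θ) * (t2 - t1) := by
    have := sub_nonneg.2 ht; positivity
  rw [q3]
  linarith

lemma integrable_potAvg (hp : IsPhase ω ω' H R l ξ) (hw : IsWeight ω ω' H Γ κ h0 h1 θ CΓ)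
    {a b c : ℝ} (h : IsCoeff (κ + 1) R a b c) (p : EuclideanSpace ℝ (Fin N)) {s : ℝ} (hs : 0 < s)
    (t : ℝ) : Integrable fun z => hk l p s z * combKern H (κ + 1) a b c (z l) (ξ z t) := by
  obtain ⟨C0, hC0, hC⟩ := hw.exists_combKern_le R
  have hv1 : ContDiff ℝ 1 fun z => ξ z t := (hp.space t).of_le (by norm_num)
  refine ((hk_mul_integrable (l := l) p hs hw.integrable).1.const_mul C0).mono'
    ((contDiff_hk (n := 1) (l := l) p s).continuous.mul
      (contDiff_combKern hw.contH _ a b c hv1).continuous).aestronglyMeasurable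
    (ae_of_all _ fun z => ?_)
  rw [norm_mul, Real.norm_of_nonneg (hk_pos _ _ _).le]
  have := mul_le_mul_of_nonneg_left (hC a b c h (z l) _ (hp.bdd z t)).1 (hk_pos (l := l) p s z).le
  rw [Real.norm_eq_abs]
  linarith

/-- Approximate monotonicity of the heat averages along backward heat flow, with the dissipated
energy. -/
theorem exists_monotone (hp : IsPhase ω ω' H R l ξ) (hw : IsWeight ω ω' H Γ κ h0 h1 θ CΓ) :
    ∃ C, 0 ≤ C ∧ ∀ a b c, IsCoeff (κ + 1) R a b c → ∀ p s0 t1 t2, 1 ≤ s0 → t1 ≤ t2 →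
      ∀ S d Q, MeasurableSet S → Bornology.IsBounded S →
      (∀ t ∈ Icc t1 t2, d ≤ dirEnergy ω l ξ S p (s0 + θ * (t2 - t)) t) →
      (∀ s t, s0 ≤ s → sqAvg ω (κ + 1) a b l ξ p (2 * s) t ≤ Q) →
      potAvg H (κ + 1) a b c l ξ p s0 t2 + exp (-((κ + 1) * R)) / 2 * d * (t2 - t1) ≤
      potAvg H (κ + 1) a b c l ξ p (s0 + θ * (t2 - t1)) t1 + C * Q / s0 := by
  obtain ⟨C, hC, hloc⟩ := hp.exists_localized_le hw
  obtain ⟨CT, hCT, hcut⟩ := exists_scaled_cutoff N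
  refine ⟨C, hC, fun a b c h p s0 t1 t2 hs0 ht S d Q hS hSb hd hQ => ?_⟩
  obtain ⟨ρ, hρ⟩ := hSb.subset_closedBall 0
  set L : ℕ → ℝ := fun n => n + (1 + |CT| + |ρ|) with hL
  have hL1 (n) : 1 ≤ L n ∧ CT ≤ L n ∧ ρ ≤ L n := by
    have h0 : (0 : ℝ) ≤ n := n.cast_nonneg
    have h1 := le_abs_self CT
    have h2 := le_abs_self ρ
    have h3 := abs_nonneg CT
    have h4 := abs_nonneg ρ
    refine ⟨?_, ?_, ?_⟩ <;> simp only [hL] <;> linarith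
  have hLt : Tendsto L atTop atTop := tendsto_atTop_add_const_right _ _ tendsto_natCast_atTop_atTop
  choose T hT hT0 hT1 hTL hTL2 hTD using fun n => hcut (L n) (hL1 n).1
  have hlim (s t) (hs : 0 < s) : Tendsto (fun n => ∫ z, hk l p s z * T n z ^ 2 *
      combKern H (κ + 1) a b c (z l) (ξ z t)) atTop (nhds (potAvg H (κ + 1) a b c l ξ p s t)) := by
    have hi := hp.integrable_potAvg hw h p hs t
    have hv1 : ContDiff ℝ 1 fun z => ξ z t := (hp.space t).of_le (by norm_num)
    refine tendsto_integral_of_dominated_convergence _ (fun n => ?_) hi.norm (fun n => ?_) ?_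
    · exact (((contDiff_hk (n := 1) (l := l) p s).continuous.mul ((hT n).continuous.pow 2)).mul
        (contDiff_combKern hw.contH _ a b c hv1).continuous).aestronglyMeasurable
    · refine ae_of_all _ fun z => ?_
      rw [norm_mul, norm_mul, norm_mul]
      refine mul_le_mul_of_nonneg_right (mul_le_of_le_one_right (norm_nonneg _) ?_) (norm_nonneg _)
      rw [Real.norm_of_nonneg (sq_nonneg _)]
      exact pow_le_one₀ (hT0 n z) (hT1 n z)
    · refine ae_of_all _ fun z => tendsto_const_nhds.congr' ?_
      filter_upwards [hLt.eventually_ge_atTop ‖z‖] with n hn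
      rw [hTL n z hn]; ring
  have hs1 : 0 < s0 + θ * (t2 - t1) := by
    have := mul_nonneg hw.θ_pos.le (sub_nonneg.2 ht); linarith
  have hD0 : Tendsto (fun n => CT / L n * C * (t2 - t1)) atTop (nhds (0 * C * (t2 - t1))) :=
    ((tendsto_const_nhds.div_atTop hLt).mul_const _).mul_const _
  rw [zero_mul, zero_mul] at hD0
  have hl := (hlim s0 t2 (by linarith)).add_const (exp (-((κ + 1) * R)) / 2 * d * (t2 - t1))
  have hr := ((hlim _ t1 hs1).add_const (C * Q / s0)).add hD0
  rw [add_zero] at hr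
  refine le_of_tendsto_of_tendsto' hl hr fun n => ?_
  refine hloc a b c h (T n) (CT / L n) (L n) (hT n) (hT0 n) (hT1 n) ?_ (hTD n) (hTL2 n) p s0 t1 t2
    hs0 ht S d Q hS (fun z hz => hTL n z ?_) hd hQ
  · exact div_le_one_of_le₀ (hL1 n).2.1 (by linarith [(hL1 n).1])
  · have := hρ hz
    rw [mem_closedBall_zero_iff] at this
    exact this.trans (hL1 n).2.2

end IsPhase

end Monotonicity

theorem lintegral_comp_smul_add {N : ℕ} {G : EuclideanSpace ℝ (Fin N) → ENNReal}
    (hG : Measurable G) {r : ℝ} (hr : 0 < r) (y : EuclideanSpace ℝ (Fin N)) :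
    ∫⁻ x, G (r • x + y) = ENNReal.ofReal ((r ^ N)⁻¹) * ∫⁻ x, G x := by
  have h1 : ∫⁻ x, G (r • x + y) = ∫⁻ x, G (x + y)
      ∂(Measure.map (fun x : EuclideanSpace ℝ (Fin N) => r • x) volume) := by
    rw [lintegral_map (by fun_prop) (by fun_prop)]
  rw [h1, Measure.map_addHaar_smul volume hr.ne', lintegral_smul_measure, finrank_euclideanSpace,
    Fintype.card_fin, abs_of_nonneg (by positivity), lintegral_add_right_eq_self]
  rfl

theorem setLIntegral_segment_le {N : ℕ} {Q : Set (EuclideanSpace ℝ (Fin N))} (hQ : Convex ℝ Q)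
    (hQm : MeasurableSet Q) {G : EuclideanSpace ℝ (Fin N) → ENNReal} (hG : Measurable G)
    {r : ℝ} (hr : 1 / 2 ≤ r) (hr1 : r ≤ 1) {y : EuclideanSpace ℝ (Fin N)} (hy : y ∈ Q) :
    ∫⁻ x in Q, G (r • x + (1 - r) • y) ≤ 2 ^ N * ∫⁻ x in Q, G x := by
  have hr0 : 0 < r := by linarith
  calc ∫⁻ x in Q, G (r • x + (1 - r) • y)
      ≤ ∫⁻ x, Q.indicator G (r • x + (1 - r) • y) := by
        rw [← lintegral_indicator hQm]
        refine lintegral_mono fun x => ?_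
        by_cases hx : x ∈ Q
        · rw [indicator_of_mem hx, indicator_of_mem
            (hQ hx hy hr0.le (by linarith) (by ring))]
        · rw [indicator_of_notMem hx]
          exact zero_le
    _ = ENNReal.ofReal ((r ^ N)⁻¹) * ∫⁻ x in Q, G x := by
        rw [lintegral_comp_smul_add (hG.indicator hQm) hr0, lintegral_indicator hQm]
    _ ≤ _ := by
        gcongr
        have : ENNReal.ofReal ((2:ℝ) ^ N) = 2 ^ N := by
          rw [ENNReal.ofReal_pow (by norm_num)]
          simp
        rw [← this]
        apply ENNReal.ofReal_le_ofReal
        rw [← inv_pow]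
        gcongr
        rw [inv_le_comm₀ hr0 (by norm_num)]
        linarith

theorem setLIntegral_segment_segment_le {N : ℕ} {Q : Set (EuclideanSpace ℝ (Fin N))}
    (hQ : Convex ℝ Q) (hQm : MeasurableSet Q) {G : EuclideanSpace ℝ (Fin N) → ENNReal}
    (hG : Measurable G) {r : ℝ} (hr0 : 0 ≤ r) (hr1 : r ≤ 1) :
    ∫⁻ y in Q, ∫⁻ x in Q, G (y + r • (x - y)) ≤ volume Q * (2 ^ N * ∫⁻ x in Q, G x) := by
  have he : ∀ x y : EuclideanSpace ℝ (Fin N), y + r • (x - y) = r • x + (1 - r) • y := by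
    intro x y
    module
  have hconst : ∫⁻ _ in Q, (2 ^ N * ∫⁻ x in Q, G x) = volume Q * (2 ^ N * ∫⁻ x in Q, G x) := by
    rw [setLIntegral_const, mul_comm]
  rw [← hconst]
  by_cases h : 1 / 2 ≤ r
  · refine setLIntegral_mono' hQm fun y hy => ?_
    simp_rw [he]
    exact setLIntegral_segment_le hQ hQm hG h hr1 hy
  · rw [lintegral_lintegral_swap (by
      refine Measurable.aemeasurable ?_
      change Measurable (fun q : EuclideanSpace ℝ (Fin N) × EuclideanSpace ℝ (Fin N) =>
        G (q.1 + r • (q.2 - q.1)))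
      fun_prop)]
    refine setLIntegral_mono' hQm fun y hy => ?_
    have := setLIntegral_segment_le hQ hQm hG (r := 1 - r) (by linarith) (by linarith) hy
    refine le_trans (le_of_eq ?_) this
    refine lintegral_congr fun x => ?_
    rw [he]
    congr 1
    rw [sub_sub_cancel, add_comm]

theorem sq_fderiv_le {N : ℕ} (v : EuclideanSpace ℝ (Fin N) → ℝ) (z u : EuclideanSpace ℝ (Fin N)) :
    (fderiv ℝ v z u) ^ 2 ≤ ‖u‖ ^ 2 * ∑ i, pd i v z ^ 2 := by
  have hu : u = ∑ i, u i • EuclideanSpace.single i (1:ℝ) := by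
    ext j
    simp [Pi.single_apply]
  have h1 : fderiv ℝ v z u = ∑ i, u i * pd i v z := by
    conv_lhs => rw [hu]
    rw [map_sum]
    exact Finset.sum_congr rfl fun i _ => by rw [map_smul]; rfl
  rw [h1, EuclideanSpace.norm_sq_eq]
  simp only [Real.norm_eq_abs, sq_abs]
  exact Finset.sum_mul_sq_le_sq_mul_sq _ _ _

theorem sq_intervalIntegral_le {g : ℝ → ℝ} (hg : Continuous g) :
    (∫ t in (0:ℝ)..1, g t) ^ 2 ≤ ∫ t in (0:ℝ)..1, g t ^ 2 := by
  set A := ∫ t in (0:ℝ)..1, g t with hA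
  have h0 : 0 ≤ ∫ t in (0:ℝ)..1, (g t - A) ^ 2 :=
    intervalIntegral.integral_nonneg (by norm_num) fun t _ => sq_nonneg _
  have h1 : ∫ t in (0:ℝ)..1, (g t - A) ^ 2
      = (∫ t in (0:ℝ)..1, g t ^ 2) - 2 * A * A + A ^ 2 := by
    have : ∀ t, (g t - A) ^ 2 = g t ^ 2 - 2 * A * g t + A ^ 2 := fun t => by ring
    simp_rw [this]
    rw [intervalIntegral.integral_add ((by fun_prop : Continuous _).intervalIntegrable _ _)
      ((by fun_prop : Continuous _).intervalIntegrable _ _),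
      intervalIntegral.integral_sub ((by fun_prop : Continuous _).intervalIntegrable _ _)
      ((by fun_prop : Continuous _).intervalIntegrable _ _),
      intervalIntegral.integral_const_mul, ← hA]
    simp
  nlinarith

theorem sq_sub_le_integral_segment {N : ℕ} {v : EuclideanSpace ℝ (Fin N) → ℝ}
    (hv : ContDiff ℝ 1 v) (x y : EuclideanSpace ℝ (Fin N)) :
    (v x - v y) ^ 2 ≤ ‖x - y‖ ^ 2 * ∫ t in (0:ℝ)..1, ∑ i, pd i v (y + t • (x - y)) ^ 2 := by
  have hG : Continuous fun z => ∑ i, pd i v z ^ 2 :=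
    continuous_finsetSum _ fun i _ => (continuous_pd hv i).pow 2
  have hfd : Continuous (fderiv ℝ v) := hv.continuous_fderiv (by norm_num)
  have hγ : Continuous fun t : ℝ => y + t • (x - y) := by fun_prop
  have hd : ∀ t : ℝ, HasDerivAt (fun t : ℝ => v (y + t • (x - y)))
      (fderiv ℝ v (y + t • (x - y)) (x - y)) t := by
    intro t
    have h1 : HasDerivAt (fun t : ℝ => y + t • (x - y)) (x - y) t := by
      simpa using ((hasDerivAt_id t).smul_const (x - y)).const_add y
    exact ((hv.differentiable (by norm_num)) _).hasFDerivAt.comp_hasDerivAt t h1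
  have hc : Continuous fun t : ℝ => fderiv ℝ v (y + t • (x - y)) (x - y) :=
    (hfd.comp hγ).clm_apply continuous_const
  have h_int := intervalIntegral.integral_eq_sub_of_hasDerivAt (a := 0) (b := 1)
    (fun t _ => hd t) (hc.intervalIntegrable _ _)
  have h_int' : ∫ t in (0:ℝ)..1, fderiv ℝ v (y + t • (x - y)) (x - y) = v x - v y := by
    rw [h_int]
    simp
  rw [← h_int', ← intervalIntegral.integral_const_mul]
  refine (sq_intervalIntegral_le hc).trans ?_
  refine intervalIntegral.integral_mono_on (by norm_num) ((hc.pow 2).intervalIntegrable _ _)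
    ((continuous_const.mul (hG.comp hγ)).intervalIntegrable _ _) fun t _ => sq_fderiv_le _ _ _

/-- A Poincaré inequality on convex sets, with one of the values of the function in place of
its mean. -/
theorem exists_integral_sq_sub_le {N : ℕ} {Q : Set (EuclideanSpace ℝ (Fin N))} (hQ : Convex ℝ Q)
    (hQm : MeasurableSet Q) (hQb : Bornology.IsBounded Q) (hQ0 : volume Q ≠ 0) {d : ℝ}
    (hd : ∀ x ∈ Q, ∀ y ∈ Q, ‖x - y‖ ≤ d) {v : EuclideanSpace ℝ (Fin N) → ℝ}
    (hv : ContDiff ℝ 1 v) :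
    ∃ y ∈ Q, ∫ x in Q, (v x - v y) ^ 2 ≤ d ^ 2 * 2 ^ N * ∫ x in Q, ∑ i, pd i v x ^ 2 := by
  have hQt : volume Q ≠ ⊤ := hQb.measure_lt_top.ne
  have hG : Continuous fun z => ∑ i, pd i v z ^ 2 :=
    continuous_finsetSum _ fun i _ => (continuous_pd hv i).pow 2
  have hvc := hv.continuous
  have hio : ∀ h : EuclideanSpace ℝ (Fin N) → ℝ, Continuous h → IntegrableOn h Q := fun h hh =>
    (hh.continuousOn.integrableOn_compact hQb.isCompact_closure).mono_set subset_closure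
  set g : EuclideanSpace ℝ (Fin N) → ENNReal := fun z => ENNReal.ofReal (∑ i, pd i v z ^ 2)
    with hg
  have hgm : Measurable g := (ENNReal.continuous_ofReal.comp hG).measurable
  have hpt : ∀ x ∈ Q, ∀ y ∈ Q, ENNReal.ofReal ((v x - v y) ^ 2)
      ≤ ENNReal.ofReal (d ^ 2) * ∫⁻ t in Ioc (0:ℝ) 1, g (y + t • (x - y)) := by
    intro x hx y hy
    have hcc : Continuous fun t : ℝ => ∑ i, pd i v (y + t • (x - y)) ^ 2 :=
      hG.comp (by fun_prop : Continuous fun t : ℝ => y + t • (x - y))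
    have hlin : ∫⁻ t in Ioc (0:ℝ) 1, g (y + t • (x - y)) =
        ENNReal.ofReal (∫ t in Ioc (0:ℝ) 1, ∑ i, pd i v (y + t • (x - y)) ^ 2) :=
      (ofReal_integral_eq_lintegral_ofReal
        (f := fun t : ℝ => ∑ i, pd i v (y + t • (x - y)) ^ 2) ((hcc.intervalIntegrable 0 1).1)
        (ae_of_all _ fun t => Finset.sum_nonneg fun i _ => sq_nonneg _)).symm
    rw [hlin, ← ENNReal.ofReal_mul (sq_nonneg _)]
    apply ENNReal.ofReal_le_ofReal
    refine (sq_sub_le_integral_segment hv x y).trans ?_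
    rw [intervalIntegral.integral_of_le (by norm_num)]
    have hd' : ‖x - y‖ ^ 2 ≤ d ^ 2 := pow_le_pow_left₀ (norm_nonneg _) (hd x hx y hy) 2
    exact mul_le_mul_of_nonneg_right hd' (integral_nonneg fun t =>
      (Finset.sum_nonneg fun i _ => sq_nonneg _ :
        (0:ℝ) ≤ ∑ i, pd i v (y + t • (x - y)) ^ 2))
  set F : EuclideanSpace ℝ (Fin N) → ENNReal :=
    fun y => ∫⁻ x in Q, ENNReal.ofReal ((v x - v y) ^ 2) with hF
  have hFm : Measurable F := by
    refine Measurable.lintegral_prod_left' (f := fun q : EuclideanSpace ℝ (Fin N) ×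
      EuclideanSpace ℝ (Fin N) => ENNReal.ofReal ((v q.1 - v q.2) ^ 2)) ?_
    exact (ENNReal.continuous_ofReal.comp (by fun_prop :
      Continuous fun q : EuclideanSpace ℝ (Fin N) × EuclideanSpace ℝ (Fin N) =>
        (v q.1 - v q.2) ^ 2)).measurable
  have hFle : ∫⁻ y in Q, F y ≤ ENNReal.ofReal (d ^ 2) *
      (volume Q * (2 ^ N * ∫⁻ x in Q, g x)) := by
    calc ∫⁻ y in Q, F y
        ≤ ∫⁻ y in Q, ∫⁻ x in Q, ENNReal.ofReal (d ^ 2) *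
            ∫⁻ t in Ioc (0:ℝ) 1, g (y + t • (x - y)) :=
          setLIntegral_mono' hQm fun y hy => setLIntegral_mono' hQm fun x hx => hpt x hx y hy
      _ = ENNReal.ofReal (d ^ 2) * ∫⁻ y in Q, ∫⁻ x in Q,
            ∫⁻ t in Ioc (0:ℝ) 1, g (y + t • (x - y)) := by
          rw [← lintegral_const_mul' _ _ ENNReal.ofReal_ne_top]
          refine lintegral_congr fun y => ?_
          rw [lintegral_const_mul' _ _ ENNReal.ofReal_ne_top]
      _ = ENNReal.ofReal (d ^ 2) * ∫⁻ t in Ioc (0:ℝ) 1, ∫⁻ y in Q, ∫⁻ x in Q,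
            g (y + t • (x - y)) := by
          congr 1
          have h1 : ∀ y, ∫⁻ x in Q, ∫⁻ t in Ioc (0:ℝ) 1, g (y + t • (x - y))
              = ∫⁻ t in Ioc (0:ℝ) 1, ∫⁻ x in Q, g (y + t • (x - y)) := by
            intro y
            refine lintegral_lintegral_swap (Measurable.aemeasurable ?_)
            refine hgm.comp (Continuous.measurable ?_)
            fun_prop
          simp_rw [h1]
          refine lintegral_lintegral_swap (Measurable.aemeasurable ?_)
          refine Measurable.lintegral_prod_right' (f := fun q : (EuclideanSpace ℝ (Fin N) × ℝ) ×
            EuclideanSpace ℝ (Fin N) => g (q.1.1 + q.1.2 • (q.2 - q.1.1))) ?_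
          refine hgm.comp (Continuous.measurable ?_)
          fun_prop
      _ ≤ ENNReal.ofReal (d ^ 2) * ∫⁻ _ in Ioc (0:ℝ) 1,
            (volume Q * (2 ^ N * ∫⁻ x in Q, g x)) := by
          gcongr 1
          exact setLIntegral_mono' measurableSet_Ioc fun t ht =>
            setLIntegral_segment_segment_le hQ hQm hgm ht.1.le ht.2
      _ = _ := by simp
  obtain ⟨y, hy, hle⟩ := exists_le_setLAverage hQ0 hQt hFm.aemeasurable.restrict
  refine ⟨y, hy, ?_⟩
  have h1 : F y ≤ ENNReal.ofReal (d ^ 2) * (2 ^ N * ∫⁻ x in Q, g x) := by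
    refine hle.trans ?_
    rw [setLAverage_eq]
    refine ENNReal.div_le_of_le_mul (hFle.trans (le_of_eq ?_))
    ring
  have h2 : F y = ENNReal.ofReal (∫ x in Q, (v x - v y) ^ 2) := by
    rw [ofReal_integral_eq_lintegral_ofReal (hio _ (by fun_prop))
      (ae_of_all _ fun x => sq_nonneg _)]
  have h3 : ∫⁻ x in Q, g x = ENNReal.ofReal (∫ x in Q, ∑ i, pd i v x ^ 2) := by
    rw [ofReal_integral_eq_lintegral_ofReal (hio _ hG)
      (ae_of_all _ fun x => Finset.sum_nonneg fun i _ => sq_nonneg _)]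
  have h4 : (2:ENNReal) ^ N = ENNReal.ofReal (2 ^ N) := by
    rw [ENNReal.ofReal_pow (by norm_num)]
    simp
  have hI0 : 0 ≤ ∫ x in Q, ∑ i, pd i v x ^ 2 :=
    integral_nonneg fun x => Finset.sum_nonneg fun i _ => sq_nonneg _
  rw [h2, h3, h4, ← ENNReal.ofReal_mul (by positivity), ← ENNReal.ofReal_mul (by positivity),
    ENNReal.ofReal_le_ofReal_iff (by positivity)] at h1
  linarith

section TangentialBox

variable {N : ℕ} {l : Fin N}

/-- A box of size `r * √σ` in the tangential directions and `r` in the normal direction. -/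
def tbox (l : Fin N) (p : EuclideanSpace ℝ (Fin N)) (r σ : ℝ) : Set (EuclideanSpace ℝ (Fin N)) :=
  {z | (∀ i, i ≠ l → |z i - p i| ≤ r * √σ) ∧ |z l| ≤ r}

variable {p : EuclideanSpace ℝ (Fin N)} {r σ : ℝ}

lemma convex_tbox : Convex ℝ (tbox l p r σ) := by
  have key {x y c A a b : ℝ} (hx : |x - c| ≤ A) (hy : |y - c| ≤ A) (ha : 0 ≤ a) (hb : 0 ≤ b)
      (hab : a + b = 1) : |a * x + b * y - c| ≤ A := by
    rw [abs_le] at *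
    have hc : c = a * c + b * c := by rw [← add_mul, hab, one_mul]
    have hA : A = a * A + b * A := by rw [← add_mul, hab, one_mul]
    constructor <;> nlinarith [mul_le_mul_of_nonneg_left hx.1 ha, mul_le_mul_of_nonneg_left hx.2 ha,
      mul_le_mul_of_nonneg_left hy.1 hb, mul_le_mul_of_nonneg_left hy.2 hb]
  intro x hx y hy a b ha hb hab
  refine ⟨fun i hi => ?_, ?_⟩
  · simpa using key (hx.1 i hi) (hy.1 i hi) ha hb hab
  · simpa using key (c := 0) (by simpa using hx.2) (by simpa using hy.2) ha hb hab

lemma measurableSet_tbox : MeasurableSet (tbox l p r σ) := by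
  refine IsClosed.measurableSet ?_
  have : tbox l p r σ = (⋂ i, ⋂ (_ : i ≠ l), {z | |z i - p i| ≤ r * √σ}) ∩ {z | |z l| ≤ r} := by
    ext z
    simp [tbox]
  rw [this]
  refine (isClosed_iInter fun i => isClosed_iInter fun _ => ?_).inter ?_
  · exact isClosed_le (by fun_prop) continuous_const
  · exact isClosed_le (by fun_prop) continuous_const

lemma norm_sub_le_of_mem_tbox (hσ : 1 ≤ σ) {x y : EuclideanSpace ℝ (Fin N)}
    (hx : x ∈ tbox l p r σ) (hy : y ∈ tbox l p r σ) : ‖x - y‖ ≤ √(N * (4 * r ^ 2 * σ)) := by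
  refine Real.le_sqrt_of_sq_le ?_
  rw [EuclideanSpace.norm_sq_eq]
  have hr : 0 ≤ r := (abs_nonneg _).trans hx.2
  have hs : √σ ^ 2 = σ := Real.sq_sqrt (by linarith)
  have key : ∀ i, ‖(x - y) i‖ ^ 2 ≤ 4 * r ^ 2 * σ := by
    intro i
    have h4 : 4 * r ^ 2 * σ = (2 * (r * √σ)) ^ 2 := by rw [mul_pow, mul_pow, hs]; ring
    rw [h4]
    refine pow_le_pow_left₀ (norm_nonneg _) ?_ 2
    rw [Real.norm_eq_abs, PiLp.sub_apply]
    by_cases hi : i = l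
    · subst hi
      have h1 : 1 ≤ √σ := Real.one_le_sqrt.2 hσ
      have h2 := abs_sub (x i) (y i)
      have := hx.2
      have := hy.2
      nlinarith
    · have h1 := abs_sub_le (x i) (p i) (y i)
      have := hx.1 i hi
      have := hy.1 i hi
      rw [abs_sub_comm (p i)] at h1
      linarith
  refine (Finset.sum_le_sum fun i _ => key i).trans ?_
  simp

lemma isBounded_tbox (hσ : 1 ≤ σ) : Bornology.IsBounded (tbox l p r σ) := by
  rw [Metric.isBounded_iff]
  exact ⟨_, fun x hx y hy => by rw [dist_eq_norm]; exact norm_sub_le_of_mem_tbox hσ hx hy⟩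

lemma volume_tbox_ne_zero (hr : 0 < r) (hσ : 1 ≤ σ) : volume (tbox l p r σ) ≠ 0 := by
  set q : EuclideanSpace ℝ (Fin N) := p - (p l) • EuclideanSpace.single l (1:ℝ) with hq
  refine (lt_of_lt_of_le (Metric.measure_ball_pos volume q hr) (measure_mono fun z hz => ?_)).ne'
  have hz : ‖z - q‖ < r := by rwa [Metric.mem_ball, dist_eq_norm] at hz
  have hs : 1 ≤ √σ := Real.one_le_sqrt.2 hσ
  refine ⟨fun i hi => ?_, ?_⟩
  · have h1 := abs_coord_le (z - q) i
    have h2 : (z - q) i = z i - p i := by simp [hq, hi]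
    rw [h2] at h1
    nlinarith
  · have h1 := abs_coord_le (z - q) l
    have h2 : (z - q) l = z l := by simp [hq]
    rw [h2] at h1
    linarith

lemma le_hk_of_mem_tbox (hσ : 1 ≤ σ) {s : ℝ} (hs : σ / 2 ≤ s) (hs' : s ≤ 3 * σ)
    {z : EuclideanSpace ℝ (Fin N)} (hz : z ∈ tbox l p r σ) :
    exp (-(tdim l * r ^ 2 / 2) - tdim l / 2 * log 3) * exp (-(tdim l / 2 * log σ)) ≤
      hk l p s z := by
  have hn := tdim_nonneg (l := l)
  have hs0 : 0 < s := by linarith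
  have htsq : tsq l p z ≤ tdim l * (r ^ 2 * σ) := by
    rw [tsq, tdim, ← nsmul_eq_mul]
    refine Finset.sum_le_card_nsmul _ _ _ fun i hi => ?_
    have h1 := hz.1 i (Finset.ne_of_mem_erase hi)
    calc (z i - p i) ^ 2 = |z i - p i| ^ 2 := (sq_abs _).symm
      _ ≤ (r * √σ) ^ 2 := pow_le_pow_left₀ (abs_nonneg _) h1 2
      _ = _ := by rw [mul_pow, Real.sq_sqrt (by linarith)]
  rw [hk, ← exp_add]
  refine exp_le_exp.2 ?_
  have hlog : log s ≤ log 3 + log σ := by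
    rw [← log_mul (by norm_num) (by linarith)]
    exact log_le_log hs0 hs'
  have h2 : tsq l p z / (4 * s) ≤ tdim l * r ^ 2 / 2 := by
    rw [div_le_div_iff₀ (by positivity) (by norm_num)]
    have h3 : 0 ≤ tdim l * r ^ 2 := by positivity
    nlinarith
  have h4 := mul_le_mul_of_nonneg_left hlog (by positivity : 0 ≤ tdim l / 2)
  rw [neg_div]
  linarith

lemma hk_le_of_half_le (q z : EuclideanSpace ℝ (Fin N)) (hσ : 1 ≤ σ) {s : ℝ} (hs : σ / 2 ≤ s) :
    hk l q s z ≤ exp (tdim l / 2 * log 2) * exp (-(tdim l / 2 * log σ)) := by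
  have hn := tdim_nonneg (l := l)
  rw [hk, ← exp_add]
  refine exp_le_exp.2 ?_
  have h1 : 0 ≤ tsq l q z / (4 * s) := div_nonneg (tsq_nonneg q z) (by linarith)
  have h2 : log σ - log 2 ≤ log s := by
    rw [← log_div (by linarith) (by norm_num)]
    exact log_le_log (by linarith) hs
  have h4 := mul_le_mul_of_nonneg_left h2 (by positivity : 0 ≤ tdim l / 2)
  rw [neg_div]
  linarith

lemma exists_tail_le {ω : ℝ → ℝ} (hω : ∀ x, 0 ≤ ω x) (hωi : Integrable ω) (l : Fin N) {η : ℝ}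
    (hη : 0 < η) : ∃ r, 0 < r ∧ ∀ (p q : EuclideanSpace ℝ (Fin N)) (σ s : ℝ), 1 ≤ σ → 0 < s →
      s ≤ 3 * σ → (∀ i, |q i - p i| ≤ √σ) →
      ∫ z in (tbox l p r σ)ᶜ, hk l q s z * ω (z l) ≤ η := by
  have hm := tmass_pos (l := l)
  have hI : 0 ≤ ∫ x, ω x := integral_nonneg hω
  set B := exp (tdim l / 2 * log 2) with hB
  have hB0 : 0 < B := exp_pos _
  have ht1 : Tendsto (fun r : ℝ => ∫ x, (Icc (-r) r)ᶜ.indicator ω x) atTop (nhds 0) := by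
    have : (0:ℝ) = ∫ _ : ℝ, (0:ℝ) := by simp
    rw [this]
    refine tendsto_integral_filter_of_dominated_convergence ω
      (Eventually.of_forall fun r =>
        (hωi.indicator measurableSet_Icc.compl).aestronglyMeasurable)
      (Eventually.of_forall fun r => ae_of_all _ fun x => ?_) hωi (ae_of_all _ fun x => ?_)
    · by_cases hx : x ∈ (Icc (-r) r)ᶜ
      · rw [indicator_of_mem hx, Real.norm_of_nonneg (hω x)]
      · rw [indicator_of_notMem hx, norm_zero]
        exact hω x
    · refine tendsto_const_nhds.congr' ?_
      filter_upwards [eventually_ge_atTop |x|] with r hr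
      rw [indicator_of_notMem]
      simpa [abs_le] using hr
  have ht2 : Tendsto (fun r : ℝ => exp (-((r - 1) ^ 2 / 24))) atTop (nhds 0) := by
    refine tendsto_exp_neg_atTop_nhds_zero.comp ?_
    refine Tendsto.atTop_div_const (by norm_num) ?_
    refine (tendsto_pow_atTop two_ne_zero).comp ?_
    exact tendsto_atTop_add_const_right _ _ tendsto_id
  have ht3 : Tendsto (fun r : ℝ => tmass l * (∫ x, (Icc (-r) r)ᶜ.indicator ω x) +
      B * exp (-((r - 1) ^ 2 / 24)) * (tmass l * ∫ x, ω x)) atTop (nhds 0) := by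
    have := (ht1.const_mul (tmass l)).add ((ht2.const_mul B).mul_const (tmass l * ∫ x, ω x))
    simpa using this
  obtain ⟨r, hr, hr1⟩ := ((ht3.eventually_lt_const hη).and (eventually_ge_atTop 1)).exists
  refine ⟨r, by linarith, fun p q σ s hσ hs hsσ hpq => le_trans ?_ hr.le⟩
  have hi1 := hk_mul_integrable (l := l) q hs
    (hωi.indicator (measurableSet_Icc (a := -r) (b := r)).compl)
  have hi2 := hk_mul_integrable (l := l) q (by linarith : 0 < 2 * s) hωi
  have hi0 := hk_mul_integrable (l := l) q hs hωi
  rw [← hi1.2, ← hi2.2, ← integral_const_mul, ← integral_add hi1.1 (hi2.1.const_mul _),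
    ← integral_indicator measurableSet_tbox.compl]
  have hnn : ∀ z : EuclideanSpace ℝ (Fin N), 0 ≤ hk l q s z * (Icc (-r) r)ᶜ.indicator ω (z l) :=
    fun z => mul_nonneg (hk_pos _ _ _).le (indicator_nonneg (fun x _ => hω x) _)
  have hnn2 : ∀ z : EuclideanSpace ℝ (Fin N),
      0 ≤ B * exp (-((r - 1) ^ 2 / 24)) * (hk l q (2 * s) z * ω (z l)) := fun z =>
    mul_nonneg (mul_nonneg hB0.le (exp_pos _).le) (mul_nonneg (hk_pos _ _ _).le (hω _))
  refine integral_mono (hi0.1.indicator measurableSet_tbox.compl)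
    (hi1.1.add (hi2.1.const_mul _)) fun z => ?_
  change _ ≤ hk l q s z * (Icc (-r) r)ᶜ.indicator ω (z l) +
    B * exp (-((r - 1) ^ 2 / 24)) * (hk l q (2 * s) z * ω (z l))
  by_cases hz : z ∈ (tbox l p r σ)ᶜ
  swap
  · rw [indicator_of_notMem hz]
    exact add_nonneg (hnn z) (hnn2 z)
  rw [indicator_of_mem hz]
  by_cases hzl : |z l| ≤ r
  · have : ∃ i, i ≠ l ∧ r * √σ < |z i - p i| := by
      by_contra! hcon
      exact hz ⟨hcon, hzl⟩
    obtain ⟨i, hi, hlt⟩ := this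
    have h1 : (r - 1) * √σ ≤ |z i - q i| := by
      have h1 := abs_sub_le (z i) (q i) (p i)
      have := hpq i
      linarith
    have h2 : (r - 1) ^ 2 * σ ≤ tsq l q z := by
      refine le_trans ?_ (sq_le_tsq q z hi)
      rw [← sq_abs (z i - q i), ← Real.sq_sqrt (by linarith : 0 ≤ σ), ← mul_pow]
      exact pow_le_pow_left₀ (mul_nonneg (by linarith) (sqrt_nonneg _)) h1 2
    have h3 : (r - 1) ^ 2 / 24 ≤ tsq l q z / (8 * s) := by
      rw [div_le_div_iff₀ (by norm_num) (by positivity)]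
      have := mul_le_mul_of_nonneg_left hsσ (sq_nonneg (r - 1))
      linarith
    have h4 : hk l q s z ≤ B * exp (-((r - 1) ^ 2 / 24)) * hk l q (2 * s) z := by
      rw [hk_eq_double q z hs]
      have := hk_pos (l := l) q (2 * s) z
      gcongr
    have := mul_le_mul_of_nonneg_right h4 (hω (z l))
    linarith [hnn z]
  · rw [indicator_of_mem (s := (Icc (-r) r)ᶜ) (by simpa [abs_le] using hzl)]
    linarith [hnn2 z]

end TangentialBox

namespace IsPhase

variable {N : ℕ} {l : Fin N} {ω ω' H : ℝ → ℝ} {R : ℝ} {ξ : EuclideanSpace ℝ (Fin N) → ℝ → ℝ}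

lemma exists_integral_tbox_le (hp : IsPhase ω ω' H R l ξ) (hω : ∀ x, 0 < ω x) (hωc : Continuous ω)
    {r : ℝ} (hr : 0 < r) : ∃ C, 0 ≤ C ∧ ∀ (p : EuclideanSpace ℝ (Fin N)) (σ s t d : ℝ), 1 ≤ σ →
      σ / 2 ≤ s → s ≤ 3 * σ → dirEnergy ω l ξ (tbox l p r σ) p s t ≤ d →
      ∃ c, |c| ≤ R ∧ ∀ q s', σ / 2 ≤ s' →
        ∫ z in tbox l p r σ, hk l q s' z * (ω (z l) * (ξ z t - c) ^ 2) ≤ C * (σ * d) := by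
  obtain ⟨x0, -, hx0⟩ := (isCompact_Icc (a := -(r + R)) (b := r + R)).exists_isMinOn
    (nonempty_Icc.2 (by linarith [(abs_nonneg _).trans (hp.bdd 0 0)])) hωc.continuousOn
  obtain ⟨x1, -, hx1⟩ := (isCompact_Icc (a := -r) (b := r)).exists_isMaxOn
    (nonempty_Icc.2 (by linarith)) hωc.continuousOn
  set m := ω x0 with hm
  set M := ω x1 with hM
  have hm0 : 0 < m := hω x0
  have hM0 : 0 < M := hω x1
  set A := exp (-(tdim l * r ^ 2 / 2) - tdim l / 2 * log 3) with hA
  set B := exp (tdim l / 2 * log 2) with hB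
  have hA0 : 0 < A := exp_pos _
  have hB0 : 0 < B := exp_pos _
  refine ⟨B * M * (N * (4 * r ^ 2)) * 2 ^ N / (A * m), by positivity,
    fun p σ s t d hσ hs hs' hd => ?_⟩
  set Q := tbox l p r σ with hQ
  set e := exp (-(tdim l / 2 * log σ)) with he
  have he0 : 0 < e := exp_pos _
  have hQb : Bornology.IsBounded Q := isBounded_tbox hσ
  have hQm : MeasurableSet Q := measurableSet_tbox
  have hv : ContDiff ℝ 1 fun z => ξ z t := (hp.space t).of_le (by norm_num)
  have hio : ∀ h : EuclideanSpace ℝ (Fin N) → ℝ, Continuous h → IntegrableOn h Q := fun h hh =>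
    (hh.continuousOn.integrableOn_compact hQb.isCompact_closure).mono_set subset_closure
  have hG : Continuous fun z => ∑ i, pd i (fun y => ξ y t) z ^ 2 :=
    continuous_finsetSum _ fun i _ => (continuous_pd hv i).pow 2
  have hvc := hv.continuous
  have hkc : ∀ q s, Continuous (hk l q s) := fun q s => (contDiff_hk (n := 1) q s).continuous
  obtain ⟨y, -, hy⟩ := exists_integral_sq_sub_le convex_tbox hQm hQb (volume_tbox_ne_zero hr hσ)
    (fun x hx y hy => norm_sub_le_of_mem_tbox hσ hx hy) hv
  refine ⟨ξ y t, hp.bdd y t, fun q s' hs2 => ?_⟩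
  set c := ξ y t with hc
  rw [Real.sq_sqrt (by positivity)] at hy
  have h1 : A * e * m * ∫ z in Q, ∑ i, pd i (fun y => ξ y t) z ^ 2 ≤ d := by
    refine le_trans ?_ hd
    rw [← integral_const_mul]
    refine setIntegral_mono_on (hio _ (by fun_prop)) (hio _ ?_) hQm fun z hz => ?_
    · exact ((hkc p s).mul (hωc.comp (by fun_prop))).mul hG
    · refine mul_le_mul_of_nonneg_right ?_ (Finset.sum_nonneg fun i _ => sq_nonneg _)
      refine mul_le_mul (le_hk_of_mem_tbox hσ hs hs' hz) ?_ hm0.le (hk_pos _ _ _).le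
      refine hx0 ?_
      have h1 := abs_le.1 hz.2
      have h2 := abs_le.1 (hp.bdd z t)
      constructor <;> linarith
  have h2 : ∫ z in Q, hk l q s' z * (ω (z l) * (ξ z t - c) ^ 2)
      ≤ B * e * M * ∫ z in Q, (ξ z t - c) ^ 2 := by
    rw [← integral_const_mul]
    refine setIntegral_mono_on (hio _ ?_) (hio _ (by fun_prop)) hQm fun z hz => ?_
    · exact (hkc q s').mul ((hωc.comp (by fun_prop)).mul (by fun_prop))
    · rw [← mul_assoc]
      refine mul_le_mul_of_nonneg_right ?_ (sq_nonneg _)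
      exact mul_le_mul (hk_le_of_half_le q z hσ hs2) (hx1 (abs_le.1 hz.2)) (hω _).le (by positivity)
  refine h2.trans ?_
  have h3 : ∫ z in Q, ∑ i, pd i (fun y => ξ y t) z ^ 2 ≤ d / (A * e * m) := by
    rw [le_div_iff₀ (by positivity)]
    linarith
  calc B * e * M * ∫ z in Q, (ξ z t - c) ^ 2
      ≤ B * e * M * (N * (4 * r ^ 2 * σ) * 2 ^ N * (d / (A * e * m))) := by
        gcongr
        refine hy.trans ?_
        gcongr
    _ = _ := by
        field_simp

end IsPhase

section Concentration

variable {N : ℕ} {l : Fin N} {ω ω' H Γ : ℝ → ℝ} {κ h0 h1 θ CΓ R : ℝ}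
  {ξ : EuclideanSpace ℝ (Fin N) → ℝ → ℝ}

/-- The heat average of the potential of a constant phase. -/
noncomputable def constAvg (H : ℝ → ℝ) (k a b c : ℝ) (l : Fin N) (c' : ℝ) : ℝ :=
  tmass l * ∫ x, combKern H k a b c x c'

lemma IsWeight.integrable_combKern (hw : IsWeight ω ω' H Γ κ h0 h1 θ CΓ) {a b c c' : ℝ}
    (h : IsCoeff (κ + 1) R a b c) (hc : |c'| ≤ R) :
    Integrable fun x => combKern H (κ + 1) a b c x c' := by
  obtain ⟨C0, hC0, hC⟩ := hw.exists_combKern_le R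
  refine (hw.integrable.const_mul C0).mono' ?_ (ae_of_all _ fun x => (hC a b c h x c' hc).1)
  exact ((continuous_combKern hw.contH (κ + 1) a b c).comp
    (by fun_prop : Continuous fun x : ℝ => (x, c'))).aestronglyMeasurable

lemma IsWeight.exists_combKern_sub_le (hw : IsWeight ω ω' H Γ κ h0 h1 θ CΓ) (R : ℝ) :
    ∃ C, 0 < C ∧ ∀ a b c, IsCoeff (κ + 1) R a b c → ∀ x u v, |u| ≤ R → |v| ≤ R →
      combKern H (κ + 1) a b c x u ≤ combKern H (κ + 1) a b c x v + C * ω x * |u - v| := by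
  obtain ⟨C0, hC0, hC⟩ := hw.exists_combKern_le R
  refine ⟨C0 + 1, by linarith, fun a b c h x u v hu hv => ?_⟩
  have := (convex_Icc (-R) R).norm_image_sub_le_of_norm_hasDerivWithin_le (C := (C0 + 1) * ω x)
    (fun y _ => (hasDerivAt_combKern hw.contH (κ + 1) a b c x y).hasDerivWithinAt)
    (fun y hy => by
      have h1 := (hC a b c h x y (abs_le.2 hy)).2.2.2.2
      rw [Real.norm_eq_abs]
      linarith [hw.pos x]) (abs_le.1 hv) (abs_le.1 hu)
  rw [Real.norm_eq_abs, Real.norm_eq_abs] at this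
  linarith [le_abs_self (combKern H (κ + 1) a b c x u - combKern H (κ + 1) a b c x v)]

namespace IsPhase

lemma exists_avg_le (hp : IsPhase ω ω' H R l ξ) (hw : IsWeight ω ω' H Γ κ h0 h1 θ CΓ) :
    ∃ W, 0 ≤ W ∧ ∀ a b c, IsCoeff (κ + 1) R a b c → ∀ p s t, 0 < s →
      potAvg H (κ + 1) a b c l ξ p s t ≤ W ∧ sqAvg ω (κ + 1) a b l ξ p s t ≤ W := by
  obtain ⟨C0, hC0, hC⟩ := hw.exists_combKern_le R
  have hI : 0 ≤ ∫ x, ω x := integral_nonneg fun x => (hw.pos x).le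
  have hm := tmass_pos (l := l)
  refine ⟨C0 * (tmass l * ∫ x, ω x), by positivity, fun a b c h p s t hs => ?_⟩
  have hi := hk_mul_integrable (l := l) p hs hw.integrable
  rw [← hi.2, ← integral_const_mul]
  constructor
  · refine integral_mono (hp.integrable_potAvg hw h p hs t) (hi.1.const_mul _) fun z => ?_
    have := mul_le_mul_of_nonneg_left ((le_abs_self _).trans
      (hC a b c h (z l) _ (hp.bdd z t)).1) (hk_pos (l := l) p s z).le
    change _ ≤ C0 * (hk l p s z * ω (z l))
    linarith
  · refine integral_mono_of_nonneg (ae_of_all _ fun z => ?_) (hi.1.const_mul _)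
      (ae_of_all _ fun z => ?_)
    · exact mul_nonneg (hk_pos _ _ _).le (mul_nonneg (hw.pos _).le (sq_nonneg _))
    · have := mul_le_mul_of_nonneg_left (hC a b c h (z l) _ (hp.bdd z t)).2.2.2.1
        (hk_pos (l := l) p s z).le
      change _ ≤ C0 * (hk l p s z * ω (z l))
      linarith

lemma integrable_sq_sub (hp : IsPhase ω ω' H R l ξ) (hw : IsWeight ω ω' H Γ κ h0 h1 θ CΓ)
    {c' : ℝ} (hc : |c'| ≤ R) (p : EuclideanSpace ℝ (Fin N)) {s : ℝ} (hs : 0 < s) (t : ℝ) :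
    Integrable fun z => hk l p s z * (ω (z l) * (ξ z t - c') ^ 2) := by
  have hωc := hw.continuous.1
  have hv := (hp.space t).continuous
  refine ((hk_mul_integrable (l := l) p hs hw.integrable).1.const_mul ((2 * R) ^ 2)).mono'
    ((contDiff_hk (n := 1) (l := l) p s).continuous.mul
      ((hωc.comp (by fun_prop)).mul (by fun_prop))).aestronglyMeasurable (ae_of_all _ fun z => ?_)
  have hk0 := hk_pos (l := l) p s z
  have hω0 := hw.pos (z l)
  rw [Real.norm_of_nonneg (by positivity)]
  have h1 : (ξ z t - c') ^ 2 ≤ (2 * R) ^ 2 := by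
    rw [← sq_abs (ξ z t - c')]
    refine pow_le_pow_left₀ (abs_nonneg _) ?_ 2
    linarith [abs_sub (ξ z t) c', hp.bdd z t]
  have := mul_le_mul_of_nonneg_left h1 (mul_pos hk0 hω0).le
  linarith

lemma exists_potAvg_le_constAvg (hp : IsPhase ω ω' H R l ξ)
    (hw : IsWeight ω ω' H Γ κ h0 h1 θ CΓ) : ∃ C, 0 < C ∧ ∀ a b c, IsCoeff (κ + 1) R a b c →
      ∀ c' p s t S lam, |c'| ≤ R → 0 < s → MeasurableSet S → 0 < lam →
      potAvg H (κ + 1) a b c l ξ p s t ≤ constAvg H (κ + 1) a b c l c' +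
        C * (lam + (∫ z in S, hk l p s z * (ω (z l) * (ξ z t - c') ^ 2)) / lam +
          ∫ z in Sᶜ, hk l p s z * ω (z l)) := by
  obtain ⟨C1, hC1, hC⟩ := hw.exists_combKern_sub_le R
  have hI : 0 ≤ ∫ x, ω x := integral_nonneg fun x => (hw.pos x).le
  have hm := tmass_pos (l := l)
  have hR : 0 ≤ R := (abs_nonneg _).trans (hp.bdd 0 0)
  set W := tmass l * ∫ x, ω x with hW
  have hW0 : 0 ≤ W := by positivity
  refine ⟨C1 * (1 + W + 2 * R), by positivity, fun a b c h c' p s t S lam hc hs hS hl => ?_⟩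
  have hi := hk_mul_integrable (l := l) p hs hw.integrable
  have hj := hk_mul_integrable (l := l) p hs (hw.integrable_combKern h hc)
  have hsq := hp.integrable_sq_sub hw hc p hs t
  have hpt : ∀ z, hk l p s z * combKern H (κ + 1) a b c (z l) (ξ z t) ≤
      hk l p s z * combKern H (κ + 1) a b c (z l) c' + C1 * lam * (hk l p s z * ω (z l)) +
        C1 / lam * S.indicator (fun z => hk l p s z * (ω (z l) * (ξ z t - c') ^ 2)) z +
        C1 * (2 * R) * Sᶜ.indicator (fun z => hk l p s z * ω (z l)) z := by
    intro z
    have hk0 := hk_pos (l := l) p s z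
    have hω0 := hw.pos (z l)
    have h1 := mul_le_mul_of_nonneg_left (hC a b c h (z l) _ _ (hp.bdd z t) hc) hk0.le
    by_cases hz : z ∈ S
    · rw [indicator_of_mem hz, indicator_of_notMem (s := Sᶜ) (fun h => h hz)]
      have h2 : |ξ z t - c'| ≤ lam + (ξ z t - c') ^ 2 / lam := by
        rw [← sub_le_iff_le_add', le_div_iff₀ hl, ← sq_abs (ξ z t - c')]
        nlinarith [sq_nonneg (|ξ z t - c'| - lam), abs_nonneg (ξ z t - c')]
      have h3 := mul_le_mul_of_nonneg_left h2
        (mul_nonneg (mul_nonneg hC1.le hk0.le) hω0.le)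
      have h4 : C1 * hk l p s z * ω (z l) * (lam + (ξ z t - c') ^ 2 / lam) =
        C1 * lam * (hk l p s z * ω (z l)) +
          C1 / lam * (hk l p s z * (ω (z l) * (ξ z t - c') ^ 2)) := by ring
      linarith
    · rw [indicator_of_notMem hz, indicator_of_mem (s := Sᶜ) hz]
      have h2 : |ξ z t - c'| ≤ 2 * R := by linarith [abs_sub (ξ z t) c', hp.bdd z t]
      have h3 := mul_le_mul_of_nonneg_left h2
        (mul_nonneg (mul_nonneg hC1.le hk0.le) hω0.le)
      have h4 : 0 ≤ C1 * lam * (hk l p s z * ω (z l)) := by positivity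
      linarith
  have h_int := integral_mono (hp.integrable_potAvg hw h p hs t)
    (((hj.1.add (hi.1.const_mul (C1 * lam))).add ((hsq.indicator hS).const_mul (C1 / lam))).add
      ((hi.1.indicator hS.compl).const_mul (C1 * (2 * R)))) hpt
  rw [integral_add' ((hj.1.add (hi.1.const_mul (C1 * lam))).add
      ((hsq.indicator hS).const_mul (C1 / lam)))
      ((hi.1.indicator hS.compl).const_mul (C1 * (2 * R))),
    integral_add' (hj.1.add (hi.1.const_mul (C1 * lam)))
      ((hsq.indicator hS).const_mul (C1 / lam)),
    integral_add' hj.1 (hi.1.const_mul (C1 * lam)), integral_const_mul, integral_const_mul,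
    integral_const_mul, integral_indicator hS, integral_indicator hS.compl, hj.2, hi.2] at h_int
  change _ ≤ constAvg H (κ + 1) a b c l c' + C1 * lam * W + _ + _ at h_int
  set J := ∫ z in S, hk l p s z * (ω (z l) * (ξ z t - c') ^ 2) with hJ
  set T := ∫ z in Sᶜ, hk l p s z * ω (z l) with hT
  have hJ0 : 0 ≤ J := integral_nonneg fun z =>
    mul_nonneg (hk_pos _ _ _).le (mul_nonneg (hw.pos _).le (sq_nonneg _))
  have hT0 : 0 ≤ T := integral_nonneg fun z => mul_nonneg (hk_pos _ _ _).le (hw.pos _).le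
  refine h_int.trans ?_
  have e1 : 0 ≤ C1 * (1 + 2 * R) * lam := by positivity
  have e2 : 0 ≤ C1 * (W + 2 * R) * (J / lam) := by positivity
  have e3 : 0 ≤ C1 * (1 + W) * T := by positivity
  have e4 : C1 / lam * J = C1 * (J / lam) := by ring
  rw [e4]
  nlinarith

set_option maxHeartbeats 1000000 in
/-- The heat averages of two potentials are simultaneously almost bounded by those of one
constant phase, once averaged on a large scale. -/
lemma exists_scale_potAvg_le (hp : IsPhase ω ω' H R l ξ)
    (hw : IsWeight ω ω' H Γ κ h0 h1 θ CΓ) {a b c a' b' c₁ : ℝ} (h : IsCoeff (κ + 1) R a b c)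
    (h' : IsCoeff (κ + 1) R a' b' c₁) {δ : ℝ} (hδ : 0 < δ) :
    ∃ s1, 1 ≤ s1 ∧ ∀ s0, s1 ≤ s0 → ∃ c', |c'| ≤ R ∧ ∀ p s t, s0 ≤ s →
      potAvg H (κ + 1) a b c l ξ p s t ≤ constAvg H (κ + 1) a b c l c' + δ ∧
      potAvg H (κ + 1) a' b' c₁ l ξ p s t ≤ constAvg H (κ + 1) a' b' c₁ l c' + δ := by
  obtain ⟨Cm, hCm, hmono⟩ := hp.exists_monotone hw
  obtain ⟨W, hW0, hW⟩ := hp.exists_avg_le hw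
  obtain ⟨C1, hC1, hcomp⟩ := hp.exists_potAvg_le_constAvg hw
  have hθ := hw.θ_pos
  set lam := δ / (4 * C1) with hlam
  have hlam0 : 0 < lam := by positivity
  obtain ⟨r, hr, htail⟩ := exists_tail_le (fun x => (hw.pos x).le) hw.integrable l hlam0
  obtain ⟨C2, hC2, hbox⟩ := hp.exists_integral_tbox_le hw.pos hw.continuous.1 hr
  set E := exp (-((κ + 1) * R)) / 2 with hE
  have hE0 : 0 < E := by positivity
  set X := C2 * (2 * θ / E) / lam * C1 with hX
  have hX0 : 0 ≤ X := by positivity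
  set ε := δ / 4 / (1 + X) with hε
  have hε0 : 0 < ε := by positivity
  have hεX : ε * (1 + X) = δ / 4 := div_mul_cancel₀ _ (by positivity)
  have hXε : 0 ≤ X * ε := by positivity
  have hεδ : ε ≤ δ / 4 := by linarith
  refine ⟨max 1 (4 * Cm * W / ε), le_max_left _ _, fun s0 hs0 => ?_⟩
  have hs01 : 1 ≤ s0 := (le_max_left _ _).trans hs0
  have hs00 : 0 < s0 := by linarith
  have hloss : Cm * W / s0 ≤ ε / 4 := by
    have h1 := (le_max_right _ _).trans hs0
    rw [div_le_iff₀ hε0] at h1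
    rw [div_le_iff₀ hs00]
    linarith
  have hloss' : ∀ s, s0 ≤ s → Cm * W / s ≤ ε / 4 := fun s hs =>
    (div_le_div_of_nonneg_left (by positivity) hs00 hs).trans hloss
  have hsup : ∀ a b c, IsCoeff (κ + 1) R a b c → ∃ q, (∀ p s t, s0 ≤ s →
      potAvg H (κ + 1) a b c l ξ p s t ≤ q) ∧ ∃ p s t, s0 ≤ s ∧
      q - ε / 4 < potAvg H (κ + 1) a b c l ξ p s t := by
    intro a b c h
    set A := {x | ∃ p s t, s0 ≤ s ∧ potAvg H (κ + 1) a b c l ξ p s t = x} with hA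
    have hAne : A.Nonempty := ⟨_, 0, s0, 0, le_rfl, rfl⟩
    have hAb : BddAbove A := by
      refine ⟨W, ?_⟩
      rintro x ⟨p, s, t, hs, rfl⟩
      exact (hW a b c h p s t (by linarith)).1
    refine ⟨sSup A, fun p s t hs => le_csSup hAb ⟨p, s, t, hs, rfl⟩, ?_⟩
    obtain ⟨x, ⟨p, s, t, hs, rfl⟩, hx⟩ := exists_lt_of_lt_csSup hAne
      (by linarith : sSup A - ε / 4 < sSup A)
    exact ⟨p, s, t, hs, hx⟩
  have hback : ∀ a b c, IsCoeff (κ + 1) R a b c → ∀ p s t1 t, s0 ≤ s → t ≤ t1 →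
      potAvg H (κ + 1) a b c l ξ p s t1 - ε / 4 ≤
        potAvg H (κ + 1) a b c l ξ p (s + θ * (t1 - t)) t := by
    intro a b c h p s t1 t hs ht
    have := hmono a b c h p s t t1 (hs01.trans hs) ht ∅ 0 W MeasurableSet.empty
      Bornology.isBounded_empty (fun _ _ => by simp [dirEnergy])
      (fun s' t' hs' => (hW a b c h p (2 * s') t' (by linarith)).2)
    have h2 := hloss' s hs
    simp only [mul_zero, zero_mul, add_zero] at this
    linarith
  obtain ⟨q, hq, p, s, t1, hs, hqp⟩ := hsup a b c h
  obtain ⟨q', hq', p', s', t1', hs', hqp'⟩ := hsup a' b' c₁ h'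
  set A := s + θ * t1 with hA
  set A' := s' + θ * t1' with hA'
  set T := 1 + |t1| + |t1'| + (1 + 2 * |A| + 2 * |A'| + ‖p' - p‖ ^ 2) / θ with hT
  have hTX : 0 ≤ (1 + 2 * |A| + 2 * |A'| + ‖p' - p‖ ^ 2) / θ := by positivity
  have hT1 : 1 ≤ T := by linarith [abs_nonneg t1, abs_nonneg t1']
  have hTt : -T ≤ t1 := by linarith [neg_abs_le t1, abs_nonneg t1']
  have hTt' : -T ≤ t1' := by linarith [neg_abs_le t1', abs_nonneg t1]
  set σ := θ * T with hσ
  have hσX : 1 + 2 * |A| + 2 * |A'| + ‖p' - p‖ ^ 2 ≤ σ := by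
    have h1 : (1 + 2 * |A| + 2 * |A'| + ‖p' - p‖ ^ 2) / θ ≤ T := by
      linarith [abs_nonneg t1, abs_nonneg t1']
    rw [div_le_iff₀ hθ] at h1
    linarith
  have hσ1 : 1 ≤ σ := by linarith [abs_nonneg A, abs_nonneg A', sq_nonneg ‖p' - p‖]
  have hσA : 2 * |A| ≤ σ := by linarith [abs_nonneg A, abs_nonneg A', sq_nonneg ‖p' - p‖]
  have hσA' : 2 * |A'| ≤ σ := by linarith [abs_nonneg A, abs_nonneg A', sq_nonneg ‖p' - p‖]
  have hσp : ∀ i, |p' i - p i| ≤ √σ := by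
    intro i
    refine Real.le_sqrt_of_sq_le ?_
    have h1 : |p' i - p i| ≤ ‖p' - p‖ := abs_coord_le (p' - p) i
    have h2 := pow_le_pow_left₀ (abs_nonneg _) h1 2
    linarith [abs_nonneg A, abs_nonneg A']
  set d := 2 * ε / (E * T) with hd
  have hex : ∃ t ∈ Icc (-(2 * T)) (-T),
      dirEnergy ω l ξ (tbox l p r σ) p (s + θ * (t1 - t)) t ≤ d := by
    by_contra! hcon
    have hge : s ≤ s + θ * (t1 - -T) := by
      have := mul_nonneg hθ.le (by linarith : 0 ≤ t1 - -T)
      linarith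
    have h1 := hmono a b c h p (s + θ * (t1 - -T)) (-(2 * T)) (-T) (by linarith) (by linarith)
      (tbox l p r σ) d W measurableSet_tbox (isBounded_tbox hσ1)
      (fun t ht => by
        have h1 := (hcon t ht).le
        have h2 : s + θ * (t1 - -T) + θ * (-T - t) = s + θ * (t1 - t) := by ring
        rwa [h2])
      (fun s' t' hs' => (hW a b c h p (2 * s') t' (by linarith)).2)
    have h2 := hback a b c h p s t1 (-T) hs hTt
    have h3 := hloss' _ (hs.trans hge)
    have h4 := hq p (s + θ * (t1 - -T) + θ * (-T - -(2 * T))) (-(2 * T)) (by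
      have := mul_nonneg hθ.le (by linarith : 0 ≤ -T - -(2 * T))
      linarith)
    have h5 : E * d * (-T - -(2 * T)) = 2 * ε := by
      rw [hd]
      field_simp
      ring
    linarith
  obtain ⟨t, ht, hdt⟩ := hex
  have hrange : ∀ B, 2 * |B| ≤ σ → σ / 2 ≤ B - θ * t ∧ B - θ * t ≤ 3 * σ := by
    intro B hB
    have h1 := mul_le_mul_of_nonneg_left ht.1 hθ.le
    have h2 := mul_le_mul_of_nonneg_left ht.2 hθ.le
    have h3 := abs_le.1 (le_refl |B|)
    constructor <;> linarith
  have e1 : s + θ * (t1 - t) = A - θ * t := by rw [hA]; ring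
  have e2 : s' + θ * (t1' - t) = A' - θ * t := by rw [hA']; ring
  have hr1 := hrange A hσA
  have hr2 := hrange A' hσA'
  rw [e1] at hdt
  obtain ⟨c', hc', hball⟩ := hbox p σ _ t d hσ1 hr1.1 hr1.2 hdt
  have hσd : σ * d = 2 * θ / E * ε := by
    rw [hd, hσ]
    field_simp
  have hfin : ∀ a b c, IsCoeff (κ + 1) R a b c → ∀ q p₂ s₂ t₂, s0 ≤ s₂ → -T ≤ t₂ →
      2 * |s₂ + θ * t₂| ≤ σ → (∀ i, |p₂ i - p i| ≤ √σ) →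
      q - ε / 4 < potAvg H (κ + 1) a b c l ξ p₂ s₂ t₂ → q ≤ constAvg H (κ + 1) a b c l c' + δ := by
    intro a b c h q p₂ s₂ t₂ hs₂ ht₂ hσ₂ hp₂ hq₂
    have hr₂ := hrange _ hσ₂
    have e₂ : s₂ + θ * (t₂ - t) = s₂ + θ * t₂ - θ * t := by ring
    have h1 := hback a b c h p₂ s₂ t₂ t hs₂ (ht.2.trans ht₂)
    rw [e₂] at h1
    have hpos : 0 < s₂ + θ * t₂ - θ * t := by linarith
    have h2 := hcomp a b c h c' p₂ (s₂ + θ * t₂ - θ * t) t (tbox l p r σ) lam hc' hpos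
      measurableSet_tbox hlam0
    have h3 := htail p p₂ σ (s₂ + θ * t₂ - θ * t) hσ1 hpos hr₂.2 hp₂
    have h4 := hball p₂ (s₂ + θ * t₂ - θ * t) hr₂.1
    rw [hσd] at h4
    have h5 : C1 * (lam + (∫ z in tbox l p r σ, hk l p₂ (s₂ + θ * t₂ - θ * t) z *
        (ω (z l) * (ξ z t - c') ^ 2)) / lam +
        ∫ z in (tbox l p r σ)ᶜ, hk l p₂ (s₂ + θ * t₂ - θ * t) z * ω (z l)) ≤
        C1 * (lam + C2 * (2 * θ / E * ε) / lam + lam) := by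
      gcongr
    have h6 : C1 * (lam + C2 * (2 * θ / E * ε) / lam + lam) = 2 * (C1 * lam) + X * ε := by
      rw [hX]
      ring
    have h7 : C1 * lam = δ / 4 := by
      rw [hlam]
      field_simp
    have h8 : X * ε ≤ δ / 4 := by linarith
    linarith
  refine ⟨c', hc', fun p₂ s₂ t₂ hs₂ => ⟨?_, ?_⟩⟩
  · exact (hq p₂ s₂ t₂ hs₂).trans (hfin a b c h q p s t1 hs hTt hσA
      (fun i => by simp) hqp)
  · exact (hq' p₂ s₂ t₂ hs₂).trans (hfin a' b' c₁ h' q' p' s' t1' hs' hTt' hσA' hσp hqp')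

end IsPhase

end Concentration

section Rigidity

variable {N : ℕ} {l : Fin N} {ω ω' H Γ : ℝ → ℝ} {κ h0 h1 θ CΓ R : ℝ}
  {ξ : EuclideanSpace ℝ (Fin N) → ℝ → ℝ}

lemma expComb_eq_sinh (k c x : ℝ) :
    expComb k (exp (-(k * c)) / 2) (-(exp (k * c) / 2)) x = sinh (k * (x - c)) := by
  have h1 : exp (k * (x - c)) = exp (-(k * c)) * exp (k * x) := by
    rw [← exp_add]
    ring_nf
  have h2 : exp (-(k * (x - c))) = exp (k * c) * exp (-k * x) := by
    rw [← exp_add]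
    ring_nf
  rw [expComb, sinh_eq, h1, h2]
  ring

lemma isCoeff_sinh {k c : ℝ} (hk : 0 ≤ k) (hc : |c| ≤ R) :
    IsCoeff k R (exp (-(k * c)) / 2) (-(exp (k * c) / 2)) c where
  nonneg := by positivity
  nonpos := by linarith [exp_pos (k * c)]
  one_le := by
    have := one_le_cosh (k * c)
    rw [cosh_eq] at this
    linarith
  le := by
    have h1 : exp (-(k * c)) ≤ exp (k * R) := exp_le_exp.2 (by
      nlinarith [mul_le_mul_of_nonneg_left (abs_le.1 hc).1 hk])
    linarith [exp_pos (-(k * c))]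
  neg_le := by
    have h1 : exp (k * c) ≤ exp (k * R) :=
      exp_le_exp.2 (mul_le_mul_of_nonneg_left (abs_le.1 hc).2 hk)
    linarith [exp_pos (k * c)]
  base := hc

lemma integral_sinh_shift {k : ℝ} (hk : k ≠ 0) (c ξ : ℝ) :
    ∫ s in c..ξ, sinh (k * (s - c)) = (cosh (k * (ξ - c)) - 1) / k := by
  have hd : ∀ s, HasDerivAt (fun s => cosh (k * (s - c)) / k) (sinh (k * (s - c))) s := by
    intro s
    have h1 : HasDerivAt (fun s => k * (s - c)) (k * 1) s :=
      ((hasDerivAt_id s).sub_const c).const_mul k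
    exact (h1.cosh.div_const k).congr_deriv (by field_simp)
  rw [intervalIntegral.integral_eq_sub_of_hasDerivAt (fun s _ => hd s)
    (Continuous.intervalIntegrable (by fun_prop) _ _)]
  simp
  ring

lemma IsWeight.exists_le_combKern (hw : IsWeight ω ω' H Γ κ h0 h1 θ CΓ) (R : ℝ) :
    ∃ C, 0 < C ∧ ∀ c x ξ, |c| ≤ R → |ξ| ≤ R →
      C * (ω (x - ξ) * sinh ((κ + 1) * (ξ - c)) ^ 2) ≤
        combKern H (κ + 1) (exp (-((κ + 1) * c)) / 2) (-(exp ((κ + 1) * c) / 2)) c x ξ := by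
  have hκ := hw.κ_pos
  have hk : 0 < κ + 1 := by linarith
  have hh0 := hw.h0_pos
  set k := κ + 1 with hkdef
  refine ⟨h0 * exp (-(4 * κ * R)) / (k * (cosh (2 * k * R) + 1)),
    by have := cosh_pos (2 * k * R); positivity, fun c x ξ hc hξ => ?_⟩
  have hR : 0 ≤ R := (abs_nonneg _).trans hc
  rw [combKern_eq hw.contH]
  simp_rw [expComb_eq_sinh]
  set m := h0 * exp (-(4 * κ * R)) * ω (x - ξ) with hm
  have hm0 : 0 ≤ m := by have := hw.pos (x - ξ); positivity
  have hmH : ∀ s, |s| ≤ R → m ≤ H (x - s) := by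
    intro s hs
    refine le_trans ?_ (hw.h0_le (x - s))
    rw [hm, mul_assoc]
    refine mul_le_mul_of_nonneg_left ?_ hh0.le
    have h1 := hw.le_shift (x - s) (ξ - s)
    rw [show x - s - (ξ - s) = x - ξ by ring] at h1
    have h2 : |ξ - s| ≤ 2 * R := by linarith [abs_sub ξ s]
    have h3 : exp (2 * κ * |ξ - s|) ≤ exp (4 * κ * R) := exp_le_exp.2 (by nlinarith)
    rw [exp_neg, inv_mul_le_iff₀ (exp_pos _)]
    exact h1.trans (mul_le_mul_of_nonneg_right h3 (hw.pos _).le)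
  have hHc : Continuous fun s => H (x - s) * sinh (k * (s - c)) :=
    (hw.contH.comp (by fun_prop)).mul (by fun_prop)
  have hcmp : m * ∫ s in c..ξ, sinh (k * (s - c)) ≤
    ∫ s in c..ξ, H (x - s) * sinh (k * (s - c)) := by
    rw [← intervalIntegral.integral_const_mul]
    rcases le_total c ξ with h | h
    · refine intervalIntegral.integral_mono_on h (Continuous.intervalIntegrable (by fun_prop) _ _)
        (hHc.intervalIntegrable _ _) fun s hs => ?_
      refine mul_le_mul_of_nonneg_right (hmH s ?_)
        (sinh_nonneg_iff.2 (mul_nonneg hk.le (by linarith [hs.1])))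
      exact abs_le.2 ⟨by linarith [hs.1, (abs_le.1 hc).1], by linarith [hs.2, (abs_le.1 hξ).2]⟩
    · rw [intervalIntegral.integral_symm, intervalIntegral.integral_symm ξ c]
      refine neg_le_neg ?_
      refine intervalIntegral.integral_mono_on h (hHc.intervalIntegrable _ _)
        (Continuous.intervalIntegrable (by fun_prop) _ _) fun s hs => ?_
      refine mul_le_mul_of_nonpos_right (hmH s ?_)
        (sinh_nonpos_iff.2 (mul_nonpos_of_nonneg_of_nonpos hk.le (by linarith [hs.2])))
      exact abs_le.2 ⟨by linarith [hs.1, (abs_le.1 hξ).1], by linarith [hs.2, (abs_le.1 hc).2]⟩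
  refine le_trans ?_ hcmp
  rw [integral_sinh_shift hk.ne', sinh_sq]
  have h1 : cosh (k * (ξ - c)) ≤ cosh (2 * k * R) := by
    rw [cosh_le_cosh, abs_mul, abs_of_pos hk, abs_of_nonneg (by positivity : 0 ≤ 2 * k * R)]
    nlinarith [abs_sub ξ c]
  have h2 := one_le_cosh (k * (ξ - c))
  have h3 := cosh_pos (2 * k * R)
  have h4 : cosh (k * (ξ - c)) ^ 2 - 1 ≤
      (cosh (k * (ξ - c)) - 1) * (cosh (2 * k * R) + 1) := by nlinarith
  calc h0 * exp (-(4 * κ * R)) / (k * (cosh (2 * k * R) + 1)) *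
        (ω (x - ξ) * (cosh (k * (ξ - c)) ^ 2 - 1))
      = m / (k * (cosh (2 * k * R) + 1)) * (cosh (k * (ξ - c)) ^ 2 - 1) := by rw [hm]; ring
    _ ≤ m / (k * (cosh (2 * k * R) + 1)) *
        ((cosh (k * (ξ - c)) - 1) * (cosh (2 * k * R) + 1)) := by gcongr
    _ = _ := by
      field_simp

lemma combKern_eq_sub (W : ℝ → ℝ) (k a b c x ξ : ℝ) : combKern W k a b c x ξ =
    a * (combKern W k 1 0 0 x ξ - combKern W k 1 0 0 x c) -
      b * (combKern W k 0 (-1) 0 x ξ - combKern W k 0 (-1) 0 x c) := by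
  simp only [combKern, expKern]
  ring

namespace IsPhase

lemma isCoeff_one_zero {k R : ℝ} (hk : 0 ≤ k) (hR : 0 ≤ R) : IsCoeff k R 1 0 0 where
  nonneg := zero_le_one
  nonpos := le_rfl
  one_le := by norm_num
  le := one_le_exp (mul_nonneg hk hR)
  neg_le := by rw [neg_zero]; exact (exp_pos _).le
  base := by simpa using hR

lemma isCoeff_zero_neg_one {k R : ℝ} (hk : 0 ≤ k) (hR : 0 ≤ R) : IsCoeff k R 0 (-1) 0 where
  nonneg := le_rfl
  nonpos := by norm_num
  one_le := by norm_num
  le := (exp_pos _).le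
  neg_le := by rw [neg_neg]; exact one_le_exp (mul_nonneg hk hR)
  base := by simpa using hR

lemma potAvg_eq_sub (hp : IsPhase ω ω' H R l ξ) (hw : IsWeight ω ω' H Γ κ h0 h1 θ CΓ) {c : ℝ}
    (hc : |c| ≤ R) (a b : ℝ) (p : EuclideanSpace ℝ (Fin N)) {s : ℝ} (hs : 0 < s) (t : ℝ) :
    potAvg H (κ + 1) a b c l ξ p s t =
      a * (potAvg H (κ + 1) 1 0 0 l ξ p s t - constAvg H (κ + 1) 1 0 0 l c) -
      b * (potAvg H (κ + 1) 0 (-1) 0 l ξ p s t - constAvg H (κ + 1) 0 (-1) 0 l c) := by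
  have hR : 0 ≤ R := (abs_nonneg _).trans hc
  have hκ1 : 0 ≤ κ + 1 := by linarith [hw.κ_pos]
  have h1 := isCoeff_one_zero hκ1 hR
  have h2 := isCoeff_zero_neg_one hκ1 hR
  have i1 := hp.integrable_potAvg hw h1 p hs t
  have i2 := hp.integrable_potAvg hw h2 p hs t
  have j1 := hk_mul_integrable (l := l) p hs (hw.integrable_combKern h1 hc)
  have j2 := hk_mul_integrable (l := l) p hs (hw.integrable_combKern h2 hc)
  rw [constAvg, constAvg, ← j1.2, ← j2.2, potAvg, potAvg, potAvg, ← integral_sub i1 j1.1,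
    ← integral_sub i2 j2.1, ← integral_const_mul, ← integral_const_mul,
    ← integral_sub (f := fun z => a * (hk l p s z * combKern H (κ + 1) 1 0 0 (z l) (ξ z t) -
        hk l p s z * combKern H (κ + 1) 1 0 0 (z l) c))
      (g := fun z => b * (hk l p s z * combKern H (κ + 1) 0 (-1) 0 (z l) (ξ z t) -
        hk l p s z * combKern H (κ + 1) 0 (-1) 0 (z l) c))
      ((i1.sub j1.1).const_mul a) ((i2.sub j2.1).const_mul b)]
  refine integral_congr_ae (ae_of_all _ fun z => ?_)
  change hk l p s z * combKern H (κ + 1) a b c (z l) (ξ z t) = _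
  rw [combKern_eq_sub H (κ + 1) a b c]
  ring

/-- At a fixed scale, the weighted quadratic distance of the phase to some constant is as small
as we wish. -/
lemma exists_scale_forall_sqAvg_le (hp : IsPhase ω ω' H R l ξ)
    (hw : IsWeight ω ω' H Γ κ h0 h1 θ CΓ) : ∃ s1, 1 ≤ s1 ∧ ∀ δ, 0 < δ → ∃ c, |c| ≤ R ∧ ∀ p t,
      ∫ z, hk l p s1 z * (ω (z l - ξ z t) * (ξ z t - c) ^ 2) ≤ δ := by
  have hR : 0 ≤ R := (abs_nonneg _).trans (hp.bdd 0 0)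
  have hκ := hw.κ_pos
  have hκ1 : 0 ≤ κ + 1 := by linarith
  have hθ := hw.θ_pos
  obtain ⟨Cm, hCm, hmono⟩ := hp.exists_monotone hw
  obtain ⟨W, hW0, hW⟩ := hp.exists_avg_le hw
  obtain ⟨C1, hC1, hlow⟩ := hw.exists_le_combKern R
  set s1 := max 1 (2 * Cm / C1) with hs1
  have hs11 : 1 ≤ s1 := le_max_left _ _
  have hs10 : 0 < s1 := by linarith
  refine ⟨s1, hs11, fun δ hδ => ?_⟩
  set F := exp ((κ + 1) * R) with hF
  have hF0 : 0 < F := exp_pos _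
  set δ' := C1 * δ / (4 * F) with hδ'
  have hδ'0 : 0 < δ' := by positivity
  obtain ⟨S, hS1, hS⟩ := hp.exists_scale_potAvg_le hw (isCoeff_one_zero hκ1 hR)
    (isCoeff_zero_neg_one hκ1 hR) hδ'0
  obtain ⟨c, hc, hcS⟩ := hS (max S s1) (le_max_left _ _)
  refine ⟨c, hc, ?_⟩
  have hco := isCoeff_sinh hκ1 hc
  set a := exp (-((κ + 1) * c)) / 2 with ha
  set b := -(exp ((κ + 1) * c) / 2) with hb
  have hfar : ∀ p s t, max S s1 ≤ s → potAvg H (κ + 1) a b c l ξ p s t ≤ C1 * δ / 2 := by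
    intro p s t hs
    have hs0 : 0 < s := by linarith [le_max_right S s1]
    obtain ⟨e1, e2⟩ := hcS p s t hs
    rw [hp.potAvg_eq_sub hw hc a b p hs0 t]
    have q1 : a * (potAvg H (κ + 1) 1 0 0 l ξ p s t - constAvg H (κ + 1) 1 0 0 l c) ≤ F * δ' :=
      (mul_le_mul_of_nonneg_left (by linarith : _ ≤ δ') hco.nonneg).trans
        (mul_le_mul_of_nonneg_right hco.le hδ'0.le)
    have q2 : -b * (potAvg H (κ + 1) 0 (-1) 0 l ξ p s t - constAvg H (κ + 1) 0 (-1) 0 l c) ≤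
        F * δ' :=
      (mul_le_mul_of_nonneg_left (by linarith : _ ≤ δ') (by linarith [hco.nonpos])).trans
        (mul_le_mul_of_nonneg_right hco.neg_le hδ'0.le)
    have q3 : F * δ' = C1 * δ / 4 := by
      rw [hδ']
      field_simp
    linarith
  have hsqi : ∀ p s t, 0 < s → Integrable fun z =>
      hk l p s z * (ω (z l - ξ z t) * expComb (κ + 1) a b (ξ z t) ^ 2) := by
    intro p s t hs
    obtain ⟨C0, hC0, hC⟩ := hw.exists_combKern_le R
    have hv := (hp.space t).continuous
    refine ((hk_mul_integrable (l := l) p hs hw.integrable).1.const_mul C0).mono'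
      ((contDiff_hk (n := 1) (l := l) p s).continuous.mul
        ((hw.continuous.1.comp (by fun_prop)).mul
          (((continuous_expComb _ a b).comp hv).pow 2))).aestronglyMeasurable
      (ae_of_all _ fun z => ?_)
    have hk0 := hk_pos (l := l) p s z
    have hω0 := hw.pos (z l - ξ z t)
    rw [Real.norm_of_nonneg (by positivity)]
    have := mul_le_mul_of_nonneg_left (hC a b c hco (z l) _ (hp.bdd z t)).2.2.2.1 hk0.le
    linarith
  have hsq : ∀ p s t, 0 < s →
      C1 * sqAvg ω (κ + 1) a b l ξ p s t ≤ potAvg H (κ + 1) a b c l ξ p s t := by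
    intro p s t hs
    rw [sqAvg, ← integral_const_mul]
    refine integral_mono ((hsqi p s t hs).const_mul C1) (hp.integrable_potAvg hw hco p hs t)
      fun z => ?_
    change C1 * (hk l p s z * (ω (z l - ξ z t) * expComb (κ + 1) a b (ξ z t) ^ 2)) ≤ _
    rw [ha, hb, expComb_eq_sinh]
    have := mul_le_mul_of_nonneg_left (hlow c (z l) (ξ z t) hc (hp.bdd z t))
      (hk_pos (l := l) p s z).le
    linarith
  set A := {x | ∃ p s t, s1 ≤ s ∧ potAvg H (κ + 1) a b c l ξ p s t = x} with hA
  have hAne : A.Nonempty := ⟨_, 0, s1, 0, le_rfl, rfl⟩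
  have hAb : BddAbove A := by
    refine ⟨W, ?_⟩
    rintro x ⟨p, s, t, hs, rfl⟩
    exact (hW a b c hco p s t (by linarith)).1
  set q := sSup A with hq
  have hqA : ∀ p s t, s1 ≤ s → potAvg H (κ + 1) a b c l ξ p s t ≤ q := fun p s t hs =>
    le_csSup hAb ⟨p, s, t, hs, rfl⟩
  have hq0 : 0 ≤ q := by
    refine le_trans ?_ ((hsq 0 s1 0 hs10).trans (hqA 0 s1 0 le_rfl))
    refine mul_nonneg hC1.le (integral_nonneg fun z => ?_)
    exact mul_nonneg (hk_pos _ _ _).le (mul_nonneg (hw.pos _).le (sq_nonneg _))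
  have hstep : q ≤ C1 * δ / 2 + q / 2 := by
    refine csSup_le hAne ?_
    rintro x ⟨p, s, t, hs, rfl⟩
    set τ := |max S s1| / θ with hτ
    have hτ0 : 0 ≤ τ := by positivity
    have hm := hmono a b c hco p s (t - τ) t (by linarith) (by linarith) ∅ 0 (q / C1)
      MeasurableSet.empty Bornology.isBounded_empty (fun _ _ => by simp [dirEnergy])
      (fun s' t' hs' => by
        rw [le_div_iff₀ hC1]
        have := (hsq p (2 * s') t' (by linarith)).trans (hqA p (2 * s') t' (by linarith))
        linarith)
    have hθτ : θ * (t - (t - τ)) = |max S s1| := by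
      rw [hτ]
      field_simp
      ring
    have h2 := hfar p (s + θ * (t - (t - τ))) (t - τ) (by
      rw [hθτ]
      linarith [le_abs_self (max S s1)])
    have h3 : Cm * (q / C1) / s ≤ q / 2 := by
      rw [div_le_iff₀ (by linarith)]
      have h4 : 2 * Cm / C1 ≤ s := (le_max_right _ _).trans hs
      have h5 := mul_le_mul_of_nonneg_left h4 hq0
      have h6 : q * (2 * Cm / C1) = 2 * (Cm * (q / C1)) := by ring
      linarith
    simp only [mul_zero, zero_mul, add_zero] at hm
    linarith
  intro p t
  have h1 : C1 * sqAvg ω (κ + 1) a b l ξ p s1 t ≤ C1 * δ :=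
    (hsq p s1 t hs10).trans ((hqA p s1 t le_rfl).trans (by linarith))
  refine le_trans ?_ (le_of_mul_le_mul_left h1 hC1)
  refine integral_mono_of_nonneg (ae_of_all _ fun z => ?_) (hsqi p s1 t hs10)
    (ae_of_all _ fun z => ?_)
  · exact mul_nonneg (hk_pos _ _ _).le (mul_nonneg (hw.pos _).le (sq_nonneg _))
  · refine mul_le_mul_of_nonneg_left (mul_le_mul_of_nonneg_left ?_ (hw.pos _).le) (hk_pos _ _ _).le
    rw [ha, hb, expComb_eq_sinh]
    refine sq_le_sq.2 ?_
    have h2 : |ξ z t - c| ≤ |(κ + 1) * (ξ z t - c)| := by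
      rw [abs_mul, abs_of_nonneg hκ1]
      exact le_mul_of_one_le_left (abs_nonneg _) (by linarith)
    refine h2.trans ?_
    rw [abs_sinh]
    exact self_le_sinh_iff.2 (abs_nonneg _)

lemma exists_forall_eq (hp : IsPhase ω ω' H R l ξ) (hw : IsWeight ω ω' H Γ κ h0 h1 θ CΓ) :
    ∃ c, ∀ z t, ξ z t = c := by
  obtain ⟨s1, hs1, hδ⟩ := hp.exists_scale_forall_sqAvg_le hw
  have hs0 : 0 < s1 := by linarith
  choose c hcR hc using fun n : ℕ => hδ (1 / ((n : ℝ) + 1)) (by positivity)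
  obtain ⟨c₀, -, g, hg, hlim⟩ := (isCompact_Icc (a := -R) (b := R)).tendsto_subseq
    (fun n => abs_le.1 (hcR n))
  refine ⟨c₀, fun z t => ?_⟩
  have hv := (hp.space t).continuous
  have hωc := hw.continuous.1
  have hkc : Continuous (hk l 0 s1) := (contDiff_hk (n := 1) (l := l) 0 s1).continuous
  set B := exp (2 * κ * R) with hB
  have hωB : ∀ z : EuclideanSpace ℝ (Fin N), ω (z l - ξ z t) ≤ B * ω (z l) := fun z =>
    (hw.le_shift _ _).trans (mul_le_mul_of_nonneg_right (exp_le_exp.2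
      (mul_le_mul_of_nonneg_left (hp.bdd z t) (by linarith [hw.κ_pos]))) (hw.pos _).le)
  have hi0 := (hk_mul_integrable (l := l) 0 hs0 hw.integrable).1
  have hiω : Integrable fun z => hk l 0 s1 z * ω (z l - ξ z t) := by
    refine (hi0.const_mul B).mono'
      (hkc.mul (hωc.comp (by fun_prop))).aestronglyMeasurable (ae_of_all _ fun z => ?_)
    have hk0 := hk_pos (l := l) 0 s1 z
    have hω0 := hw.pos (z l - ξ z t)
    rw [Real.norm_of_nonneg (by positivity)]
    have := mul_le_mul_of_nonneg_left (hωB z) hk0.le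
    linarith
  have hisq : ∀ u : ℝ, Integrable fun z => hk l 0 s1 z * (ω (z l - ξ z t) * (ξ z t - u) ^ 2) := by
    intro u
    refine (hiω.const_mul ((R + |u|) ^ 2)).mono'
      (hkc.mul ((hωc.comp (by fun_prop)).mul (by fun_prop))).aestronglyMeasurable
      (ae_of_all _ fun z => ?_)
    have hk0 := hk_pos (l := l) 0 s1 z
    have hω0 := hw.pos (z l - ξ z t)
    rw [Real.norm_of_nonneg (by positivity)]
    have h1 : (ξ z t - u) ^ 2 ≤ (R + |u|) ^ 2 := by
      rw [← sq_abs (ξ z t - u)]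
      refine pow_le_pow_left₀ (abs_nonneg _) ?_ 2
      linarith [abs_sub (ξ z t) u, hp.bdd z t]
    have := mul_le_mul_of_nonneg_left h1 (mul_pos hk0 hω0).le
    linarith
  have hnn : ∀ u z, 0 ≤ hk l 0 s1 z * (ω (z l - ξ z t) * (ξ z t - u) ^ 2) := fun u z =>
    mul_nonneg (hk_pos _ _ _).le (mul_nonneg (hw.pos _).le (sq_nonneg _))
  have hle : ∀ n, ∫ z, hk l 0 s1 z * (ω (z l - ξ z t) * (ξ z t - c₀) ^ 2) ≤
      2 * (1 / ((g n : ℝ) + 1)) +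
        2 * (c (g n) - c₀) ^ 2 * ∫ z, hk l 0 s1 z * ω (z l - ξ z t) := by
    intro n
    have h1 := integral_mono (hisq c₀)
      (((hisq (c (g n))).const_mul 2).add (hiω.const_mul (2 * (c (g n) - c₀) ^ 2))) fun z => by
        have h2 : (ξ z t - c₀) ^ 2 ≤ 2 * (ξ z t - c (g n)) ^ 2 + 2 * (c (g n) - c₀) ^ 2 := by
          nlinarith [sq_nonneg (ξ z t - c (g n) - (c (g n) - c₀))]
        have h3 := mul_le_mul_of_nonneg_left h2
          (mul_pos (hk_pos (l := l) 0 s1 z) (hw.pos (z l - ξ z t))).le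
        change hk l 0 s1 z * (ω (z l - ξ z t) * (ξ z t - c₀) ^ 2) ≤
          2 * (hk l 0 s1 z * (ω (z l - ξ z t) * (ξ z t - c (g n)) ^ 2)) +
            2 * (c (g n) - c₀) ^ 2 * (hk l 0 s1 z * ω (z l - ξ z t))
        linarith
    rw [integral_add' ((hisq (c (g n))).const_mul 2) (hiω.const_mul (2 * (c (g n) - c₀) ^ 2)),
      integral_const_mul, integral_const_mul] at h1
    linarith [hc (g n) 0 t]
  have hlim0 : Tendsto (fun n => 2 * (1 / ((g n : ℝ) + 1)) +
      2 * (c (g n) - c₀) ^ 2 * ∫ z, hk l 0 s1 z * ω (z l - ξ z t)) atTop (nhds 0) := by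
    have e1 : Tendsto (fun n => 1 / ((g n : ℝ) + 1)) atTop (nhds 0) :=
      (tendsto_one_div_add_atTop_nhds_zero_nat (𝕜 := ℝ)).comp hg.tendsto_atTop
    have e2 : Tendsto (fun n => c (g n) - c₀) atTop (nhds 0) := by
      simpa using hlim.sub_const c₀
    have := (e1.const_mul 2).add (((e2.pow 2).const_mul 2).mul_const
      (∫ z, hk l 0 s1 z * ω (z l - ξ z t)))
    simpa using this
  have hzero : ∫ z, hk l 0 s1 z * (ω (z l - ξ z t) * (ξ z t - c₀) ^ 2) = 0 :=
    le_antisymm (ge_of_tendsto' hlim0 hle) (integral_nonneg (hnn c₀))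
  rw [integral_eq_zero_iff_of_nonneg (hnn c₀) (hisq c₀)] at hzero
  have hcont : Continuous fun z => hk l 0 s1 z * (ω (z l - ξ z t) * (ξ z t - c₀) ^ 2) :=
    hkc.mul ((hωc.comp (by fun_prop)).mul (by fun_prop))
  have hev := congrFun ((hcont.ae_eq_iff_eq volume continuous_const).1 hzero) z
  have hk0 := hk_pos (l := l) 0 s1 z
  have hω0 := hw.pos (z l - ξ z t)
  have : (ξ z t - c₀) ^ 2 = 0 := by
    rcases mul_eq_zero.1 hev with h | h
    · exact absurd h hk0.ne'
    · exact (mul_eq_zero.1 h).resolve_left hω0.ne'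
  linarith [pow_eq_zero_iff (two_ne_zero) |>.1 this]

end IsPhase

end Rigidity

/-- Rigidity of bounded eternal solutions of
`w_τ = Δφ(w) + f(w)` on `ℝ^N × ℝ` connecting `α₋` (uniformly as
`z^{(N)} → -∞`) to `α₊` (uniformly as `z^{(N)} → +∞`): such a solution is a
translate of the standing wave, `w(z,τ) = U₀(z^{(N)} - z*)`. -/
theorem eternal_solution_rigidity
    (N : ℕ) (hN : 2 ≤ N)
    (f : ℝ → ℝ) (αm αc αp : ℝ)
    (hf : ContDiff ℝ 2 f)
    (hαs : αm < αc ∧ αc < αp)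
    (hzeros : ∀ s : ℝ, f s = 0 ↔ s = αm ∨ s = αc ∨ s = αp)
    (hfm : deriv f αm < 0) (hfp : deriv f αp < 0) (hfc : 0 < deriv f αc)
    (hfbelow : ∀ s : ℝ, s < αm → 0 < f s) (hfabove : ∀ s : ℝ, αp < s → f s < 0)
    (φ : ℝ → ℝ) (Cφ : ℝ) (hCφ : 0 < Cφ)
    (hφ : ContDiff ℝ 4 φ) (hφ' : ∀ s : ℝ, Cφ ≤ deriv φ s)
    (hbal : ∫ s in αm..αp, deriv φ s * f s = 0)
    (U0 : ℝ → ℝ)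
    (hU0mono : StrictMono U0)
    (hU0C2 : ContDiff ℝ 2 U0)
    (hU0ode : ∀ z : ℝ, deriv (deriv (fun y => φ (U0 y))) z + f (U0 z) = 0)
    (hU0m : Tendsto U0 atBot (nhds αm)) (hU0c : U0 0 = αc)
    (hU0p : Tendsto U0 atTop (nhds αp))
    (w : EuclideanSpace ℝ (Fin N) → ℝ → ℝ)
    (hwbdd : ∃ M : ℝ, ∀ (z : EuclideanSpace ℝ (Fin N)) (τ : ℝ), |w z τ| ≤ M)
    (hwC2 : ∀ τ : ℝ, ContDiff ℝ 2 (fun z => w z τ))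
    (hwC1 : ∀ z : EuclideanSpace ℝ (Fin N), ContDiff ℝ 1 (fun τ => w z τ))
    (hweq : ∀ (z : EuclideanSpace ℝ (Fin N)) (τ : ℝ),
      deriv (fun s => w z s) τ = lap (fun y => φ (w y τ)) z + f (w z τ))
    (hwlimm : ∀ δ : ℝ, 0 < δ → ∃ R : ℝ,
      ∀ (z : EuclideanSpace ℝ (Fin N)) (τ : ℝ),
        z ⟨N - 1, by omega⟩ ≤ -R → |w z τ - αm| < δ)
    (hwlimp : ∀ δ : ℝ, 0 < δ → ∃ R : ℝ,
      ∀ (z : EuclideanSpace ℝ (Fin N)) (τ : ℝ),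
        R ≤ z ⟨N - 1, by omega⟩ → |w z τ - αp| < δ) :
    ∃ zstar : ℝ, ∀ (z : EuclideanSpace ℝ (Fin N)) (τ : ℝ),
      w z τ = U0 (z ⟨N - 1, by omega⟩ - zstar) := by
  obtain ⟨M, hM⟩ := hwbdd
  have hs : IsSol φ f Cφ (max M (max |αm| |αp|)) w :=
    ⟨hCφ, hφ, hφ', hf, fun z t => (hM z t).trans (le_max_left _ _), hwC2, hwC1, hweq⟩
  have hU : IsWave φ f αm αp U0 := ⟨hU0mono, hU0C2, hU0ode, hU0m, hU0p⟩
  have hMm : |αm| ≤ max M (max |αm| |αp|) := (le_max_left _ _).trans (le_max_right _ _)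
  have hMp : |αp| ≤ max M (max |αm| |αp|) := (le_max_right _ _).trans (le_max_right _ _)
  obtain ⟨R₁, hup⟩ := hs.le_wave hU hMm hMp hfm hfp ((hzeros αp).2 (by simp)) hfabove hwlimm
  obtain ⟨R₂, hlow⟩ := hs.wave_le hU hMm hMp hfm hfp ((hzeros αm).2 (by simp)) hfbelow hwlimp
  obtain ⟨hpos, Γ, κ, h0, h1, θ, CΓ, hweight⟩ :=
    IsWave.exists_isWeight hCφ hφ hφ' hf hfm hfp hU
  obtain ⟨ξ, hphase, hwξ⟩ := hs.exists_phase hU hpos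
    (hlow _ (le_max_right R₁ R₂)) (hup _ (le_max_left R₁ R₂))
  obtain ⟨zstar, hconst⟩ := hphase.exists_forall_eq hweight
  exact ⟨zstar, fun z t => by rw [hwξ, hconst]⟩
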